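/- Let n = rm → ∞, where m = m(n) ≥ 1 and r = r(n) ≥ 3 are integers, and let d = d(n) be any integer sequence with 0 ≤ d ≤ m^{r−1}. Then H_r(d,m) = (1+o(1))·Ĥ_r(d,m), i.e., the ratio H_r(d,m)/Ĥ_r(d,m) tends to 1 as n → ∞. -/

import Mathlib

open Filter

/-- `Hcount r m d` is the number of `d`-regular `(r,r)`-graphs with classes of size `m`:
subsets `E` of `(Fin m)^r` (each element an edge with one vertex in each class) such that
for every class index `t` and vertex `v`, exactly `d` edges `e ∈ E` have `e t = v`. -/
noncomputable def Hcount (r m d : ℕ) : ℕ :=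
  Nat.card {E : Finset (Fin r → Fin m) //
    ∀ t : Fin r, ∀ v : Fin m, (E.filter (fun e => e t = v)).card = d}

/-- The heuristic estimate `Ĥ_r(d,m) = C(m^(r-1), d)^(r*m) / C(m^r, m*d)^(r-1)`. -/
noncomputable def Hhat (r m d : ℕ) : ℝ :=
  (((m ^ (r - 1)).choose d : ℝ)) ^ (r * m) / (((m ^ r).choose (m * d) : ℝ)) ^ (r - 1)

set_option linter.unusedSectionVars false

section Switching

variable {ι : Type*} [Fintype ι] [DecidableEq ι] {m : ℕ}

/-- Number of edges of `E` whose vertex in class `s` is `v`. -/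
def vdeg (E : Finset (ι → Fin m)) (s : ι) (v : Fin m) : ℕ :=
  (E.filter (fun e => e s = v)).card

/-- Edge sets regular of degree `d` in the classes of `A`, with degrees `D` in class `c`. -/
def degFam (A : Finset ι) (d : ℕ) (c : ι) (D : Fin m → ℕ) : Finset (Finset (ι → Fin m)) :=
  Finset.univ.filter (fun E => (∀ s ∈ A, ∀ v, vdeg E s v = d) ∧ ∀ v, vdeg E c v = D v)

/-- Number of edges through `u` in class `c` that stay in `E` when `u` is replaced by `v`. -/
def codeg (E : Finset (ι → Fin m)) (c : ι) (u v : Fin m) : ℕ :=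
  (E.filter (fun e => e c = u ∧ Function.update e c v ∈ E)).card

theorem sum_ite_eq_sum_filter_ite {α : Type*} [Fintype α] [DecidableEq α] (S : Finset α)
    (p : α → Prop) [DecidablePred p] (f : α → ℝ) :
    ∑ x ∈ S, (if p x then f x else 0) = ∑ x with p x, (if x ∈ S then f x else 0) := by
  rw [← Finset.sum_filter, ← Finset.sum_filter]
  congr 1
  ext x
  simp [and_comm]

theorem sum_switch {α : Type*} [Fintype α] [DecidableEq α] (P Q : Finset α) (hPQ : Disjoint P Q)
    (f g : Finset α → ℝ)
    (h : ∀ E, P ⊆ E → Disjoint Q E → f E = g ((E \ P) ∪ Q)) :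
    ∑ E with (P ⊆ E ∧ Disjoint Q E), f E = ∑ E with (Q ⊆ E ∧ Disjoint P E), g E := by
  refine Finset.sum_bij' (fun E _ => (E \ P) ∪ Q) (fun E _ => (E \ Q) ∪ P) ?_ ?_ ?_ ?_ ?_
  · intro E hE
    simp only [Finset.mem_filter, Finset.mem_univ, true_and] at hE ⊢
    refine ⟨Finset.subset_union_right, ?_⟩
    rw [Finset.disjoint_union_right]
    exact ⟨Finset.disjoint_sdiff, hPQ⟩
  · intro E hE
    simp only [Finset.mem_filter, Finset.mem_univ, true_and] at hE ⊢
    refine ⟨Finset.subset_union_right, ?_⟩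
    rw [Finset.disjoint_union_right]
    exact ⟨Finset.disjoint_sdiff, hPQ.symm⟩
  · intro E hE
    simp only [Finset.mem_filter, Finset.mem_univ, true_and] at hE ⊢
    ext x
    have h1 := @hE.1 x
    have h2 : x ∈ Q → x ∉ E := fun a b => Finset.disjoint_left.1 hE.2 a b
    have h3 : x ∈ P → x ∉ Q := fun a b => Finset.disjoint_left.1 hPQ a b
    simp only [Finset.mem_union, Finset.mem_sdiff]
    tauto
  · intro E hE
    simp only [Finset.mem_filter, Finset.mem_univ, true_and] at hE ⊢
    ext x
    have h1 := @hE.1 x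
    have h2 : x ∈ P → x ∉ E := fun a b => Finset.disjoint_left.1 hE.2 a b
    have h3 : x ∈ P → x ∉ Q := fun a b => Finset.disjoint_left.1 hPQ a b
    simp only [Finset.mem_union, Finset.mem_sdiff]
    tauto
  · intro E hE
    simp only [Finset.mem_filter, Finset.mem_univ, true_and] at hE
    exact h E hE.1 hE.2

theorem vdeg_switch {E P Q : Finset (ι → Fin m)} (hP : P ⊆ E) (hQ : Disjoint Q E) (s : ι)
    (v : Fin m) : vdeg ((E \ P) ∪ Q) s v + vdeg P s v = vdeg E s v + vdeg Q s v := by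
  unfold vdeg
  rw [Finset.filter_union, Finset.card_union_of_disjoint, add_right_comm,
    ← Finset.card_union_of_disjoint, ← Finset.filter_union, Finset.sdiff_union_of_subset hP]
  · exact Finset.disjoint_filter_filter Finset.sdiff_disjoint
  · exact Finset.disjoint_filter_filter (hQ.symm.mono_left Finset.sdiff_subset)

theorem vdeg_singleton (x : ι → Fin m) (s : ι) (v : Fin m) :
    vdeg {x} s v = if x s = v then 1 else 0 := by
  unfold vdeg
  rw [Finset.filter_singleton]
  split_ifs <;> simp

theorem codeg_le (E : Finset (ι → Fin m)) (c : ι) (u v : Fin m) : codeg E c u v ≤ vdeg E c u :=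
  Finset.card_le_card (Finset.monotone_filter_right _ (fun _ _ h => h.1))

theorem codeg_comm (E : Finset (ι → Fin m)) (c : ι) (u v : Fin m) :
    codeg E c u v = codeg E c v u := by
  unfold codeg
  refine Finset.card_bij' (fun e _ => Function.update e c v) (fun e _ => Function.update e c u)
    ?_ ?_ ?_ ?_
  · intro e he
    simp only [Finset.mem_filter] at he ⊢
    refine ⟨he.2.2, by simp, ?_⟩
    rw [Function.update_idem, ← he.2.1, Function.update_eq_self]
    exact he.1
  · intro e he
    simp only [Finset.mem_filter] at he ⊢
    refine ⟨he.2.2, by simp, ?_⟩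
    rw [Function.update_idem, ← he.2.1, Function.update_eq_self]
    exact he.1
  · intro e he
    simp only [Finset.mem_filter] at he ⊢
    rw [Function.update_idem, ← he.2.1, Function.update_eq_self]
  · intro e he
    simp only [Finset.mem_filter] at he ⊢
    rw [Function.update_idem, ← he.2.1, Function.update_eq_self]

theorem card_single_add_codeg (E : Finset (ι → Fin m)) (c : ι) (u v : Fin m) :
    (E.filter (fun e => e c = u ∧ Function.update e c v ∉ E)).card + codeg E c u v
      = vdeg E c u := by
  unfold codeg vdeg
  rw [add_comm, ← Finset.filter_filter, ← Finset.filter_filter]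
  exact Finset.card_filter_add_card_filter_not (s := E.filter (fun e => e c = u))
    (fun e => Function.update e c v ∈ E)

theorem codeg_switch {E : Finset (ι → Fin m)} {c : ι} {u v : Fin m} (huv : u ≠ v)
    {x : ι → Fin m} (hx : x ∈ E) (hxc : x c = v) (hy : Function.update x c u ∉ E) :
    codeg ((E \ {x}) ∪ {Function.update x c u}) c u v = codeg E c u v := by
  unfold codeg
  congr 1
  ext e
  simp only [Finset.mem_filter, Finset.mem_union, Finset.mem_sdiff, Finset.mem_singleton]
  have hxx : Function.update (Function.update x c u) c v = x := by
    rw [Function.update_idem, ← hxc, Function.update_eq_self]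
  have hvu : ∀ e : ι → Fin m, Function.update e c v ≠ Function.update x c u := by
    intro e he
    have := congrFun he c
    simp at this
    exact huv this.symm
  constructor
  · rintro ⟨h1, h2, h3⟩
    rcases h3 with h3 | h3
    · rcases h1 with h1 | h1
      · exact ⟨h1.1, h2, h3.1⟩
      · exfalso
        subst h1
        exact h3.2 hxx
    · exact absurd h3 (hvu e)
  · rintro ⟨h1, h2, h3⟩
    refine ⟨Or.inl ⟨h1, ?_⟩, h2, Or.inl ⟨h3, ?_⟩⟩
    · rintro rfl
      exact huv (h2.symm.trans hxc)
    · intro h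
      apply hy
      rw [← h, Function.update_idem, ← h2, Function.update_eq_self]
      exact h1

theorem vdeg_update_pair {c : ι} {x : ι → Fin m} {u : Fin m} {s : ι} (hs : s ≠ c) (v : Fin m) :
    vdeg {Function.update x c u} s v = vdeg {x} s v := by
  rw [vdeg_singleton, vdeg_singleton, Function.update_of_ne hs]

theorem sum_codeg_switch (A : Finset ι) (d : ℕ) {c : ι} (hc : c ∉ A) {u v : Fin m} (huv : u ≠ v)
    {D D' : Fin m → ℕ} (hu : D u = D' u + 1) (hv : D' v = D v + 1)
    (hD : ∀ x, x ≠ u → x ≠ v → D x = D' x) (ψ : ℕ → ℝ) :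
    ∑ E ∈ degFam A d c D, ψ (codeg E c u v) * ((D u : ℝ) - codeg E c u v)
      = ∑ E ∈ degFam A d c D', ψ (codeg E c u v) * ((D' v : ℝ) - codeg E c u v) := by
  have key : ∀ x : ι → Fin m, x c = v →
      ∑ E with ({x} ⊆ E ∧ Disjoint {Function.update x c u} E),
        (if E ∈ degFam A d c D' then ψ (codeg E c u v) else 0)
      = ∑ E with ({Function.update x c u} ⊆ E ∧ Disjoint {x} E),
        (if E ∈ degFam A d c D then ψ (codeg E c u v) else 0) := by
    intro x hx
    have hne : x ≠ Function.update x c u := by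
      intro h
      have := congrFun h c
      rw [hx] at this
      simp at this
      exact huv this.symm
    apply sum_switch
    · simpa using hne
    · intro E hP hQ
      have hQ' := hQ
      simp only [Finset.singleton_subset_iff, Finset.disjoint_singleton_left] at hP hQ
      rw [codeg_switch huv hP hx hQ]
      congr 1
      have hdeg := vdeg_switch (Finset.singleton_subset_iff.2 hP) hQ'
      simp only [degFam, Finset.mem_filter, Finset.mem_univ, true_and, eq_iff_iff]
      apply and_congr
      · refine forall₂_congr fun s hs => forall_congr' fun z => ?_
        have h := hdeg s z
        rw [vdeg_update_pair (show s ≠ c by rintro rfl; exact hc hs)] at h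
        rw [Nat.add_right_cancel h]
      · refine forall_congr' fun z => ?_
        have h := hdeg c z
        simp only [vdeg_singleton, hx, Function.update_self] at h
        by_cases hzu : z = u
        · subst hzu
          rw [if_neg huv.symm, if_pos rfl] at h
          omega
        · by_cases hzv : z = v
          · subst hzv
            rw [if_pos rfl, if_neg huv] at h
            omega
          · rw [if_neg (Ne.symm hzv), if_neg (Ne.symm hzu)] at h
            have := hD z hzu hzv
            omega
  have hR : ∀ E ∈ degFam A d c D', ψ (codeg E c u v) * ((D' v : ℝ) - codeg E c u v)
      = ∑ x with x c = v, if ({x} ⊆ E ∧ Disjoint {Function.update x c u} E)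
          then ψ (codeg E c u v) else 0 := by
    intro E hE
    have h1 := card_single_add_codeg E c v u
    rw [codeg_comm, ((Finset.mem_filter.1 hE).2.2 v)] at h1
    rw [← h1, ← Finset.sum_filter, Finset.sum_const, Finset.filter_filter, nsmul_eq_mul]
    push_cast
    rw [add_sub_cancel_right, mul_comm]
    congr 3
    ext e
    simp only [Finset.mem_filter, Finset.mem_univ, true_and, Finset.singleton_subset_iff,
      Finset.disjoint_singleton_left]
    tauto
  have hL : ∀ E ∈ degFam A d c D, ψ (codeg E c u v) * ((D u : ℝ) - codeg E c u v)
      = ∑ x with x c = v, if ({Function.update x c u} ⊆ E ∧ Disjoint {x} E)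
          then ψ (codeg E c u v) else 0 := by
    intro E hE
    have h1 := card_single_add_codeg E c u v
    rw [((Finset.mem_filter.1 hE).2.2 u)] at h1
    rw [← h1, ← Finset.sum_filter, Finset.sum_const, Finset.filter_filter, nsmul_eq_mul]
    push_cast
    rw [add_sub_cancel_right, mul_comm]
    congr 2
    refine Finset.card_bij' (fun e _ => Function.update e c v) (fun e _ => Function.update e c u)
      ?_ ?_ ?_ ?_
    · intro e he
      simp only [Finset.mem_filter, Finset.mem_univ, true_and, Finset.singleton_subset_iff,
        Finset.disjoint_singleton_left] at he ⊢
      refine ⟨by simp, ?_, he.2.2⟩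
      rw [Function.update_idem, ← he.2.1, Function.update_eq_self]
      exact he.1
    · intro e he
      simp only [Finset.mem_filter, Finset.mem_univ, true_and, Finset.singleton_subset_iff,
        Finset.disjoint_singleton_left] at he ⊢
      refine ⟨he.2.1, by simp, ?_⟩
      rw [Function.update_idem, ← he.1, Function.update_eq_self]
      exact he.2.2
    · intro e he
      simp only [Finset.mem_filter] at he ⊢
      rw [Function.update_idem, ← he.2.1, Function.update_eq_self]
    · intro e he
      simp only [Finset.mem_filter] at he ⊢
      rw [Function.update_idem, ← he.2.1, Function.update_eq_self]
  rw [Finset.sum_congr rfl hL, Finset.sum_congr rfl hR, Finset.sum_comm, Finset.sum_comm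
    (s := degFam A d c D')]
  refine Finset.sum_congr rfl fun x hx => ?_
  exact (sum_ite_eq_sum_filter_ite _ _ _).trans ((key x (Finset.mem_filter.1 hx).2).symm.trans
    (sum_ite_eq_sum_filter_ite _ _ _).symm)

theorem codeg_le_of_mem {A : Finset ι} {d : ℕ} {c : ι} {D : Fin m → ℕ} {E : Finset (ι → Fin m)}
    (hE : E ∈ degFam A d c D) (u v : Fin m) : codeg E c u v ≤ D u ∧ codeg E c u v ≤ D v := by
  have h := (Finset.mem_filter.1 hE).2.2
  exact ⟨h u ▸ codeg_le E c u v, h v ▸ codeg_comm E c u v ▸ codeg_le E c v u⟩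

/-- Total codegree of the columns `u` and `v` over a family with prescribed degrees. -/
noncomputable def totalCodeg (A : Finset ι) (d : ℕ) (c : ι) (D : Fin m → ℕ) (u v : Fin m) : ℝ :=
  ∑ E ∈ degFam A d c D, (codeg E c u v : ℝ)

theorem card_mul_sub_totalCodeg (A : Finset ι) (d : ℕ) {c : ι} (hc : c ∉ A) {u v : Fin m}
    (huv : u ≠ v) {D D' : Fin m → ℕ} (hu : D u = D' u + 1) (hv : D' v = D v + 1)
    (hD : ∀ x, x ≠ u → x ≠ v → D x = D' x) :
    ((degFam A d c D).card : ℝ) * D u - totalCodeg A d c D u v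
      = (degFam A d c D').card * D' v - totalCodeg A d c D' u v := by
  have h := sum_codeg_switch A d hc huv hu hv hD (fun _ => 1)
  simp only [one_mul, Finset.sum_sub_distrib, Finset.sum_const, nsmul_eq_mul] at h
  exact h

theorem card_degFam_le_of_step (A : Finset ι) (d : ℕ) {c : ι} (hc : c ∉ A) {u v : Fin m}
    (huv : u ≠ v) {D D' : Fin m → ℕ} (hu : D u = D' u + 1) (hv : D' v = D v + 1)
    (hD : ∀ x, x ≠ u → x ≠ v → D x = D' x) (hle : D' v ≤ D' u) :
    (degFam A d c D).card ≤ (degFam A d c D').card := by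
  have h := sum_codeg_switch A d hc huv hu hv hD (fun j => ((D u : ℝ) - j)⁻¹)
  have h1 : ∑ E ∈ degFam A d c D, ((D u : ℝ) - codeg E c u v)⁻¹ * ((D u : ℝ) - codeg E c u v)
      = (degFam A d c D).card := by
    rw [Finset.card_eq_sum_ones, Nat.cast_sum]
    refine Finset.sum_congr rfl fun E hE => ?_
    have hlt : codeg E c u v < D u := by
      have := (codeg_le_of_mem hE u v).2
      omega
    have : (codeg E c u v : ℝ) < D u := by exact_mod_cast hlt
    rw [inv_mul_cancel₀ (by linarith)]
    simp
  have h2 : ∑ E ∈ degFam A d c D', ((D u : ℝ) - codeg E c u v)⁻¹ * ((D' v : ℝ) - codeg E c u v)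
      ≤ (degFam A d c D').card := by
    rw [Finset.card_eq_sum_ones, Nat.cast_sum]
    refine Finset.sum_le_sum fun E hE => ?_
    have hlt : codeg E c u v < D u := by
      have := (codeg_le_of_mem hE u v).1
      omega
    have h3 : (codeg E c u v : ℝ) < D u := by exact_mod_cast hlt
    have h4 : (D' v : ℝ) ≤ D u := by exact_mod_cast (by omega : D' v ≤ D u)
    rw [inv_mul_le_iff₀ (by linarith)]
    simp only [Nat.cast_one]
    linarith
  have : ((degFam A d c D).card : ℝ) ≤ (degFam A d c D').card := by
    rw [← h1, h]
    exact h2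
  exact_mod_cast this

end Switching

section PairSwitching

variable {ι : Type*} [Fintype ι] [DecidableEq ι] {m : ℕ}

open Function (update)

theorem update_update_of_eq {x : ι → Fin m} {s : ι} {α β : Fin m} (h : x s = α) :
    update (update x s β) s α = x := by
  rw [Function.update_idem, ← h, Function.update_eq_self]

theorem vdeg_pair {y z : ι → Fin m} (h : y ≠ z) (t : ι) (w : Fin m) :
    vdeg {y, z} t w = vdeg {y} t w + vdeg {z} t w := by
  simp only [vdeg_singleton]
  unfold vdeg
  rw [Finset.filter_insert, Finset.filter_singleton]
  split_ifs <;> simp [h]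

theorem card_single_pos {A : Finset ι} {d : ℕ} {c : ι} {D : Fin m → ℕ} {E : Finset (ι → Fin m)}
    (hE : E ∈ degFam A d c D) {s : ι} (hs : s ∈ A) {α β : Fin m}
    (hβ : ∃ z ∈ E, z s = β ∧ update z s α ∉ E) : 0 < (d : ℝ) - codeg E s α β := by
  obtain ⟨z, hz, hzβ, hzα⟩ := hβ
  have h := card_single_add_codeg E s β α
  rw [(Finset.mem_filter.1 hE).2.1 s hs β, codeg_comm] at h
  have h2 : 0 < (E.filter (fun e => e s = β ∧ update e s α ∉ E)).card :=
    Finset.card_pos.2 ⟨z, Finset.mem_filter.2 ⟨hz, hzβ, hzα⟩⟩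
  rw [sub_pos]
  exact_mod_cast (by omega : codeg E s α β < d)

theorem card_single_eq {A : Finset ι} {d : ℕ} {c : ι} {D : Fin m → ℕ} {E : Finset (ι → Fin m)}
    (hE : E ∈ degFam A d c D) {s : ι} (hs : s ∈ A) (α β : Fin m) :
    ((E.filter (fun e => e s = α ∧ update e s β ∉ E)).card : ℝ) = d - codeg E s α β := by
  rw [eq_sub_iff_add_eq, ← (Finset.mem_filter.1 hE).2.1 s hs α]
  exact_mod_cast card_single_add_codeg E s α β

/-- Swapping the line of `y` alone, in a class without degree constraint. -/
theorem sum_switch_free (A : Finset ι) (d : ℕ) {c : ι} (D : Fin m → ℕ) {s : ι}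
    (hs : s ∉ A) (hsc : s ≠ c) {α β : Fin m} (hαβ : α ≠ β) {x y : ι → Fin m} (hxy : x c ≠ y c)
    (hy : y s = α) :
    ∑ E ∈ degFam A d c D, (if x ∈ E ∧ y ∈ E ∧ update y s β ∉ E then (1 : ℝ) else 0)
      = ∑ E ∈ degFam A d c D, (if x ∈ E ∧ update y s β ∈ E ∧ y ∉ E then (1 : ℝ) else 0) := by
  have hne : y ≠ update y s β := fun h => hαβ (by rw [← hy, h]; simp)
  have hx1 : x ≠ y := fun h => hxy (congrFun h c)
  have hx2 : x ≠ update y s β := fun h => hxy (by rw [h, Function.update_of_ne hsc.symm])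
  have key := sum_switch {y} {update y s β} (by simpa using hne)
    (fun E => if E ∈ degFam A d c D ∧ x ∈ E then (1 : ℝ) else 0)
    (fun E => if E ∈ degFam A d c D ∧ x ∈ E then (1 : ℝ) else 0) (by
      intro E hP hQ
      congr 1
      have hdeg := vdeg_switch hP hQ
      simp only [degFam, Finset.mem_filter, Finset.mem_univ, true_and, eq_iff_iff]
      refine and_congr (and_congr ?_ ?_) ?_
      · refine forall₂_congr fun t ht => forall_congr' fun z => ?_
        have h := hdeg t z
        rw [vdeg_update_pair (show t ≠ s by rintro rfl; exact hs ht)] at h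
        rw [Nat.add_right_cancel h]
      · refine forall_congr' fun z => ?_
        have h := hdeg c z
        rw [vdeg_update_pair hsc.symm] at h
        rw [Nat.add_right_cancel h]
      · simp [hx1, hx2])
  simp only [← Finset.sum_filter, Finset.filter_filter] at key ⊢
  convert key using 2
  · ext E
    simp only [Finset.mem_filter, Finset.mem_univ, true_and, Finset.singleton_subset_iff,
      Finset.disjoint_singleton_left]
    tauto
  · ext E
    simp only [Finset.mem_filter, Finset.mem_univ, true_and, Finset.singleton_subset_iff,
      Finset.disjoint_singleton_left]
    tauto

theorem codeg_switch_pair {E : Finset (ι → Fin m)} {s : ι} {α β : Fin m} (hαβ : α ≠ β)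
    {y z : ι → Fin m} (hy : y s = α) (hz : z s = β) (hyE : y ∈ E) (hzE : z ∈ E)
    (hyE' : update y s β ∉ E) (hzE' : update z s α ∉ E) :
    codeg ((E \ {y, z}) ∪ {update y s β, update z s α}) s α β = codeg E s α β := by
  have hyz : y ≠ z := fun h => hαβ (by rw [← hy, h, hz])
  have hzy : z ≠ update y s β := fun h => hyE' (h ▸ hzE)
  have h1 := codeg_switch hαβ.symm hyE hy hyE'
  have h2 := codeg_switch (E := (E \ {y}) ∪ {update y s β}) hαβ (x := z) (c := s)
    (by simp [hzE, hyz.symm]) hz (by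
      simp only [Finset.mem_union, Finset.mem_sdiff, hzE', false_and, Finset.mem_singleton,
        false_or]
      intro h
      have := congrFun h s
      simp at this
      exact hαβ this)
  rw [codeg_comm, codeg_comm E] at h1
  rw [← h1, ← h2]
  congr 1
  ext e
  simp only [Finset.mem_union, Finset.mem_sdiff, Finset.mem_insert, Finset.mem_singleton]
  have : e = update y s β → e ≠ z := fun h h' => hzy (h' ▸ h)
  tauto

theorem mem_degFam_switch_pair {A : Finset ι} {d : ℕ} {c : ι} {D : Fin m → ℕ} {s : ι}
    {α β : Fin m} (hαβ : α ≠ β) {y z : ι → Fin m} (hy : y s = α) (hz : z s = β)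
    {E : Finset (ι → Fin m)} (hP : {y, z} ⊆ E) (hQ : Disjoint {update y s β, update z s α} E) :
    E ∈ degFam A d c D ↔
      (E \ {y, z}) ∪ {update y s β, update z s α} ∈ degFam A d c D := by
  have hyz : y ≠ z := fun h => hαβ (by rw [← hy, h, hz])
  have hyz' : update y s β ≠ update z s α := fun h => hαβ (by
    have := congrFun h s
    simp at this
    exact this.symm)
  have hdeg : ∀ t w, vdeg ((E \ {y, z}) ∪ {update y s β, update z s α}) t w = vdeg E t w := by
    intro t w
    have h := vdeg_switch hP hQ t w
    rw [vdeg_pair hyz, vdeg_pair hyz'] at h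
    by_cases hts : t = s
    · subst hts
      simp only [vdeg_singleton, Function.update_self, hy, hz] at h
      omega
    · rw [vdeg_update_pair hts, vdeg_update_pair hts] at h
      omega
  simp only [degFam, Finset.mem_filter, Finset.mem_univ, true_and, hdeg]

/-- Swapping the line of `y` together with a balancing line, in a regular class. -/
theorem sum_switch_regular (A : Finset ι) (d : ℕ) {c : ι} (D : Fin m → ℕ) {s : ι}
    (hs : s ∈ A) (hsc : s ≠ c) {α β : Fin m} (hαβ : α ≠ β) {x y : ι → Fin m} (hxy : x c ≠ y c)
    (hx : x s = α) (hy : y s = α) :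
    ∑ E ∈ degFam A d c D, (if x ∈ E ∧ y ∈ E ∧ update y s β ∉ E then (1 : ℝ) else 0)
      = ∑ E ∈ degFam A d c D, (if x ∈ E ∧ update y s β ∈ E ∧ y ∉ E then
          1 - (if update x s β ∉ E then ((d : ℝ) - codeg E s α β)⁻¹ else 0) else 0) := by
  have hne : y ≠ update y s β := fun h => hαβ (by rw [← hy, h]; simp)
  have hx1 : x ≠ y := fun h => hxy (congrFun h c)
  have hx2 : x ≠ update y s β := fun h => hxy (by rw [h, Function.update_of_ne hsc.symm])
  set w : Finset (ι → Fin m) → ℝ := fun E => ((d : ℝ) - codeg E s α β)⁻¹ with hw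
  have key : ∀ z : ι → Fin m, z s = β →
      ∑ E with ({y, z} ⊆ E ∧ Disjoint {update y s β, update z s α} E),
        (if E ∈ degFam A d c D ∧ x ∈ E ∧ x ≠ update z s α then w E else 0)
      = ∑ E with ({update y s β, update z s α} ⊆ E ∧ Disjoint {y, z} E),
        (if E ∈ degFam A d c D ∧ x ∈ E ∧ x ≠ update z s α then w E else 0) := by
    intro z hz
    by_cases hzy : z = update y s β
    · rw [Finset.filter_false_of_mem, Finset.filter_false_of_mem]
      · intro E _ h
        rw [Finset.insert_subset_iff, Finset.disjoint_insert_left,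
          Finset.disjoint_singleton_left] at h
        exact h.2.2 (hzy ▸ h.1.1)
      · intro E _ h
        rw [Finset.insert_subset_iff, Finset.disjoint_insert_left,
          Finset.singleton_subset_iff] at h
        exact h.2.1 (hzy ▸ h.1.2)
    refine sum_switch {y, z} {update y s β, update z s α} ?_ _ _ ?_
    · have h1 : z ≠ update z s α := fun h => hαβ (by rw [← hz, h]; simp)
      have h2 : y ≠ update z s α := by
        rintro rfl
        exact hzy (update_update_of_eq hz).symm
      simp only [Finset.disjoint_insert_left, Finset.disjoint_singleton_left, Finset.mem_insert,
        Finset.mem_singleton]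
      tauto
    · intro E hP hQ
      have hP' := hP
      have hQ' := hQ
      rw [Finset.insert_subset_iff, Finset.singleton_subset_iff] at hP'
      rw [Finset.disjoint_insert_left, Finset.disjoint_singleton_left] at hQ'
      simp only [hw]
      rw [codeg_switch_pair hαβ hy hz hP'.1 hP'.2 hQ'.1 hQ'.2]
      congr 1
      rw [eq_iff_iff]
      refine and_congr (mem_degFam_switch_pair hαβ hy hz hP hQ) ?_
      have hxz : x ≠ z := fun h => hαβ (by rw [← hx, h, hz])
      simp only [Finset.mem_union, Finset.mem_sdiff, Finset.mem_insert, Finset.mem_singleton]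
      tauto
  have hL : ∀ E ∈ degFam A d c D,
      (if x ∈ E ∧ y ∈ E ∧ update y s β ∉ E then (1 : ℝ) else 0)
      = ∑ z with z s = β, if ({y, z} ⊆ E ∧ Disjoint {update y s β, update z s α} E) ∧
          x ∈ E ∧ x ≠ update z s α then w E else 0 := by
    intro E hE
    split_ifs with h
    · have hcard := card_single_add_codeg E s α β
      have hcard2 := card_single_add_codeg E s β α
      rw [(Finset.mem_filter.1 hE).2.1 s hs] at hcard hcard2
      rw [codeg_comm] at hcard2
      have hpos : 0 < (E.filter (fun e => e s = α ∧ update e s β ∉ E)).card :=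
        Finset.card_pos.2 ⟨y, Finset.mem_filter.2 ⟨h.2.1, hy, h.2.2⟩⟩
      rw [← Finset.sum_filter, Finset.sum_const, Finset.filter_filter, nsmul_eq_mul]
      have hset : (Finset.univ.filter (fun z => z s = β ∧
          ({y, z} ⊆ E ∧ Disjoint {update y s β, update z s α} E) ∧ x ∈ E ∧ x ≠ update z s α))
          = E.filter (fun e => e s = β ∧ update e s α ∉ E) := by
        ext z
        simp only [Finset.mem_filter, Finset.mem_univ, true_and, Finset.insert_subset_iff,
          Finset.singleton_subset_iff, Finset.disjoint_insert_left,
          Finset.disjoint_singleton_left]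
        have : update z s α ∉ E → x ≠ update z s α := fun h1 h2 => h1 (h2 ▸ h.1)
        tauto
      rw [hset]
      have h3 : ((E.filter (fun e => e s = β ∧ update e s α ∉ E)).card : ℝ)
          = d - codeg E s α β := by
        rw [eq_sub_iff_add_eq]
        exact_mod_cast hcard2
      rw [h3, hw, mul_inv_cancel₀]
      rw [← h3]
      exact_mod_cast (by omega : _ ≠ 0)
    · symm
      refine Finset.sum_eq_zero fun z _ => if_neg fun h' => h ?_
      simp only [Finset.insert_subset_iff, Finset.disjoint_insert_left] at h'
      tauto
  have hR : ∀ E ∈ degFam A d c D,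
      (if x ∈ E ∧ update y s β ∈ E ∧ y ∉ E then
          1 - (if update x s β ∉ E then w E else 0) else 0)
      = ∑ z with z s = β, if ({update y s β, update z s α} ⊆ E ∧ Disjoint {y, z} E) ∧
          x ∈ E ∧ x ≠ update z s α then w E else 0 := by
    intro E hE
    by_cases h : x ∈ E ∧ update y s β ∈ E ∧ y ∉ E
    · rw [if_pos h]
      have hpos : 0 < (d : ℝ) - codeg E s α β := card_single_pos hE hs
        ⟨update y s β, h.2.1, by simp, by rw [update_update_of_eq hy]; exact h.2.2⟩
      have hcard := card_single_eq hE hs α β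
      rw [← Finset.sum_filter, Finset.sum_const, Finset.filter_filter, nsmul_eq_mul]
      have hset : (Finset.univ.filter (fun z => z s = β ∧
          ({update y s β, update z s α} ⊆ E ∧ Disjoint {y, z} E) ∧ x ∈ E ∧
            x ≠ update z s α)).card
          = ((E.filter (fun e => e s = α ∧ update e s β ∉ E)).erase x).card := by
        refine Finset.card_bij' (fun e _ => update e s α) (fun e _ => update e s β) ?_ ?_ ?_ ?_
        · intro e he
          simp only [Finset.mem_filter, Finset.mem_univ, true_and, Finset.insert_subset_iff,
            Finset.singleton_subset_iff, Finset.disjoint_insert_left,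
            Finset.disjoint_singleton_left, Finset.mem_erase] at he ⊢
          rw [update_update_of_eq he.1]
          refine ⟨he.2.2.2.symm, he.2.1.1.2, by simp, he.2.1.2.2⟩
        · intro e he
          simp only [Finset.mem_filter, Finset.mem_univ, true_and, Finset.insert_subset_iff,
            Finset.singleton_subset_iff, Finset.disjoint_insert_left,
            Finset.disjoint_singleton_left, Finset.mem_erase] at he ⊢
          rw [update_update_of_eq he.2.2.1]
          exact ⟨by simp, ⟨⟨h.2.1, he.2.1⟩, h.2.2, he.2.2.2⟩, h.1, he.1.symm⟩
        · intro e he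
          exact update_update_of_eq (Finset.mem_filter.1 he).2.1
        · intro e he
          exact update_update_of_eq (Finset.mem_filter.1 (Finset.mem_erase.1 he).2).2.1
      rw [hset]
      by_cases h' : update x s β ∉ E
      · rw [if_pos h']
        have hmem : x ∈ E.filter (fun e => e s = α ∧ update e s β ∉ E) :=
          Finset.mem_filter.2 ⟨h.1, hx, h'⟩
        have h1 := Finset.card_erase_add_one hmem
        rw [← h1] at hcard
        push_cast at hcard
        rw [eq_sub_of_add_eq hcard, sub_mul, hw, mul_inv_cancel₀ hpos.ne', one_mul]
      · rw [if_neg h', Finset.erase_eq_of_notMem (by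
          rw [Finset.mem_filter]
          tauto), hcard, hw, mul_inv_cancel₀ hpos.ne', sub_zero]
    · rw [if_neg h]
      symm
      refine Finset.sum_eq_zero fun z _ => if_neg fun h' => h ?_
      simp only [Finset.insert_subset_iff, Finset.disjoint_insert_left] at h'
      tauto
  rw [Finset.sum_congr rfl hL, Finset.sum_congr rfl hR, Finset.sum_comm, Finset.sum_comm
    (s := degFam A d c D)]
  refine Finset.sum_congr rfl fun z hz => ?_
  have h := key z (Finset.mem_filter.1 hz).2
  simp only [← Finset.sum_filter, Finset.filter_filter] at h ⊢
  convert h using 2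
  · ext E
    simp only [Finset.mem_filter, Finset.mem_univ, true_and]
    tauto
  · ext E
    simp only [Finset.mem_filter, Finset.mem_univ, true_and]
    tauto

end PairSwitching

section PairCorrelation

variable {ι : Type*} [Fintype ι] [DecidableEq ι] {m : ℕ}

open Function (update)

/-- Pairs of edges through `u` and `v` in class `c` that agree in the classes of `B`. -/
def agreePairs (E : Finset (ι → Fin m)) (c : ι) (u v : Fin m) (B : Finset ι) :
    Finset ((ι → Fin m) × (ι → Fin m)) :=
  (E ×ˢ E).filter (fun p => p.1 c = u ∧ p.2 c = v ∧ ∀ t ∈ B, p.1 t = p.2 t)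

/-- All pairs of potential edges through `u` and `v` that agree in the classes of `B`. -/
def agreeAll (c : ι) (u v : Fin m) (B : Finset ι) : Finset ((ι → Fin m) × (ι → Fin m)) :=
  Finset.univ.filter (fun p => p.1 c = u ∧ p.2 c = v ∧ ∀ t ∈ B, p.1 t = p.2 t)

/-- The loss in the pair correlation caused by the degree constraint in class `s`. -/
noncomputable def corrLoss (d : ℕ) (E : Finset (ι → Fin m)) (c : ι) (u v : Fin m) (B : Finset ι)
    (s : ι) : ℝ :=
  ∑ p ∈ agreeAll c u v (insert s B), ∑ β : Fin m,
    if β ≠ p.1 s ∧ (p.1 ∈ E ∧ update p.2 s β ∈ E ∧ p.2 ∉ E) ∧ update p.1 s β ∉ E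
    then ((d : ℝ) - codeg E s (p.1 s) β)⁻¹ else 0

theorem card_agreePairs_empty (E : Finset (ι → Fin m)) (c : ι) (u v : Fin m) :
    (agreePairs E c u v ∅).card = vdeg E c u * vdeg E c v := by
  unfold agreePairs vdeg
  rw [← Finset.card_product]
  congr 1
  ext p
  simp only [Finset.mem_filter, Finset.mem_product, Finset.notMem_empty, false_implies,
    implies_true, and_true]
  tauto

theorem card_agreePairs_erase (E : Finset (ι → Fin m)) (c : ι) (u v : Fin m) :
    (agreePairs E c u v (Finset.univ.erase c)).card = codeg E c u v := by
  unfold agreePairs codeg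
  refine Finset.card_bij' (fun p _ => p.1) (fun e _ => (e, update e c v)) ?_ ?_ ?_ ?_
  · rintro ⟨x, y⟩ h
    simp only [Finset.mem_filter, Finset.mem_product, Finset.mem_erase, Finset.mem_univ,
      and_true] at h ⊢
    have : update x c v = y := by
      ext t
      by_cases ht : t = c
      · subst ht
        simp [h.2.2.1]
      · rw [Function.update_of_ne ht, h.2.2.2 t ht]
    rw [this]
    tauto
  · intro e h
    simp only [Finset.mem_filter, Finset.mem_product, Finset.mem_erase, Finset.mem_univ,
      and_true] at h ⊢
    refine ⟨⟨h.1, h.2.2⟩, h.2.1, by simp, fun t ht => ?_⟩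
    rw [Function.update_of_ne ht]
  · rintro ⟨x, y⟩ h
    simp only [Finset.mem_filter, Finset.mem_product, Finset.mem_erase, Finset.mem_univ,
      and_true] at h ⊢
    have : update x c v = y := by
      ext t
      by_cases ht : t = c
      · subst ht
        simp [h.2.2.1]
      · rw [Function.update_of_ne ht, h.2.2.2 t ht]
    rw [this]
  · intro e h
    rfl

theorem card_agreePairs_insert (E : Finset (ι → Fin m)) (c : ι) (u v : Fin m) (B : Finset ι) :
    ((agreePairs E c u v B).card : ℝ)
      = ∑ p ∈ agreeAll c u v B, if p.1 ∈ E ∧ p.2 ∈ E then 1 else 0 := by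
  rw [← Finset.sum_filter, Finset.sum_const, nsmul_eq_mul, mul_one]
  congr 2
  ext p
  simp only [agreePairs, agreeAll, Finset.mem_filter, Finset.mem_product, Finset.mem_univ,
    true_and]
  tauto

theorem card_agreePairs_eq_sum (E : Finset (ι → Fin m)) {c : ι} (u v : Fin m) {B : Finset ι}
    {s : ι} (hs : s ∉ B) (hsc : s ≠ c) :
    ((agreePairs E c u v B).card : ℝ)
      = ∑ p ∈ agreeAll c u v (insert s B), ∑ β : Fin m,
          if p.1 ∈ E ∧ update p.2 s β ∈ E then 1 else 0 := by
  rw [← Finset.sum_product', ← Finset.sum_filter, Finset.sum_const, nsmul_eq_mul, mul_one]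
  congr 1
  refine Finset.card_bij' (fun p _ => ((p.1, update p.2 s (p.1 s)), p.2 s))
    (fun q _ => (q.1.1, update q.1.2 s q.2)) ?_ ?_ ?_ ?_
  · rintro ⟨x, y⟩ h
    simp only [agreePairs, agreeAll, Finset.mem_filter, Finset.mem_product, Finset.mem_univ,
      and_true, true_and] at h ⊢
    refine ⟨⟨h.2.1, ?_, ?_⟩, h.1.1, ?_⟩
    · rw [Function.update_of_ne hsc.symm, h.2.2.1]
    · intro t ht
      rcases Finset.mem_insert.1 ht with rfl | ht
      · simp
      · have hts : t ≠ s := fun h => hs (h ▸ ht)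
        rw [Function.update_of_ne hts, h.2.2.2 t ht]
    · rw [update_update_of_eq rfl]
      exact h.1.2
  · rintro ⟨⟨x, y⟩, β⟩ h
    simp only [agreePairs, agreeAll, Finset.mem_filter, Finset.mem_product, Finset.mem_univ,
      and_true, true_and] at h ⊢
    refine ⟨h.2, h.1.1, ?_, ?_⟩
    · rw [Function.update_of_ne hsc.symm, h.1.2.1]
    · intro t ht
      have hts : t ≠ s := fun h => hs (h ▸ ht)
      rw [Function.update_of_ne hts, h.1.2.2 t (Finset.mem_insert_of_mem ht)]
  · rintro ⟨x, y⟩ h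
    simp only [Prod.mk.injEq, true_and]
    exact update_update_of_eq rfl
  · rintro ⟨⟨x, y⟩, β⟩ h
    simp only [agreeAll, Finset.mem_filter, Finset.mem_product, Finset.mem_univ,
      and_true, true_and] at h
    simp only [Prod.mk.injEq, true_and, Function.update_self, and_true]
    rw [h.1.2.2 s (Finset.mem_insert_self _ _)]
    exact update_update_of_eq rfl

theorem ite_sub_ite_pair (p q r : Prop) [Decidable p] [Decidable q] [Decidable r] :
    ((if p ∧ q then (1 : ℝ) else 0) - if p ∧ r then 1 else 0)
      = (if p ∧ q ∧ ¬ r then 1 else 0) - if p ∧ r ∧ ¬ q then 1 else 0 := by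
  by_cases hp : p <;> by_cases hq : q <;> by_cases hr : r <;> simp [hp, hq, hr]

theorem mul_sum_agreePairs_sub (A : Finset ι) (d : ℕ) {c : ι} (D : Fin m → ℕ) (u v : Fin m)
    {B : Finset ι} {s : ι} (hs : s ∉ B) (hsc : s ≠ c) :
    m * ∑ E ∈ degFam A d c D, ((agreePairs E c u v (insert s B)).card : ℝ)
        - ∑ E ∈ degFam A d c D, ((agreePairs E c u v B).card : ℝ)
      = ∑ p ∈ agreeAll c u v (insert s B), ∑ β : Fin m,
        ((∑ E ∈ degFam A d c D, if p.1 ∈ E ∧ p.2 ∈ E ∧ update p.2 s β ∉ E then (1 : ℝ) else 0)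
        - ∑ E ∈ degFam A d c D, if p.1 ∈ E ∧ update p.2 s β ∈ E ∧ p.2 ∉ E then (1 : ℝ) else 0)
    := by
  simp only [card_agreePairs_eq_sum _ u v hs hsc, card_agreePairs_insert _ c u v (insert s B)]
  simp only [← Finset.sum_sub_distrib, ← ite_sub_ite_pair]
  rw [Finset.mul_sum, ← Finset.sum_sub_distrib]
  have : ∀ E : Finset (ι → Fin m), (m : ℝ) * ∑ p ∈ agreeAll c u v (insert s B),
      (if p.1 ∈ E ∧ p.2 ∈ E then (1 : ℝ) else 0)
      = ∑ p ∈ agreeAll c u v (insert s B), ∑ β : Fin m,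
        (if p.1 ∈ E ∧ p.2 ∈ E then (1 : ℝ) else 0) := by
    intro E
    rw [Finset.mul_sum]
    refine Finset.sum_congr rfl fun p _ => ?_
    simp
  simp only [this, ← Finset.sum_sub_distrib]
  rw [Finset.sum_comm]
  refine Finset.sum_congr rfl fun p _ => ?_
  rw [Finset.sum_comm]

theorem mul_sum_agreePairs_free (A : Finset ι) (d : ℕ) {c : ι} (D : Fin m → ℕ) {u v : Fin m}
    (huv : u ≠ v) {B : Finset ι} {s : ι} (hsA : s ∉ A) (hs : s ∉ B) (hsc : s ≠ c) :
    m * ∑ E ∈ degFam A d c D, ((agreePairs E c u v (insert s B)).card : ℝ)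
      = ∑ E ∈ degFam A d c D, ((agreePairs E c u v B).card : ℝ) := by
  rw [← sub_eq_zero, mul_sum_agreePairs_sub A d D u v hs hsc]
  refine Finset.sum_eq_zero fun p hp => Finset.sum_eq_zero fun β _ => ?_
  have hp' := (Finset.mem_filter.1 hp).2
  by_cases hβ : p.2 s = β
  · subst hβ
    rw [Function.update_eq_self, sub_self]
  · rw [sum_switch_free A d D hsA hsc hβ (by rw [hp'.1, hp'.2.1]; exact huv) rfl, sub_self]

theorem mul_sum_agreePairs_regular (A : Finset ι) (d : ℕ) {c : ι} (D : Fin m → ℕ) {u v : Fin m}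
    (huv : u ≠ v) {B : Finset ι} {s : ι} (hsA : s ∈ A) (hs : s ∉ B) (hsc : s ≠ c) :
    m * ∑ E ∈ degFam A d c D, ((agreePairs E c u v (insert s B)).card : ℝ)
      = ∑ E ∈ degFam A d c D, ((agreePairs E c u v B).card : ℝ)
        - ∑ E ∈ degFam A d c D, corrLoss d E c u v B s := by
  have h := mul_sum_agreePairs_sub A d D u v hs hsc
  have h2 : ∑ E ∈ degFam A d c D, corrLoss d E c u v B s
      = ∑ p ∈ agreeAll c u v (insert s B), ∑ β : Fin m, ∑ E ∈ degFam A d c D,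
        if β ≠ p.1 s ∧ (p.1 ∈ E ∧ update p.2 s β ∈ E ∧ p.2 ∉ E) ∧ update p.1 s β ∉ E
        then ((d : ℝ) - codeg E s (p.1 s) β)⁻¹ else 0 := by
    unfold corrLoss
    rw [Finset.sum_comm]
    refine Finset.sum_congr rfl fun p _ => ?_
    rw [Finset.sum_comm]
  have h3 : ∑ p ∈ agreeAll c u v (insert s B), ∑ β : Fin m,
        ((∑ E ∈ degFam A d c D, if p.1 ∈ E ∧ p.2 ∈ E ∧ update p.2 s β ∉ E then (1 : ℝ) else 0)
        - ∑ E ∈ degFam A d c D, if p.1 ∈ E ∧ update p.2 s β ∈ E ∧ p.2 ∉ E then (1 : ℝ) else 0)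
      = - ∑ E ∈ degFam A d c D, corrLoss d E c u v B s := by
    rw [h2, ← Finset.sum_neg_distrib]
    refine Finset.sum_congr rfl fun p hp => ?_
    rw [← Finset.sum_neg_distrib]
    refine Finset.sum_congr rfl fun β _ => ?_
    have hp' := (Finset.mem_filter.1 hp).2
    have hs12 := hp'.2.2 s (Finset.mem_insert_self _ _)
    by_cases hβ : p.1 s = β
    · rw [Finset.sum_eq_zero (s := degFam A d c D) (f := fun E => if β ≠ p.1 s ∧ _ then _ else _)
        (fun E _ => if_neg fun h => h.1 hβ.symm)]
      rw [← hβ, hs12, Function.update_eq_self, sub_self, neg_zero]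
    · rw [sum_switch_regular A d D hsA hsc hβ (by rw [hp'.1, hp'.2.1]; exact huv) rfl hs12.symm,
        ← Finset.sum_sub_distrib, ← Finset.sum_neg_distrib]
      refine Finset.sum_congr rfl fun E _ => ?_
      by_cases h4 : p.1 ∈ E ∧ update p.2 s β ∈ E ∧ p.2 ∉ E
      · by_cases h5 : update p.1 s β ∉ E
        · rw [if_pos h4, if_pos h4, if_pos h5, if_pos ⟨Ne.symm hβ, h4, h5⟩]
          ring
        · rw [if_pos h4, if_pos h4, if_neg h5, if_neg (fun h => h5 h.2.2)]
          ring
      · rw [if_neg h4, if_neg h4, if_neg (fun h => h4 h.2.1)]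
        ring
  linarith

/-- Ordered pairs of distinct vertices in class `s` whose links differ in fewer than `g` places. -/
def closePairs (d g : ℕ) (E : Finset (ι → Fin m)) (s : ι) : Finset (Fin m × Fin m) :=
  Finset.univ.filter (fun q => q.1 ≠ q.2 ∧ d < g + codeg E s q.1 q.2)

theorem card_bad_pairs_le (E : Finset (ι → Fin m)) {c : ι} (u v : Fin m) (B : Finset ι) {s : ι}
    (α β : Fin m) :
    ((agreeAll c u v (insert s B)).filter (fun p => p.1 s = α ∧
      (p.1 ∈ E ∧ update p.2 s β ∈ E ∧ p.2 ∉ E) ∧ update p.1 s β ∉ E)).card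
    ≤ (E.filter (fun e => e s = α ∧ update e s β ∉ E)).card *
      (E.filter (fun e => e s = β ∧ update e s α ∉ E)).card := by
  rw [← Finset.card_product]
  refine Finset.card_le_card_of_injOn (fun p => (p.1, update p.2 s β)) ?_ ?_
  · rintro ⟨x, y⟩ h
    simp only [agreeAll, Finset.coe_filter, Set.mem_ofPred_eq, Finset.mem_filter,
      Finset.mem_univ, true_and, Finset.mem_coe, Finset.mem_product] at h ⊢
    have hy : y s = α := (h.1.2.2 s (Finset.mem_insert_self _ _)).symm.trans h.2.1
    rw [update_update_of_eq hy]
    simp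
    tauto
  · rintro ⟨x, y⟩ h ⟨x', y'⟩ h' he
    simp only [agreeAll, Finset.coe_filter, Set.mem_ofPred_eq, Finset.mem_filter,
      Finset.mem_univ, true_and] at h h'
    have hy : y s = α := (h.1.2.2 s (Finset.mem_insert_self _ _)).symm.trans h.2.1
    have hy' : y' s = α := (h'.1.2.2 s (Finset.mem_insert_self _ _)).symm.trans h'.2.1
    simp only [Prod.mk.injEq] at he ⊢
    refine ⟨he.1, ?_⟩
    rw [← update_update_of_eq (β := β) hy, he.2, update_update_of_eq hy']

theorem corrLoss_nonneg {A : Finset ι} {d : ℕ} {c : ι} {D : Fin m → ℕ} {E : Finset (ι → Fin m)}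
    (hE : E ∈ degFam A d c D) (u v : Fin m) (B : Finset ι) {s : ι} (hs : s ∈ A) :
    0 ≤ corrLoss d E c u v B s := by
  unfold corrLoss
  refine Finset.sum_nonneg fun p _ => Finset.sum_nonneg fun β _ => ?_
  split_ifs
  · rw [← card_single_eq hE hs]
    positivity
  · exact le_rfl

theorem corrLoss_le {A : Finset ι} {d : ℕ} {c : ι} {D : Fin m → ℕ} {E : Finset (ι → Fin m)}
    (hE : E ∈ degFam A d c D) (u v : Fin m) {B : Finset ι} {s : ι} (hs : s ∈ A) (hsB : s ∉ B)
    (hsc : s ≠ c) {g : ℕ} (hg : 0 < g) :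
    corrLoss d E c u v B s
      ≤ ((agreePairs E c u v B).card : ℝ) / g + g * (closePairs d g E s).card := by
  have hterm : ∀ p ∈ agreeAll c u v (insert s B), ∀ β : Fin m,
      (if β ≠ p.1 s ∧ (p.1 ∈ E ∧ update p.2 s β ∈ E ∧ p.2 ∉ E) ∧ update p.1 s β ∉ E
        then ((d : ℝ) - codeg E s (p.1 s) β)⁻¹ else 0)
      ≤ (if p.1 ∈ E ∧ update p.2 s β ∈ E then 1 else 0) / g
        + ∑ q ∈ closePairs d g E s, if β = q.2 ∧ p.1 s = q.1 ∧
          (p.1 ∈ E ∧ update p.2 s q.2 ∈ E ∧ p.2 ∉ E) ∧ update p.1 s q.2 ∉ E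
        then ((d : ℝ) - codeg E s q.1 q.2)⁻¹ else 0 := by
    intro p hp β
    have hnn : ∀ q : Fin m × Fin m, 0 ≤ if β = q.2 ∧ p.1 s = q.1 ∧
          (p.1 ∈ E ∧ update p.2 s q.2 ∈ E ∧ p.2 ∉ E) ∧ update p.1 s q.2 ∉ E
        then ((d : ℝ) - codeg E s q.1 q.2)⁻¹ else 0 := by
      intro q
      split_ifs
      · rw [← card_single_eq hE hs]
        positivity
      · exact le_rfl
    split_ifs with h h1 h1
    · by_cases hclose : d < g + codeg E s (p.1 s) β
      · have hmem : (p.1 s, β) ∈ closePairs d g E s := by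
          simp only [closePairs, Finset.mem_filter, Finset.mem_univ, true_and]
          exact ⟨h.1.symm, hclose⟩
        refine le_add_of_nonneg_of_le (by positivity) ?_
        refine le_trans ?_ (Finset.single_le_sum (fun q _ => hnn q) hmem)
        rw [if_pos ⟨rfl, rfl, h.2⟩]
      · refine le_add_of_le_of_nonneg ?_ (Finset.sum_nonneg fun q _ => hnn q)
        rw [one_div]
        refine inv_anti₀ (by exact_mod_cast hg) ?_
        rw [le_sub_iff_add_le]
        exact_mod_cast not_lt.1 hclose
    · exact absurd ⟨h.2.1.1, h.2.1.2.1⟩ h1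
    · exact add_nonneg (by positivity) (Finset.sum_nonneg fun q _ => hnn q)
    · exact add_nonneg (by simp) (Finset.sum_nonneg fun q _ => hnn q)
  have hclose : ∀ q ∈ closePairs d g E s, ∑ p ∈ agreeAll c u v (insert s B), ∑ β : Fin m,
      (if β = q.2 ∧ p.1 s = q.1 ∧
          (p.1 ∈ E ∧ update p.2 s q.2 ∈ E ∧ p.2 ∉ E) ∧ update p.1 s q.2 ∉ E
        then ((d : ℝ) - codeg E s q.1 q.2)⁻¹ else 0) ≤ g := by
    intro q hq
    have hq' := (Finset.mem_filter.1 hq).2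
    have h1 := card_bad_pairs_le E (c := c) u v B (s := s) q.1 q.2
    have h2 : ((Finset.filter (fun p => p.1 s = q.1 ∧
      (p.1 ∈ E ∧ update p.2 s q.2 ∈ E ∧ p.2 ∉ E) ∧ update p.1 s q.2 ∉ E)
        (agreeAll c u v (insert s B))).card : ℝ)
        ≤ (d - codeg E s q.1 q.2) * (d - codeg E s q.1 q.2) := by
      nth_rw 2 [codeg_comm]
      rw [← card_single_eq hE hs, ← card_single_eq hE hs q.2 q.1]
      exact_mod_cast h1
    have h3 : ∑ p ∈ agreeAll c u v (insert s B), ∑ β : Fin m,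
        (if β = q.2 ∧ p.1 s = q.1 ∧
          (p.1 ∈ E ∧ update p.2 s q.2 ∈ E ∧ p.2 ∉ E) ∧ update p.1 s q.2 ∉ E
        then ((d : ℝ) - codeg E s q.1 q.2)⁻¹ else 0)
        = ((agreeAll c u v (insert s B)).filter (fun p => p.1 s = q.1 ∧
          (p.1 ∈ E ∧ update p.2 s q.2 ∈ E ∧ p.2 ∉ E) ∧ update p.1 s q.2 ∉ E)).card
          * ((d : ℝ) - codeg E s q.1 q.2)⁻¹ := by
      rw [← nsmul_eq_mul, ← Finset.sum_const, Finset.sum_filter]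
      refine Finset.sum_congr rfl fun p _ => ?_
      rw [Finset.sum_eq_single q.2]
      · simp
      · intro β _ hβ
        exact if_neg fun h => hβ h.1
      · simp
    have h4 : 0 ≤ (d : ℝ) - codeg E s q.1 q.2 := by
      rw [← card_single_eq hE hs]
      positivity
    have h5 : (d : ℝ) ≤ g + codeg E s q.1 q.2 := by exact_mod_cast hq'.2.le
    rw [h3]
    refine (mul_le_mul_of_nonneg_right h2 (inv_nonneg.2 h4)).trans ?_
    rw [mul_self_mul_inv]
    linarith
  calc corrLoss d E c u v B s
      ≤ ∑ p ∈ agreeAll c u v (insert s B), ∑ β : Fin m, _ :=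
        Finset.sum_le_sum fun p hp => Finset.sum_le_sum fun β _ => hterm p hp β
    _ = ((agreePairs E c u v B).card : ℝ) / g + ∑ q ∈ closePairs d g E s,
          ∑ p ∈ agreeAll c u v (insert s B), ∑ β : Fin m, _ := by
        rw [card_agreePairs_eq_sum E u v hsB hsc]
        simp only [Finset.sum_add_distrib, Finset.sum_div]
        congr 1
        rw [Finset.sum_comm (s := closePairs d g E s)]
        refine Finset.sum_congr rfl fun p _ => ?_
        rw [Finset.sum_comm]
    _ ≤ ((agreePairs E c u v B).card : ℝ) / g + ∑ q ∈ closePairs d g E s, (g : ℝ) := by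
        gcongr with q hq
        exact hclose q hq
    _ = _ := by
        rw [Finset.sum_const, nsmul_eq_mul, mul_comm]

end PairCorrelation

section CodegreeBounds

variable {ι : Type*} [Fintype ι] [DecidableEq ι] {m : ℕ}

theorem sum_agreePairs_empty (A : Finset ι) (d : ℕ) (c : ι) (D : Fin m → ℕ) (u v : Fin m) :
    ∑ E ∈ degFam A d c D, ((agreePairs E c u v ∅).card : ℝ)
      = D u * D v * (degFam A d c D).card := by
  rw [Finset.sum_congr rfl (g := fun _ => (D u * D v : ℝ)), Finset.sum_const, nsmul_eq_mul,
    mul_comm]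
  intro E hE
  rw [card_agreePairs_empty, (Finset.mem_filter.1 hE).2.2, (Finset.mem_filter.1 hE).2.2]
  push_cast
  rfl

theorem sum_agreePairs_erase (A : Finset ι) (d : ℕ) (c : ι) (D : Fin m → ℕ) (u v : Fin m) :
    ∑ E ∈ degFam A d c D, ((agreePairs E c u v (Finset.univ.erase c)).card : ℝ)
      = totalCodeg A d c D u v := by
  simp only [card_agreePairs_erase, totalCodeg]

theorem pow_mul_sum_agreePairs_le (A : Finset ι) (d : ℕ) {c : ι} (D : Fin m → ℕ)
    {u v : Fin m} (huv : u ≠ v) {B : Finset ι} (hB : c ∉ B) :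
    (m : ℝ) ^ B.card * ∑ E ∈ degFam A d c D, ((agreePairs E c u v B).card : ℝ)
      ≤ D u * D v * (degFam A d c D).card := by
  induction B using Finset.induction_on with
  | empty => simp [sum_agreePairs_empty]
  | insert s B hs ih =>
    rw [Finset.mem_insert, not_or] at hB
    refine le_trans ?_ (ih hB.2)
    rw [Finset.card_insert_of_notMem hs, pow_succ, mul_assoc]
    refine mul_le_mul_of_nonneg_left ?_ (by positivity)
    by_cases hsA : s ∈ A
    · rw [mul_sum_agreePairs_regular A d D huv hsA hs (Ne.symm hB.1)]
      have := Finset.sum_nonneg fun E (hE : E ∈ degFam A d c D) =>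
        corrLoss_nonneg hE u v B hsA
      linarith
    · rw [mul_sum_agreePairs_free A d D huv hsA hs (Ne.symm hB.1)]

theorem pow_mul_totalCodeg_le (A : Finset ι) (d : ℕ) {c : ι} (D : Fin m → ℕ)
    {u v : Fin m} (huv : u ≠ v) :
    (m : ℝ) ^ (Fintype.card ι - 1) * totalCodeg A d c D u v
      ≤ D u * D v * (degFam A d c D).card := by
  have h := pow_mul_sum_agreePairs_le A d D huv (Finset.notMem_erase c Finset.univ)
  rwa [sum_agreePairs_erase, Finset.card_erase_of_mem (Finset.mem_univ _),
    Finset.card_univ] at h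

theorem le_sum_agreePairs (hm : 2 ≤ m) (A : Finset ι) (d : ℕ) {c : ι} (D : Fin m → ℕ)
    {u v : Fin m} (huv : u ≠ v) {g : ℕ} (hg : 0 < g) {Q : ℝ} (hQ0 : 0 ≤ Q)
    (hQ : ∀ s ∈ A, ∑ E ∈ degFam A d c D, ((closePairs d g E s).card : ℝ)
      ≤ Q * (degFam A d c D).card) {B : Finset ι} (hB : c ∉ B) :
    (D u * D v * (degFam A d c D).card) * (1 - B.card / g) / (m : ℝ) ^ B.card
        - 2 * (g * Q * (degFam A d c D).card) / m
      ≤ ∑ E ∈ degFam A d c D, ((agreePairs E c u v B).card : ℝ) := by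
  have hm' : (2 : ℝ) ≤ m := by exact_mod_cast hm
  have hg' : (0 : ℝ) < g := by exact_mod_cast hg
  have hcard := fun {B : Finset ι} => pow_mul_sum_agreePairs_le A d D huv (c := c) (B := B)
  have hempty := sum_agreePairs_empty A d c D u v
  have hX : (0 : ℝ) ≤ g * Q * (degFam A d c D).card := by positivity
  have hY : (0 : ℝ) ≤ D u * D v * (degFam A d c D).card := by positivity
  set X : ℝ := g * Q * (degFam A d c D).card with hXdef
  set Y : ℝ := D u * D v * (degFam A d c D).card with hYdef
  induction B using Finset.induction_on with
  | empty =>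
    rw [hempty]
    have : 0 ≤ 2 * X / m := by positivity
    simp
    linarith
  | insert s B hs ih =>
    rw [Finset.mem_insert, not_or] at hB
    have ih := ih hB.2
    have hup := hcard hB.2
    rw [mul_comm, ← le_div_iff₀ (by positivity)] at hup
    set S : ℝ := ∑ E ∈ degFam A d c D, ((agreePairs E c u v B).card : ℝ) with hS
    set S' : ℝ := ∑ E ∈ degFam A d c D, ((agreePairs E c u v (insert s B)).card : ℝ) with hS'
    have hstep : S - Y / m ^ B.card / g - X ≤ m * S' := by
      by_cases hsA : s ∈ A
      · rw [hS', mul_sum_agreePairs_regular A d D huv hsA hs (Ne.symm hB.1), ← hS]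
        have h1 : ∑ E ∈ degFam A d c D, corrLoss d E c u v B s ≤ S / g + X := by
          refine (Finset.sum_le_sum fun E hE =>
            corrLoss_le hE u v hsA hs (Ne.symm hB.1) hg).trans ?_
          rw [Finset.sum_add_distrib, ← Finset.sum_div, ← Finset.mul_sum, hXdef, mul_assoc]
          have := hQ s hsA
          gcongr
        have h2 : S / g ≤ Y / m ^ B.card / g := by gcongr
        linarith
      · rw [hS', mul_sum_agreePairs_free A d D huv hsA hs (Ne.symm hB.1), ← hS]
        have : 0 ≤ Y / m ^ B.card / g := by positivity
        linarith
    rw [Finset.card_insert_of_notMem hs, pow_succ, ← div_div, ← sub_div, div_le_iff₀' (by linarith)]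
    refine le_trans ?_ hstep
    push_cast
    have h3 : 2 * X / m ≤ X := by
      rw [div_le_iff₀ (by linarith)]
      nlinarith
    have h4 : Y * (1 - (B.card + 1 : ℝ) / g) / m ^ B.card
        = Y * (1 - B.card / g) / m ^ B.card - Y / m ^ B.card / g := by
      field_simp
      ring
    rw [h4]
    linarith

theorem le_totalCodeg (hm : 2 ≤ m) (A : Finset ι) (d : ℕ) {c : ι} (D : Fin m → ℕ)
    {u v : Fin m} (huv : u ≠ v) {g : ℕ} (hg : 0 < g) {Q : ℝ} (hQ0 : 0 ≤ Q)
    (hQ : ∀ s ∈ A, ∑ E ∈ degFam A d c D, ((closePairs d g E s).card : ℝ)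
      ≤ Q * (degFam A d c D).card) :
    ((1 - (Fintype.card ι : ℝ) / g) * (D u * D v) / (m : ℝ) ^ (Fintype.card ι - 1)
        - 2 * g * Q / m) * (degFam A d c D).card
      ≤ totalCodeg A d c D u v := by
  have h := le_sum_agreePairs hm A d D huv hg hQ0 hQ (Finset.notMem_erase c Finset.univ)
  rw [sum_agreePairs_erase, Finset.card_erase_of_mem (Finset.mem_univ _),
    Finset.card_univ] at h
  refine le_trans ?_ h
  have h1 : ((Fintype.card ι - 1 : ℕ) : ℝ) ≤ Fintype.card ι := by
    exact_mod_cast Nat.sub_le _ _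
  have h2 : (1 - (Fintype.card ι : ℝ) / g) ≤ 1 - ((Fintype.card ι - 1 : ℕ) : ℝ) / g := by gcongr
  have h3 : (1 - (Fintype.card ι : ℝ) / g) * (D u * D v * (degFam A d c D).card)
      / (m : ℝ) ^ (Fintype.card ι - 1)
      ≤ D u * D v * (degFam A d c D).card * (1 - ((Fintype.card ι - 1 : ℕ) : ℝ) / g)
      / (m : ℝ) ^ (Fintype.card ι - 1) := by
    rw [mul_comm (D u * D v * ((degFam A d c D).card : ℝ))]
    gcongr
  refine le_trans (le_of_eq ?_) (sub_le_sub_right h3 _)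
  ring

end CodegreeBounds

section Links

variable {ι : Type*} [Fintype ι] [DecidableEq ι] {m : ℕ}

/-- The link of the vertex `v` of class `c`. -/
def link (E : Finset (ι → Fin m)) (c : ι) (v : Fin m) : Finset ({t // t ≠ c} → Fin m) :=
  Finset.univ.filter (fun x => (Equiv.funSplitAt c (Fin m)).symm (v, x) ∈ E)

/-- An edge set is determined by the links of the vertices of one class. -/
def linkEquiv (c : ι) :
    Finset (ι → Fin m) ≃ (Fin m → Finset ({t // t ≠ c} → Fin m)) where
  toFun E := link E c
  invFun f := Finset.univ.filter (fun e => (Equiv.funSplitAt c (Fin m) e).2 ∈ f (e c))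
  left_inv E := by
    ext e
    have h : ((e c, ((Equiv.funSplitAt c (Fin m)) e).2) : Fin m × _)
      = (Equiv.funSplitAt c (Fin m)) e := rfl
    simp only [link, Finset.mem_filter, Finset.mem_univ, true_and]
    rw [h, Equiv.symm_apply_apply]
  right_inv f := by
    funext v
    ext x
    simp only [link, Finset.mem_filter, Finset.mem_univ, true_and, Equiv.apply_symm_apply]
    simp

theorem mem_link {E : Finset (ι → Fin m)} {c : ι} {v : Fin m} {x : {t // t ≠ c} → Fin m} :
    x ∈ link E c v ↔ (Equiv.funSplitAt c (Fin m)).symm (v, x) ∈ E := by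
  simp [link]

theorem card_link (E : Finset (ι → Fin m)) (c : ι) (v : Fin m) :
    (link E c v).card = vdeg E c v := by
  unfold vdeg
  refine Finset.card_bij' (fun x _ => (Equiv.funSplitAt c (Fin m)).symm (v, x))
    (fun e _ => (Equiv.funSplitAt c (Fin m) e).2) ?_ ?_ ?_ ?_
  · intro x hx
    rw [mem_link] at hx
    simp only [Finset.mem_filter, hx, true_and]
    simp
  · intro e he
    obtain ⟨hE, rfl⟩ := Finset.mem_filter.1 he
    rw [mem_link]
    have h : ((e c, ((Equiv.funSplitAt c (Fin m)) e).2) : Fin m × _)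
      = (Equiv.funSplitAt c (Fin m)) e := rfl
    rw [h, Equiv.symm_apply_apply]
    exact hE
  · intro x hx
    rw [Equiv.apply_symm_apply]
  · intro e he
    obtain ⟨-, rfl⟩ := Finset.mem_filter.1 he
    have h : ((e c, ((Equiv.funSplitAt c (Fin m)) e).2) : Fin m × _)
      = (Equiv.funSplitAt c (Fin m)) e := rfl
    rw [h, Equiv.symm_apply_apply]

theorem update_funSplitAt_symm (c : ι) (u v : Fin m) (x : {t // t ≠ c} → Fin m) :
    Function.update ((Equiv.funSplitAt c (Fin m)).symm (u, x)) c v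
      = (Equiv.funSplitAt c (Fin m)).symm (v, x) := by
  ext t
  by_cases ht : t = c
  · subst ht
    simp
  · simp [ht]

theorem card_link_inter (E : Finset (ι → Fin m)) (c : ι) (u v : Fin m) :
    (link E c u ∩ link E c v).card = codeg E c u v := by
  unfold codeg
  refine Finset.card_bij' (fun x _ => (Equiv.funSplitAt c (Fin m)).symm (u, x))
    (fun e _ => (Equiv.funSplitAt c (Fin m) e).2) ?_ ?_ ?_ ?_
  · intro x hx
    rw [Finset.mem_inter, mem_link, mem_link] at hx
    simp only [Finset.mem_filter, hx, true_and]
    rw [update_funSplitAt_symm]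
    refine ⟨by simp, hx.2⟩
  · intro e he
    obtain ⟨hE, rfl, he2⟩ := Finset.mem_filter.1 he
    rw [Finset.mem_inter, mem_link, mem_link]
    have h : ((e c, ((Equiv.funSplitAt c (Fin m)) e).2) : Fin m × _)
      = (Equiv.funSplitAt c (Fin m)) e := rfl
    rw [← update_funSplitAt_symm c (e c) v, h, Equiv.symm_apply_apply]
    exact ⟨hE, he2⟩
  · intro x hx
    rw [Equiv.apply_symm_apply]
  · intro e he
    obtain ⟨he, rfl, -⟩ := Finset.mem_filter.1 he
    have h : ((e c, ((Equiv.funSplitAt c (Fin m)) e).2) : Fin m × _)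
      = (Equiv.funSplitAt c (Fin m)) e := rfl
    rw [h, Equiv.symm_apply_apply]

theorem card_link_type (c : ι) :
    Fintype.card ({t // t ≠ c} → Fin m) = m ^ (Fintype.card ι - 1) := by
  rw [Fintype.card_fun, Fintype.card_fin]
  congr 1
  simp [Fintype.card_subtype_compl]

theorem card_degFam_empty (d : ℕ) (c : ι) (D : Fin m → ℕ) :
    (degFam (∅ : Finset ι) d c D).card = ∏ v, (m ^ (Fintype.card ι - 1)).choose (D v) := by
  have h1 : (Fintype.piFinset fun v => Finset.powersetCard (D v)
      (Finset.univ : Finset ({t // t ≠ c} → Fin m))).card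
      = ∏ v, (m ^ (Fintype.card ι - 1)).choose (D v) := by
    rw [Fintype.card_piFinset]
    refine Finset.prod_congr rfl fun v _ => ?_
    rw [Finset.card_powersetCard, Finset.card_univ, card_link_type]
  rw [← h1]
  refine Finset.card_equiv (linkEquiv c) fun E => ?_
  simp only [degFam, Finset.mem_filter, Finset.mem_univ, true_and, Finset.notMem_empty,
    false_implies, implies_true, Fintype.mem_piFinset, Finset.mem_powersetCard,
    Finset.subset_univ]
  refine forall_congr' fun v => ?_
  rw [← card_link]
  rfl

end Links

section Collisions

theorem card_filter_card_le {X : Type*} [Fintype X] [DecidableEq X] (h : ℕ) :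
    (Finset.univ.filter (fun S : Finset X => S.card ≤ h)).card ≤ (Fintype.card X + 1) ^ h := by
  have h1 : Finset.univ.filter (fun S : Finset X => S.card ≤ h)
      = (Finset.range (h + 1)).biUnion (fun i => Finset.powersetCard i Finset.univ) := by
    ext S
    simp
  rw [h1]
  refine Finset.card_biUnion_le.trans ?_
  rw [add_pow]
  refine Finset.sum_le_sum fun i hi => ?_
  rw [Finset.card_powersetCard, Finset.card_univ, one_pow, mul_one]
  refine (Nat.choose_le_pow _ _).trans (Nat.le_mul_of_pos_right _ (Nat.choose_pos ?_))
  exact Nat.lt_succ_iff.1 (Finset.mem_range.1 hi)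

theorem card_filter_lt_inter_le {X : Type*} [Fintype X] [DecidableEq X] (d h : ℕ)
    (L : Finset X) (hL : L.card = d) :
    (Finset.univ.filter (fun S : Finset X => S.card = d ∧ d < h + (L ∩ S).card)).card
      ≤ (Fintype.card X + 1) ^ (2 * h) := by
  rw [two_mul, pow_add]
  refine le_trans ?_ (Nat.mul_le_mul (card_filter_card_le (X := X) h) (card_filter_card_le h))
  rw [← Finset.card_product]
  refine Finset.card_le_card_of_injOn (fun S => (L \ S, S \ L)) ?_ ?_
  · intro S hS
    simp only [Finset.coe_filter, Set.mem_ofPred_eq, Finset.mem_univ, true_and, Finset.coe_product,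
      Set.mem_prod] at hS ⊢
    have h1 := Finset.card_sdiff_add_card_inter L S
    have h2 := Finset.card_sdiff_add_card_inter S L
    rw [Finset.inter_comm] at h2
    omega
  · intro S hS S' hS' h
    simp only [Prod.mk.injEq] at h
    ext x
    have h1 := Finset.ext_iff.1 h.1 x
    have h2 := Finset.ext_iff.1 h.2 x
    simp only [Finset.mem_sdiff] at h1 h2
    tauto

theorem sum_pow_collisions_le {Y : Type*} [Fintype Y] (R : Y → Y → Prop) [DecidableRel R]
    {M : ℕ} (hM : ∀ y, (Finset.univ.filter (fun y' => R y y')).card ≤ M) {x : ℝ} (hx : 1 ≤ x)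
    (m n : ℕ) (hn : n ≤ m) :
    ∑ f : Fin n → Y, x ^ (Finset.univ.filter (fun β => ∃ α < β, R (f α) (f β))).card
      ≤ (Fintype.card Y + x * m * M) ^ n := by
  induction n with
  | zero => simp
  | succ n ih =>
    rw [← Equiv.sum_comp (Fin.snocEquiv (fun _ => Y)), Fintype.sum_prod_type, Finset.sum_comm,
      pow_succ]
    have hstep : ∀ f : Fin n → Y, ∑ y : Y, x ^ (Finset.univ.filter (fun β => ∃ α < β,
        R ((Fin.snocEquiv (fun _ => Y) (y, f)) α) ((Fin.snocEquiv (fun _ => Y) (y, f)) β))).card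
        ≤ x ^ (Finset.univ.filter (fun β => ∃ α < β, R (f α) (f β))).card
          * (Fintype.card Y + x * m * M) := by
      intro f
      have h1 : ∀ y : Y, x ^ (Finset.univ.filter (fun β => ∃ α < β,
        R ((Fin.snocEquiv (fun _ => Y) (y, f)) α) ((Fin.snocEquiv (fun _ => Y) (y, f)) β))).card
        ≤ x ^ (Finset.univ.filter (fun β => ∃ α < β, R (f α) (f β))).card
          * (1 + ∑ α, if R (f α) y then x else 0) := by
        intro y
        have h2 : (Finset.univ.filter (fun β => ∃ α < β,
          R ((Fin.snocEquiv (fun _ => Y) (y, f)) α)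
            ((Fin.snocEquiv (fun _ => Y) (y, f)) β))).card
          = (Finset.univ.filter (fun β => ∃ α < β, R (f α) (f β))).card
            + if ∃ α, R (f α) y then 1 else 0 := by
          rw [Finset.card_filter, Fin.sum_univ_castSucc, Finset.card_filter]
          congr 1
          · refine Finset.sum_congr rfl fun β _ => ?_
            simp [Fin.exists_fin_succ', Fin.snocEquiv, (Fin.le_last _).not_gt]
          · simp [Fin.exists_fin_succ', Fin.snocEquiv, Fin.castSucc_lt_last]
        rw [h2, pow_add]
        refine mul_le_mul_of_nonneg_left ?_ (by positivity)
        have hnn : ∀ α : Fin n, 0 ≤ if R (f α) y then x else 0 := by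
          intro α
          split_ifs
          · linarith
          · exact le_rfl
        split_ifs with h
        · obtain ⟨α, hα⟩ := h
          have := Finset.single_le_sum (fun α _ => hnn α) (Finset.mem_univ α)
          rw [if_pos hα] at this
          linarith
        · have := Finset.sum_nonneg fun α (_ : α ∈ Finset.univ) => hnn α
          simpa using this
      refine (Finset.sum_le_sum fun y _ => h1 y).trans ?_
      rw [← Finset.mul_sum]
      refine mul_le_mul_of_nonneg_left ?_ (by positivity)
      rw [Finset.sum_add_distrib, Finset.sum_comm]
      have h3 : ∀ α : Fin n, ∑ y : Y, (if R (f α) y then x else 0) ≤ x * M := by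
        intro α
        rw [← Finset.sum_filter, Finset.sum_const, nsmul_eq_mul, mul_comm]
        have : ((Finset.univ.filter (fun y' => R (f α) y')).card : ℝ) ≤ M := by
          exact_mod_cast hM (f α)
        gcongr
      have h4 := Finset.sum_le_sum fun α (_ : α ∈ (Finset.univ : Finset (Fin n))) => h3 α
      rw [Finset.sum_const, Finset.card_univ, Fintype.card_fin, nsmul_eq_mul] at h4
      have h5 : (n : ℝ) * (x * M) ≤ m * (x * M) := by
        have : (n : ℝ) ≤ m := by exact_mod_cast (by omega : n ≤ m)
        gcongr
      simp only [Finset.sum_const, Finset.card_univ, nsmul_eq_mul, mul_one]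
      linarith
    refine (Finset.sum_le_sum fun f _ => hstep f).trans ?_
    rw [← Finset.sum_mul]
    exact mul_le_mul_of_nonneg_right (ih (by omega)) (by positivity)

end Collisions

section ClosePairs

theorem inter_card_triangle {X : Type*} [DecidableEq X] {S T U : Finset X} :
    (S ∩ T).card + (T ∩ U).card ≤ T.card + (S ∩ U).card := by
  have h1 := Finset.card_union_add_card_inter (S ∩ T) (T ∩ U)
  have h2 : ((S ∩ T) ∪ (T ∩ U)).card ≤ T.card := by
    refine Finset.card_le_card ?_
    intro x hx
    simp only [Finset.mem_union, Finset.mem_inter] at hx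
    tauto
  have h3 : ((S ∩ T) ∩ (T ∩ U)).card ≤ (S ∩ U).card := by
    refine Finset.card_le_card ?_
    intro x hx
    simp only [Finset.mem_inter] at hx ⊢
    tauto
  omega

/-- Indices whose set is `2 g`-close to a set of smaller index. -/
def lateClose {X : Type*} [DecidableEq X] {m : ℕ} (d g : ℕ) (f : Fin m → Finset X) :
    Finset (Fin m) :=
  Finset.univ.filter (fun β => ∃ α < β, d < 2 * g + (f α ∩ f β).card)

theorem card_close_le {X : Type*} [DecidableEq X] {m : ℕ} {d : ℕ} (g : ℕ) {f : Fin m → Finset X}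
    (hf : ∀ v, (f v).card = d) :
    (Finset.univ.filter (fun q : Fin m × Fin m =>
      q.1 ≠ q.2 ∧ d < g + (f q.1 ∩ f q.2).card)).card ≤ 3 * (lateClose d g f).card ^ 2 := by
  set R := lateClose d g f with hR
  have hmem : ∀ a b : Fin m, a ≠ b → d < 2 * g + (f a ∩ f b).card → a ∉ R → b ∈ R := by
    intro a b hab h ha
    simp only [hR, lateClose, Finset.mem_filter, Finset.mem_univ, true_and] at ha ⊢
    rcases lt_or_gt_of_ne hab with h1 | h1
    · exact ⟨a, h1, h⟩
    · exact absurd ⟨b, h1, by rwa [Finset.inter_comm]⟩ ha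
  have hone : ∀ a a' b : Fin m, a ∉ R → a' ∉ R → d < g + (f a ∩ f b).card →
      d < g + (f a' ∩ f b).card → a = a' := by
    intro a a' b ha ha' h h'
    by_contra hne
    refine ha' (hmem a a' hne ?_ ha)
    have := inter_card_triangle (S := f a) (T := f b) (U := f a')
    rw [Finset.inter_comm (f b)] at this
    have := hf b
    omega
  set P := Finset.univ.filter (fun q : Fin m × Fin m =>
      q.1 ≠ q.2 ∧ d < g + (f q.1 ∩ f q.2).card) with hP
  have hPm : ∀ q : Fin m × Fin m, q ∈ P ↔ q.1 ≠ q.2 ∧ d < g + (f q.1 ∩ f q.2).card := by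
    intro q
    simp [hP]
  have hsub : P ⊆ (R ×ˢ R) ∪ (P.filter (fun q => q.1 ∉ R) ∪ P.filter (fun q => q.2 ∉ R)) := by
    intro q hq
    simp only [Finset.mem_union, Finset.mem_product, Finset.mem_filter]
    tauto
  have h1 : (P.filter (fun q => q.1 ∉ R)).card ≤ R.card := by
    refine Finset.card_le_card_of_injOn (fun q => q.2) ?_ ?_
    · intro q hq
      rw [Finset.mem_coe, Finset.mem_filter, hPm] at hq
      exact hmem q.1 q.2 hq.1.1 (by omega) hq.2
    · intro q hq q' hq' h
      rw [Finset.mem_coe, Finset.mem_filter, hPm] at hq hq'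
      have h : q.2 = q'.2 := h
      refine Prod.ext (hone q.1 q'.1 q.2 hq.2 hq'.2 hq.1.2 ?_) h
      rw [h]
      exact hq'.1.2
  have h2 : (P.filter (fun q => q.2 ∉ R)).card ≤ R.card := by
    refine Finset.card_le_card_of_injOn (fun q => q.1) ?_ ?_
    · intro q hq
      rw [Finset.mem_coe, Finset.mem_filter, hPm] at hq
      refine hmem q.2 q.1 hq.1.1.symm ?_ hq.2
      rw [Finset.inter_comm]
      omega
    · intro q hq q' hq' h
      rw [Finset.mem_coe, Finset.mem_filter, hPm] at hq hq'
      have h : q.1 = q'.1 := h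
      refine Prod.ext h (hone q.2 q'.2 q.1 hq.2 hq'.2 ?_ ?_)
      · rw [Finset.inter_comm]
        exact hq.1.2
      · rw [h, Finset.inter_comm]
        exact hq'.1.2
  have h3 := Finset.card_le_card hsub
  have h4 := Finset.card_union_le (R ×ˢ R)
    (P.filter (fun q => q.1 ∉ R) ∪ P.filter (fun q => q.2 ∉ R))
  have h5 := Finset.card_union_le (P.filter (fun q => q.1 ∉ R)) (P.filter (fun q => q.2 ∉ R))
  rw [Finset.card_product] at h4
  have h6 : R.card ≤ R.card ^ 2 := Nat.le_self_pow two_ne_zero _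
  nlinarith

variable {ι : Type*} [Fintype ι] [DecidableEq ι] {m : ℕ}

theorem card_closePairs_le {d : ℕ} (g : ℕ) {E : Finset (ι → Fin m)} {s : ι}
    (hE : ∀ v, vdeg E s v = d) :
    (closePairs d g E s).card ≤ 3 * (lateClose d g (link E s)).card ^ 2 := by
  refine le_trans (le_of_eq ?_) (card_close_le g (f := link E s) fun v => by rw [card_link, hE])
  simp only [closePairs, card_link_inter]

theorem sum_pow_lateClose_le (d g : ℕ) (s : ι) {x : ℝ} (hx : 1 ≤ x) :
    ∑ E : Finset (ι → Fin m) with ∀ v, vdeg E s v = d, x ^ (lateClose d g (link E s)).card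
      ≤ (((m ^ (Fintype.card ι - 1)).choose d : ℕ)
        + x * m * ((m ^ (Fintype.card ι - 1) + 1) ^ (4 * g) : ℕ)) ^ m := by
  have h1 := sum_pow_collisions_le (Y := {L : Finset ({t // t ≠ s} → Fin m) // L.card = d})
    (fun L L' => d < 2 * g + (L.1 ∩ L'.1).card)
    (M := (m ^ (Fintype.card ι - 1) + 1) ^ (4 * g)) (by
      intro L
      have := card_filter_lt_inter_le d (2 * g) L.1 L.2
      rw [card_link_type, ← mul_assoc] at this
      refine le_trans ?_ this
      refine Finset.card_le_card_of_injOn Subtype.val ?_ (Subtype.val_injective.injOn)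
      intro L' hL'
      simp only [Finset.coe_filter, Set.mem_ofPred_eq, Finset.mem_univ, true_and] at hL' ⊢
      exact ⟨L'.2, hL'⟩) hx m m le_rfl
  have h2 : Fintype.card {L : Finset ({t // t ≠ s} → Fin m) // L.card = d}
      = (m ^ (Fintype.card ι - 1)).choose d := by
    rw [← card_link_type s, Fintype.card_finset_len]
  rw [h2] at h1
  refine le_trans (le_of_eq ?_) h1
  have hlink : ∀ E : Finset (ι → Fin m), link E s = linkEquiv s E := fun E => rfl
  refine Finset.sum_bij' (fun E hE => fun v => ⟨link E s v, by
      rw [card_link]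
      exact (Finset.mem_filter.1 hE).2 v⟩) (fun f _ => (linkEquiv s).symm fun v => (f v).1)
      ?_ ?_ ?_ ?_ ?_
  · intro E hE
    exact Finset.mem_univ _
  · intro f _
    rw [Finset.mem_filter]
    refine ⟨Finset.mem_univ _, fun v => ?_⟩
    rw [← card_link, hlink, Equiv.apply_symm_apply]
    exact (f v).2
  · intro E hE
    exact (linkEquiv s).symm_apply_apply E
  · intro f _
    funext v
    refine Subtype.ext ?_
    simp only [hlink, Equiv.apply_symm_apply]
  · intro E hE
    rfl

theorem sum_closePairs_le (A : Finset ι) (d : ℕ) (c : ι) (D : Fin m → ℕ) {s : ι} (hs : s ∈ A)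
    {g K : ℕ} {x : ℝ} (hx : 1 ≤ x)
    (h1 : x * m * ((m ^ (Fintype.card ι - 1) + 1) ^ (4 * g) : ℕ)
      ≤ ((m ^ (Fintype.card ι - 1)).choose d : ℕ))
    (h2 : (m : ℝ) ^ 2 * (2 * ((m ^ (Fintype.card ι - 1)).choose d : ℕ)) ^ m
      ≤ x ^ K * (degFam A d c D).card) :
    ∑ E ∈ degFam A d c D, ((closePairs d g E s).card : ℝ)
      ≤ 3 * (K ^ 2 + 1) * (degFam A d c D).card := by
  have hx0 : 0 < x := by linarith
  have hreg : ∀ E ∈ degFam A d c D, ∀ v, vdeg E s v = d := by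
    intro E hE
    exact (Finset.mem_filter.1 hE).2.1 s hs
  have h3 : ∀ E ∈ degFam A d c D, ((closePairs d g E s).card : ℝ)
      ≤ 3 * K ^ 2 + 3 * m ^ 2 / x ^ K * x ^ (lateClose d g (link E s)).card := by
    intro E hE
    have h4 : ((closePairs d g E s).card : ℝ) ≤ 3 * (lateClose d g (link E s)).card ^ 2 := by
      exact_mod_cast card_closePairs_le g (hreg E hE)
    refine h4.trans ?_
    have hle : (lateClose d g (link E s)).card ≤ m := by
      refine (Finset.card_le_univ _).trans ?_
      simp
    rcases le_total (lateClose d g (link E s)).card K with hc | hc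
    · have : ((lateClose d g (link E s)).card : ℝ) ≤ K := by exact_mod_cast hc
      have : ((lateClose d g (link E s)).card : ℝ) ^ 2 ≤ K ^ 2 := by gcongr
      have : 0 ≤ 3 * (m : ℝ) ^ 2 / x ^ K * x ^ (lateClose d g (link E s)).card := by positivity
      linarith
    · have : ((lateClose d g (link E s)).card : ℝ) ^ 2 ≤ m ^ 2 := by gcongr
      have h5 : 1 ≤ x ^ (lateClose d g (link E s)).card / x ^ K := by
        rw [one_le_div (by positivity)]
        exact pow_le_pow_right₀ hx hc
      have h6 : 3 * (m : ℝ) ^ 2 / x ^ K * x ^ (lateClose d g (link E s)).card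
        = 3 * m ^ 2 * (x ^ (lateClose d g (link E s)).card / x ^ K) := by ring
      rw [h6]
      have : (3 * (m : ℝ) ^ 2) * 1 ≤ 3 * m ^ 2 * (x ^ (lateClose d g (link E s)).card / x ^ K) := by
        gcongr
      nlinarith [sq_nonneg (K : ℝ)]
  refine (Finset.sum_le_sum h3).trans ?_
  rw [Finset.sum_add_distrib, Finset.sum_const, nsmul_eq_mul, ← Finset.mul_sum]
  have h7 : ∑ E ∈ degFam A d c D, x ^ (lateClose d g (link E s)).card
      ≤ (2 * ((m ^ (Fintype.card ι - 1)).choose d : ℕ)) ^ m := by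
    refine (Finset.sum_le_sum_of_subset_of_nonneg (t := Finset.univ.filter
      (fun E => ∀ v, vdeg E s v = d)) ?_ ?_).trans ((sum_pow_lateClose_le d g s hx).trans ?_)
    · intro E hE
      exact Finset.mem_filter.2 ⟨Finset.mem_univ _, hreg E hE⟩
    · intros
      positivity
    · gcongr
      linarith
  have h8 : 3 * (m : ℝ) ^ 2 / x ^ K * ∑ E ∈ degFam A d c D, x ^ (lateClose d g (link E s)).card
      ≤ 3 * (degFam A d c D).card := by
    rw [div_mul_eq_mul_div, div_le_iff₀ (by positivity)]
    have := mul_le_mul_of_nonneg_left h7 (show (0 : ℝ) ≤ 3 * m ^ 2 by positivity)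
    linarith
  linarith

end ClosePairs

section SecondMoment

variable {ι : Type*} [Fintype ι] [DecidableEq ι] {m : ℕ}

/-- Edge sets of size `k` that are regular of degree `d` in the classes of `A`. -/
def regFam (ι : Type*) [Fintype ι] [DecidableEq ι] (m : ℕ) (A : Finset ι) (d k : ℕ) :
    Finset (Finset (ι → Fin m)) :=
  Finset.univ.filter (fun E => E.card = k ∧ ∀ s ∈ A, ∀ v, vdeg E s v = d)

theorem vdeg_map {π : Equiv.Perm (ι → Fin m)} {s : ι} (hπ : ∀ e, (π e) s = e s)
    (E : Finset (ι → Fin m)) (v : Fin m) : vdeg (E.map π.toEmbedding) s v = vdeg E s v := by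
  unfold vdeg
  rw [Finset.filter_map, Finset.card_map]
  congr 1
  ext e
  simp [hπ]

theorem sum_regFam_map {π : Equiv.Perm (ι → Fin m)} {A : Finset ι}
    (hπ : ∀ s ∈ A, ∀ e, (π e) s = e s) (d k : ℕ) (φ : Finset (ι → Fin m) → ℝ) :
    ∑ E ∈ regFam ι m A d k, φ (E.map π.toEmbedding) = ∑ E ∈ regFam ι m A d k, φ E := by
  refine Finset.sum_equiv π.finsetCongr ?_ ?_
  · intro E
    simp only [regFam, Finset.mem_filter, Finset.mem_univ, true_and, Equiv.finsetCongr_apply,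
      Finset.card_map]
    refine and_congr_right fun _ => forall₂_congr fun s hs => forall_congr' fun v => ?_
    rw [vdeg_map (hπ s hs)]
  · intro E _
    rfl

/-- Difference of the indicators of the edges completing `x` through `u` and through `v`. -/
def lineDiff (c : ι) (u v : Fin m) (x : {t // t ≠ c} → Fin m) (E : Finset (ι → Fin m)) : ℝ :=
  (if (Equiv.funSplitAt c (Fin m)).symm (u, x) ∈ E then 1 else 0)
    - if (Equiv.funSplitAt c (Fin m)).symm (v, x) ∈ E then 1 else 0

theorem vdeg_eq_sum_line (c : ι) (u : Fin m) (E : Finset (ι → Fin m)) :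
    (vdeg E c u : ℝ) = ∑ x, if (Equiv.funSplitAt c (Fin m)).symm (u, x) ∈ E then 1 else 0 := by
  rw [← card_link, link, Finset.card_filter]
  push_cast
  rfl

theorem sum_lineDiff_mul_eq_zero {A : Finset ι} {c : ι} (hc : c ∉ A) (d k : ℕ) {u v : Fin m}
    {x y : {t // t ≠ c} → Fin m} (hxy : x ≠ y) :
    ∑ E ∈ regFam ι m A d k, lineDiff c u v x E * lineDiff c u v y E = 0 := by
  set φ := (Equiv.funSplitAt c (Fin m)).symm with hφ
  set π : Equiv.Perm (ι → Fin m) := Equiv.swap (φ (u, x)) (φ (v, x)) with hπ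
  have hs : ∀ s ∈ A, ∀ e, (π e) s = e s := by
    intro s hs e
    have hsc : s ≠ c := fun h => hc (h ▸ hs)
    have h1 : φ (u, x) s = φ (v, x) s := by simp [hφ, hsc]
    rw [hπ, Equiv.swap_apply_def]
    split_ifs with h2 h3
    · rw [h2, h1]
    · rw [h3, h1]
    · rfl
  have hne : ∀ a b, φ (a, y) ≠ φ (b, x) := by
    intro a b h
    have := φ.injective h
    exact hxy (Prod.ext_iff.1 this).2.symm
  have h := sum_regFam_map hs d k (fun E => lineDiff c u v x E * lineDiff c u v y E)
  have h2 : ∀ E : Finset (ι → Fin m), lineDiff c u v x (E.map π.toEmbedding)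
      * lineDiff c u v y (E.map π.toEmbedding) = - (lineDiff c u v x E * lineDiff c u v y E) := by
    intro E
    simp only [lineDiff, Finset.mem_map_equiv, ← hφ, hπ, Equiv.symm_swap,
      Equiv.swap_apply_left, Equiv.swap_apply_right,
      Equiv.swap_apply_of_ne_of_ne (hne u u) (hne u v),
      Equiv.swap_apply_of_ne_of_ne (hne v u) (hne v v)]
    ring
  simp only [h2, Finset.sum_neg_distrib] at h
  linarith

theorem sum_sq_vdeg_sub_le {A : Finset ι} {c : ι} (hc : c ∉ A) (d k : ℕ) (u v : Fin m) :
    ∑ E ∈ regFam ι m A d k, ((vdeg E c u : ℝ) - vdeg E c v) ^ 2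
      ≤ ∑ E ∈ regFam ι m A d k, ((vdeg E c u : ℝ) + vdeg E c v) := by
  have h1 : ∀ E : Finset (ι → Fin m), ((vdeg E c u : ℝ) - vdeg E c v) ^ 2
      = ∑ x, ∑ y, lineDiff c u v x E * lineDiff c u v y E := by
    intro E
    rw [vdeg_eq_sum_line, vdeg_eq_sum_line, ← Finset.sum_sub_distrib, sq, Finset.sum_mul_sum]
    rfl
  simp only [h1]
  rw [Finset.sum_comm]
  have h2 : ∀ x, ∑ E ∈ regFam ι m A d k, ∑ y, lineDiff c u v x E * lineDiff c u v y E
      = ∑ E ∈ regFam ι m A d k, lineDiff c u v x E ^ 2 := by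
    intro x
    rw [Finset.sum_comm, Finset.sum_eq_single x]
    · simp only [sq]
    · intro y _ hy
      exact sum_lineDiff_mul_eq_zero hc d k hy.symm
    · simp
  rw [Finset.sum_congr rfl fun x _ => h2 x, Finset.sum_comm]
  refine Finset.sum_le_sum fun E _ => ?_
  rw [vdeg_eq_sum_line, vdeg_eq_sum_line, ← Finset.sum_add_distrib]
  refine Finset.sum_le_sum fun x _ => ?_
  unfold lineDiff
  split_ifs <;> norm_num

theorem sum_vdeg (E : Finset (ι → Fin m)) (c : ι) : ∑ v, vdeg E c v = E.card := by
  unfold vdeg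
  rw [← Finset.card_eq_sum_card_fiberwise]
  intro e _
  exact Finset.mem_coe.2 (Finset.mem_univ _)

/-- Sum of the squared deviations of the degrees from `d`. -/
def sqDev (d : ℕ) (D : Fin m → ℕ) : ℝ := ∑ v, ((D v : ℝ) - d) ^ 2

theorem sum_sum_sq_sub (d : ℕ) {D : Fin m → ℕ} (hD : ∑ v, D v = m * d) :
    ∑ u, ∑ v, ((D u : ℝ) - D v) ^ 2 = 2 * m * sqDev d D := by
  have hD' : ∑ v, ((D v : ℝ) - d) = 0 := by
    rw [Finset.sum_sub_distrib, ← Nat.cast_sum, hD]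
    simp
  have h1 : ∀ u v, ((D u : ℝ) - D v) ^ 2 = ((D u : ℝ) - d) ^ 2
      + ((D v : ℝ) - d) ^ 2 - 2 * (((D u : ℝ) - d) * ((D v : ℝ) - d)) := by
    intro u v
    ring
  simp only [h1, Finset.sum_sub_distrib, Finset.sum_add_distrib, ← Finset.mul_sum, hD',
    Finset.sum_const, Finset.card_univ, Fintype.card_fin, nsmul_eq_mul, mul_zero,
    sub_zero]
  unfold sqDev
  ring

theorem sum_sqDev_vdeg_le (hm : 0 < m) {A : Finset ι} {c : ι} (hc : c ∉ A) (d : ℕ) :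
    ∑ E ∈ regFam ι m A d (m * d), sqDev d (vdeg E c)
      ≤ m * d * (regFam ι m A d (m * d)).card := by
  have h1 : ∀ E ∈ regFam ι m A d (m * d), 2 * m * sqDev d (vdeg E c)
      = ∑ u, ∑ v, ((vdeg E c u : ℝ) - vdeg E c v) ^ 2 := by
    intro E hE
    rw [sum_sum_sq_sub]
    rw [sum_vdeg]
    exact (Finset.mem_filter.1 hE).2.1
  have h2 : ∀ E ∈ regFam ι m A d (m * d), ∑ u, ∑ v, ((vdeg E c u : ℝ) + vdeg E c v)
      = 2 * m * (m * d) := by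
    intro E hE
    have h3 : ∑ v, (vdeg E c v : ℝ) = m * d := by
      rw [← Nat.cast_sum, sum_vdeg, (Finset.mem_filter.1 hE).2.1]
      push_cast
      rfl
    simp only [Finset.sum_add_distrib, Finset.sum_const, Finset.card_univ, Fintype.card_fin,
      nsmul_eq_mul, h3, ← Finset.mul_sum]
    ring
  have h4 : 2 * m * ∑ E ∈ regFam ι m A d (m * d), sqDev d (vdeg E c)
      ≤ 2 * m * (m * d * (regFam ι m A d (m * d)).card) := by
    rw [Finset.mul_sum, Finset.sum_congr rfl h1]
    calc _ = ∑ u, ∑ v, ∑ E ∈ regFam ι m A d (m * d), ((vdeg E c u : ℝ) - vdeg E c v) ^ 2 := by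
          rw [Finset.sum_comm]
          refine Finset.sum_congr rfl fun u _ => ?_
          rw [Finset.sum_comm]
      _ ≤ ∑ u, ∑ v, ∑ E ∈ regFam ι m A d (m * d), ((vdeg E c u : ℝ) + vdeg E c v) :=
          Finset.sum_le_sum fun u _ => Finset.sum_le_sum fun v _ =>
            sum_sq_vdeg_sub_le hc d (m * d) u v
      _ = ∑ E ∈ regFam ι m A d (m * d), ∑ u, ∑ v, ((vdeg E c u : ℝ) + vdeg E c v) := by
          symm
          rw [Finset.sum_comm]
          refine Finset.sum_congr rfl fun u _ => ?_
          rw [Finset.sum_comm]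
      _ = _ := by
          rw [Finset.sum_congr rfl h2, Finset.sum_const, nsmul_eq_mul]
          ring
  have : (0 : ℝ) < 2 * m := by positivity
  exact le_of_mul_le_mul_left h4 this

theorem sum_regFam_eq (A : Finset ι) (d : ℕ) (c : ι) (k : ℕ) (φ : (Fin m → ℕ) → ℝ) :
    ∑ E ∈ regFam ι m A d k, φ (vdeg E c)
      = ∑ D ∈ Finset.piAntidiag Finset.univ k, (degFam A d c D).card * φ D := by
  rw [← Finset.sum_fiberwise_of_maps_to (g := fun E => vdeg E c)
    (t := Finset.piAntidiag Finset.univ k)]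
  · refine Finset.sum_congr rfl fun D hD => ?_
    have h1 : (regFam ι m A d k).filter (fun E => vdeg E c = D) = degFam A d c D := by
      ext E
      simp only [regFam, degFam, Finset.mem_filter, Finset.mem_univ, true_and, funext_iff]
      constructor
      · rintro ⟨⟨-, h2⟩, h3⟩
        exact ⟨h2, h3⟩
      · rintro ⟨h2, h3⟩
        refine ⟨⟨?_, h2⟩, h3⟩
        rw [← sum_vdeg E c, Finset.sum_congr rfl fun v _ => h3 v]
        exact (Finset.mem_piAntidiag.1 hD).1
    rw [h1, ← nsmul_eq_mul, ← Finset.sum_const]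
    refine Finset.sum_congr rfl fun E hE => ?_
    rw [← funext (Finset.mem_filter.1 hE).2.2]
  · intro E hE
    rw [Finset.mem_piAntidiag, sum_vdeg]
    exact ⟨(Finset.mem_filter.1 hE).2.1, fun v _ => Finset.mem_univ v⟩

theorem card_regFam_eq (A : Finset ι) (d : ℕ) (c : ι) (k : ℕ) :
    ((regFam ι m A d k).card : ℝ)
      = ∑ D ∈ Finset.piAntidiag Finset.univ k, ((degFam (m := m) A d c D).card : ℝ) := by
  have := sum_regFam_eq (m := m) A d c k (fun _ => 1)
  simpa using this

theorem sum_card_mul_sqDev_le (hm : 0 < m) {A : Finset ι} {c : ι} (hc : c ∉ A) (d : ℕ) :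
    ∑ D ∈ Finset.piAntidiag Finset.univ (m * d), ((degFam (m := m) A d c D).card : ℝ) * sqDev d D
      ≤ m * d * (regFam ι m A d (m * d)).card := by
  rw [← sum_regFam_eq]
  exact sum_sqDev_vdeg_le hm hc d

theorem card_piAntidiag_le (m k : ℕ) :
    (Finset.piAntidiag (Finset.univ : Finset (Fin m)) k).card ≤ (k + 1) ^ m := by
  have h1 : (Fintype.piFinset fun _ : Fin m => Finset.range (k + 1)).card = (k + 1) ^ m := by
    simp
  rw [← h1]
  refine Finset.card_le_card fun D hD => ?_
  rw [Fintype.mem_piFinset]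
  intro v
  rw [Finset.mem_range, Nat.lt_succ_iff, ← (Finset.mem_piAntidiag.1 hD).1]
  exact Finset.single_le_sum (fun _ _ => Nat.zero_le _) (Finset.mem_univ v)

theorem card_regFam_empty (d k : ℕ) :
    (regFam ι m ∅ d k).card = (m ^ Fintype.card ι).choose k := by
  have : regFam ι m ∅ d k = Finset.powersetCard k Finset.univ := by
    ext E
    simp [regFam, Finset.mem_powersetCard]
  rw [this, Finset.card_powersetCard, Finset.card_univ]
  simp

end SecondMoment

section Run

theorem run_increment_le {a b d w δ Δ : ℝ} (hd : 2 * d ≤ w) (hb : 0 < b) (hbd : b ≤ d) (hda : d ≤ a)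
    (ha : 4 * a ≤ 3 * w) (hδ : 0 ≤ δ) (hΔ : 0 ≤ Δ) :
    (δ * (a * b / w) + Δ) * ((b * (w - a) / w)⁻¹ - (a * (w - b) / w)⁻¹)
      ≤ 8 * δ * (a - b) / w + 8 * Δ * (b⁻¹ - a⁻¹) := by
  have hw : 0 < w := by linarith
  have ha0 : 0 < a := by linarith
  have hwa : 0 < w - a := by linarith
  have hwb : 0 < w - b := by linarith
  have h1 : (δ * (a * b / w) + Δ) * ((b * (w - a) / w)⁻¹ - (a * (w - b) / w)⁻¹)
      = (δ * (a - b) / w + Δ * (b⁻¹ - a⁻¹)) * (w ^ 2 / ((w - a) * (w - b))) := by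
    field_simp
    ring
  have h2 : w ^ 2 / ((w - a) * (w - b)) ≤ 8 := by
    rw [div_le_iff₀ (by positivity)]
    nlinarith
  have h3 : 0 ≤ δ * (a - b) / w + Δ * (b⁻¹ - a⁻¹) := by
    have h4 : a⁻¹ ≤ b⁻¹ := by
      apply inv_anti₀ hb
      linarith
    have h5 : 0 ≤ a - b := by linarith
    have h6 : 0 ≤ b⁻¹ - a⁻¹ := by linarith
    positivity
  rw [h1]
  calc _ ≤ (δ * (a - b) / w + Δ * (b⁻¹ - a⁻¹)) * 8 := by gcongr
    _ = _ := by ring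

theorem defect_div_le {a b d w δ Δ : ℝ} (hd0 : 0 < d) (hd : 2 * d ≤ w) (hbd : b ≤ d)
    (hda : d ≤ a) (hδ : 0 ≤ δ) (hΔ : 0 ≤ Δ) :
    (δ * (a * b / w) + Δ) / (a * (w - b) / w) ≤ 2 * δ * d / w + 2 * Δ / d := by
  have hw : 0 < w := by linarith
  have ha0 : 0 < a := by linarith
  have hwb : 0 < w - b := by linarith
  have h1 : (δ * (a * b / w) + Δ) / (a * (w - b) / w)
      = (δ * b / w + Δ / a) * (w / (w - b)) := by
    field_simp
  have h2 : w / (w - b) ≤ 2 := by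
    rw [div_le_iff₀ hwb]
    linarith
  rw [h1]
  calc _ ≤ (δ * d / w + Δ / d) * 2 := by gcongr
    _ = _ := by ring

/-- Comparison of the two ends of a sequence of one-step degree transfers. -/
theorem run_compare {d w δ Δ a b : ℝ} (hd0 : 0 < d) (hd : 2 * d ≤ w) (hδ : 0 ≤ δ) (hΔ : 0 ≤ Δ)
    (hbd : b ≤ d) (hda : d ≤ a) (n : ℕ) (hb : 0 ≤ b - n) (ha : 4 * (a + n) ≤ 3 * w)
    (N W T Ψ : ℕ → ℝ) (hN : ∀ i ≤ n, 0 < N i) (hW : ∀ i ≤ n, 0 < W i)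
    (hT1 : ∀ i ≤ n, w * T i ≤ (a + i) * (b - i) * N i)
    (hT2 : ∀ i ≤ n, ((1 - δ) * ((a + i) * (b - i)) / w - Δ) * N i ≤ T i)
    (hNT : ∀ i < n, N i * (b - i) - T i = N (i + 1) * (a + (i + 1)) - T (i + 1))
    (hWW : ∀ i < n, W i * ((b - i) * (w - (a + i)))
      = W (i + 1) * ((a + (i + 1)) * (w - (b - (i + 1)))))
    (hΨ : ∀ i < n, 8 * δ * ((a + i) - (b - i)) / w + 8 * Δ * ((b - i)⁻¹ - (a + i)⁻¹)
      ≤ Ψ (i + 1) - Ψ i) :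
    N 0 / W 0 * Real.exp (-(2 * δ * d / w + 2 * Δ / d)) ≤ N n / W n ∧
    N n / W n ≤ N 0 / W 0 * Real.exp (2 * δ * d / w + 2 * Δ / d + (Ψ n - Ψ 0)) := by
  have hw : 0 < w := by linarith
  set e := 2 * δ * d / w + 2 * Δ / d with he
  set A : ℕ → ℝ := fun i => (a + i) * (w - (b - i)) / w with hA
  set B : ℕ → ℝ := fun i => (b - i) * (w - (a + i)) / w with hB
  set x : ℕ → ℝ := fun i => (a + i) * (b - i) / w - T i / N i with hx
  set Y : ℕ → ℝ := fun i => N i / W i * (1 + x i / A i) with hY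
  have hbi : ∀ i : ℕ, i ≤ n → 0 ≤ b - i := by
    intro i hi
    have : (i : ℝ) ≤ n := by exact_mod_cast hi
    linarith
  have hi0 : ∀ i : ℕ, (0 : ℝ) ≤ i := fun i => Nat.cast_nonneg i
  have hApos : ∀ i ≤ n, 0 < A i := by
    intro i hi
    have h1 := hi0 i
    have h2 : 0 < a + i := by linarith
    have h3 : 0 < w - (b - i) := by linarith
    positivity
  have hai : ∀ i : ℕ, i ≤ n → 4 * (a + i) ≤ 3 * w := by
    intro i hi
    have : (i : ℝ) ≤ n := by exact_mod_cast hi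
    linarith
  have hbi' : ∀ i : ℕ, i < n → 0 < b - i := by
    intro i hi
    have : (i : ℝ) + 1 ≤ n := by exact_mod_cast hi
    linarith
  have hBpos : ∀ i < n, 0 < B i := by
    intro i hi
    have h1 := hbi' i hi
    have h2 := hai i hi.le
    have h3 : 0 < w - (a + i) := by linarith
    positivity
  have hx0 : ∀ i ≤ n, 0 ≤ x i := by
    intro i hi
    have h1 := hN i hi
    rw [hx]
    simp only
    rw [sub_nonneg, div_le_div_iff₀ h1 hw]
    linarith [hT1 i hi]
  have hx1 : ∀ i ≤ n, x i ≤ δ * ((a + i) * (b - i) / w) + Δ := by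
    intro i hi
    have h1 := hN i hi
    have h2 : (1 - δ) * ((a + i) * (b - i)) / w - Δ ≤ T i / N i := by
      rw [le_div_iff₀ h1]
      exact hT2 i hi
    simp only [hx]
    have h3 : (1 - δ) * ((a + i) * (b - i)) / w
      = (a + i) * (b - i) / w - δ * ((a + i) * (b - i) / w) := by ring
    linarith
  have hxA : ∀ i ≤ n, 0 ≤ x i / A i ∧ x i / A i ≤ e := by
    intro i hi
    refine ⟨div_nonneg (hx0 i hi) (hApos i hi).le, ?_⟩
    have h1 := hi0 i
    refine le_trans ?_ (defect_div_le (a := a + i) (b := b - i) hd0 hd (by linarith)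
      (by linarith) hδ hΔ)
    have := hApos i hi
    have := hx1 i hi
    simp only [hA] at *
    gcongr
  have hstep : ∀ i < n, Y (i + 1) = N i / W i * (1 + x i / B i) := by
    intro i hi
    have h1 := hN i hi.le
    have h2 := hN (i + 1) hi
    have h3 := hW i hi.le
    have h4 := hW (i + 1) hi
    have h5 := hApos (i + 1) hi
    have h6 := hBpos i hi
    have h7 : N i * (B i + x i) = N (i + 1) * (A (i + 1) + x (i + 1)) := by
      have e1 : N i * (B i + x i) = N i * (b - i) - T i := by
        simp only [hB, hx]
        field_simp
        ring
      have e2 : N (i + 1) * (A (i + 1) + x (i + 1))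
          = N (i + 1) * (a + (i + 1)) - T (i + 1) := by
        simp only [hA, hx]
        push_cast
        field_simp
        ring
      rw [e1, e2, hNT i hi]
    have h8 : W i * B i = W (i + 1) * A (i + 1) := by
      have := hWW i hi
      simp only [hA, hB]
      push_cast
      rw [← mul_div_assoc, ← mul_div_assoc, this]
    have e1 : Y (i + 1) = N (i + 1) * (A (i + 1) + x (i + 1)) / (W (i + 1) * A (i + 1)) := by
      simp only [hY]
      field_simp
    rw [e1, ← h7, ← h8]
    field_simp
  have hYpos : ∀ i ≤ n, 0 < Y i := by
    intro i hi
    have := hN i hi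
    have := hW i hi
    have := (hxA i hi).1
    simp only [hY]
    positivity
  have hlow : ∀ i ≤ n, Y 0 ≤ Y i := by
    intro i
    induction i with
    | zero => exact fun _ => le_rfl
    | succ i ih =>
      intro hi
      refine (ih (by omega)).trans ?_
      rw [hstep i hi]
      have h1 := hN i (by omega)
      have h2 := hW i (by omega)
      have h3 := hx0 i (by omega)
      have h4 := hBpos i hi
      have h5 : B i ≤ A i := by
        simp only [hA, hB]
        have := hi0 i
        gcongr ?_ / w
        nlinarith
      simp only [hY]
      gcongr
  have hup : ∀ i ≤ n, Y i ≤ Y 0 * Real.exp (Ψ i - Ψ 0) := by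
    intro i
    induction i with
    | zero => intro _; simp
    | succ i ih =>
      intro hi
      have h1 := hN i (by omega)
      have h2 := hW i (by omega)
      have h3 := hx0 i (by omega)
      have h4 := hBpos i hi
      have h5 := hApos i (by omega)
      have h6 := hi0 i
      have h7 : Y (i + 1) ≤ Y i * (1 + x i * ((B i)⁻¹ - (A i)⁻¹)) := by
        rw [hstep i hi]
        simp only [hY]
        rw [mul_assoc]
        have h8 : B i ≤ A i := by
          simp only [hA, hB]
          gcongr ?_ / w
          nlinarith
        have h9 : (A i)⁻¹ ≤ (B i)⁻¹ := inv_anti₀ h4 h8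
        have h10 : 1 + x i / B i ≤ (1 + x i / A i) * (1 + x i * ((B i)⁻¹ - (A i)⁻¹)) := by
          have : 0 ≤ x i / A i * (x i * ((B i)⁻¹ - (A i)⁻¹)) := by
            have : 0 ≤ (B i)⁻¹ - (A i)⁻¹ := by linarith
            positivity
          have e1 : x i / B i = x i * (B i)⁻¹ := div_eq_mul_inv _ _
          have e2 : x i / A i = x i * (A i)⁻¹ := div_eq_mul_inv _ _
          rw [e2] at this
          rw [e1, e2]
          nlinarith
        gcongr
      have h8 : x i * ((B i)⁻¹ - (A i)⁻¹) ≤ Ψ (i + 1) - Ψ i := by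
        refine le_trans ?_ (hΨ i hi)
        refine le_trans ?_ (run_increment_le (a := a + i) (b := b - i) hd (hbi' i hi)
          (by linarith) (by linarith) (hai i (Nat.le_of_lt hi)) hδ hΔ)
        refine mul_le_mul_of_nonneg_right (hx1 i (Nat.le_of_lt hi)) ?_
        have h8 : B i ≤ A i := by
          simp only [hA, hB]
          gcongr ?_ / w
          nlinarith
        have h9 : (A i)⁻¹ ≤ (B i)⁻¹ := inv_anti₀ h4 h8
        exact sub_nonneg.2 h9
      have h9 : 1 + x i * ((B i)⁻¹ - (A i)⁻¹) ≤ Real.exp (Ψ (i + 1) - Ψ i) := by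
        have := Real.add_one_le_exp (Ψ (i + 1) - Ψ i)
        linarith
      have h10 := hYpos i (by omega)
      calc Y (i + 1) ≤ Y i * (1 + x i * ((B i)⁻¹ - (A i)⁻¹)) := h7
        _ ≤ Y i * Real.exp (Ψ (i + 1) - Ψ i) := by gcongr
        _ ≤ (Y 0 * Real.exp (Ψ i - Ψ 0)) * Real.exp (Ψ (i + 1) - Ψ i) := by
            gcongr
            exact ih (by omega)
        _ = Y 0 * Real.exp (Ψ (i + 1) - Ψ 0) := by
            rw [mul_assoc, ← Real.exp_add]
            congr 2
            ring
  have hZ0 : N 0 / W 0 ≤ Y 0 := by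
    have h1 := hN 0 (by omega)
    have h2 := hW 0 (by omega)
    exact le_mul_of_one_le_right (by positivity) (by linarith [(hxA 0 (by omega)).1])
  have hZn : N n / W n ≤ Y n := by
    have h1 := hN n le_rfl
    have h2 := hW n le_rfl
    exact le_mul_of_one_le_right (by positivity) (by linarith [(hxA n le_rfl).1])
  have hYe : ∀ i ≤ n, Y i ≤ N i / W i * Real.exp e := by
    intro i hi
    have h1 := hN i hi
    have h2 := hW i hi
    simp only [hY]
    gcongr
    linarith [(hxA i hi).2, Real.add_one_le_exp e]
  constructor
  · rw [Real.exp_neg, ← div_eq_mul_inv, div_le_iff₀ (Real.exp_pos _)]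
    exact hZ0.trans ((hlow n le_rfl).trans (hYe n le_rfl))
  · refine hZn.trans ((hup n le_rfl).trans ?_)
    rw [Real.exp_add, ← mul_assoc]
    gcongr
    exact hYe 0 (by omega)

end Run

section Compare

/-- The degree sequence with `t` units of degree moved from `u` to `v`. -/
def shift {m : ℕ} (D : Fin m → ℕ) (u v : Fin m) (t : ℕ) : Fin m → ℕ :=
  Function.update (Function.update D u (D u - t)) v (D v + t)

theorem shift_left {m : ℕ} (D : Fin m → ℕ) {u v : Fin m} (huv : u ≠ v) (t : ℕ) :
    shift D u v t u = D u - t := by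
  simp [shift, huv]

theorem shift_right {m : ℕ} (D : Fin m → ℕ) (u v : Fin m) (t : ℕ) :
    shift D u v t v = D v + t := by
  simp [shift]

theorem shift_of_ne {m : ℕ} (D : Fin m → ℕ) {u v x : Fin m} (hu : x ≠ u) (hv : x ≠ v) (t : ℕ) :
    shift D u v t x = D x := by
  simp [shift, hu, hv]

theorem shift_zero {m : ℕ} (D : Fin m → ℕ) (u v : Fin m) : shift D u v 0 = D := by
  simp [shift]

@[to_additive]
theorem prod_eq_mul_mul {m : ℕ} {M : Type*} [CommMonoid M] (f : Fin m → M) {u v : Fin m}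
    (huv : u ≠ v) :
    ∏ x, f x = f u * f v * ∏ x ∈ (Finset.univ.erase u).erase v, f x := by
  rw [mul_assoc, Finset.mul_prod_erase _ _ (by simp [huv.symm]),
    Finset.mul_prod_erase _ _ (Finset.mem_univ u)]

@[to_additive]
theorem prod_shift {m : ℕ} {M : Type*} [CommMonoid M] (D : Fin m → ℕ) (f : ℕ → M) {u v : Fin m}
    (huv : u ≠ v) (t : ℕ) :
    ∏ x, f (shift D u v t x)
      = f (D u - t) * f (D v + t) * ∏ x ∈ (Finset.univ.erase u).erase v, f (D x) := by
  rw [prod_eq_mul_mul _ huv, shift_left D huv, shift_right]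
  congr 1
  refine Finset.prod_congr rfl fun x hx => ?_
  simp only [Finset.mem_erase, Finset.mem_univ, and_true] at hx
  rw [shift_of_ne D hx.2 hx.1]

theorem sum_shift_eq {m : ℕ} (D : Fin m → ℕ) {u v : Fin m} (huv : u ≠ v) {t : ℕ} (ht : t ≤ D u) :
    ∑ x, shift D u v t x = ∑ x, D x := by
  have h1 := sum_shift D id huv t
  have h2 := sum_eq_add_add D huv
  simp only [id] at h1
  omega

/-- Number of ways of choosing the links of the vertices of one class. -/
noncomputable def linkWeight {m : ℕ} (w : ℕ) (D : Fin m → ℕ) : ℝ := ∏ v, (w.choose (D v) : ℝ)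

theorem linkWeight_pos {m w : ℕ} {D : Fin m → ℕ} (hD : ∀ v, D v ≤ w) : 0 < linkWeight w D :=
  Finset.prod_pos fun v _ => by exact_mod_cast Nat.choose_pos (hD v)

theorem choose_succ_mul_cast {w a : ℕ} (ha : a ≤ w) :
    (w.choose (a + 1) : ℝ) * (a + 1) = w.choose a * (w - a) := by
  have := Nat.choose_succ_right_eq w a
  rw [← Nat.cast_sub ha]
  exact_mod_cast this

theorem linkWeight_shift {m w : ℕ} (D : Fin m → ℕ) {u v : Fin m} (huv : u ≠ v) {t : ℕ}
    (ht : t < D u) (hu : D u ≤ w) (hv : D v + t < w) :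
    linkWeight w (shift D u v (t + 1))
      * (((D v : ℝ) + (t + 1)) * (w - ((D u : ℝ) - (t + 1))))
      = linkWeight w (shift D u v t) * (((D u : ℝ) - t) * (w - ((D v : ℝ) + t))) := by
  unfold linkWeight
  rw [prod_shift D (fun i => (w.choose i : ℝ)) huv, prod_shift D (fun i => (w.choose i : ℝ)) huv]
  obtain ⟨a, ha⟩ : ∃ a, D u = a + t + 1 := ⟨D u - t - 1, by omega⟩
  have h1 := choose_succ_mul_cast (w := w) (a := a) (by omega)
  have h2 := choose_succ_mul_cast (w := w) (a := D v + t) (by omega)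
  have e1 : D u - (t + 1) = a := by omega
  have e2 : D u - t = a + 1 := by omega
  have e3 : (D u : ℝ) = a + t + 1 := by rw [ha]; push_cast; ring
  rw [e1, e2, e3, ← add_assoc]
  push_cast at h2
  generalize ∏ x ∈ (Finset.univ.erase u).erase v, (w.choose (D x) : ℝ) = R at *
  calc _ = (w.choose a * ((w : ℝ) - a)) * (w.choose (D v + t + 1) * ((D v : ℝ) + t + 1)) * R := by
        ring
    _ = (w.choose (a + 1) * ((a : ℝ) + 1)) * (w.choose (D v + t) * ((w : ℝ) - (D v + t))) * R := by
        rw [h1, h2]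
    _ = _ := by ring

/-- Potential controlling how the count changes when two degrees move apart. -/
noncomputable def degPot (d x : ℕ) : ℝ :=
  ∑ i ∈ Finset.Ioc x d, ((i : ℝ)⁻¹ - (d : ℝ)⁻¹) + ((x : ℝ) - d) ^ 2 / d ^ 2

theorem degPot_self (d : ℕ) : degPot d d = 0 := by simp [degPot]

theorem le_degPot_sub_of_le {d b : ℕ} (hb : b + 1 ≤ d) :
    ((b + 1 : ℕ) : ℝ)⁻¹ - (d : ℝ)⁻¹ ≤ degPot d b - degPot d (b + 1) := by
  unfold degPot
  have h1 : Finset.Ioc b d = insert (b + 1) (Finset.Ioc (b + 1) d) := by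
    ext i
    simp only [Finset.mem_insert, Finset.mem_Ioc]
    omega
  rw [h1, Finset.sum_insert (by simp)]
  have h2 : (((b + 1 : ℕ) : ℝ) - d) ^ 2 / d ^ 2 ≤ ((b : ℝ) - d) ^ 2 / d ^ 2 := by
    have : ((b + 1 : ℕ) : ℝ) ≤ d := by exact_mod_cast hb
    push_cast at this ⊢
    gcongr ?_ / _
    nlinarith
  linarith

theorem le_degPot_sub_of_ge {d a : ℕ} (hd : 0 < d) (ha : d ≤ a) :
    (d : ℝ)⁻¹ - (a : ℝ)⁻¹ ≤ degPot d (a + 1) - degPot d a := by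
  unfold degPot
  have hd' : (0 : ℝ) < d := by exact_mod_cast hd
  have ha' : (d : ℝ) ≤ a := by exact_mod_cast ha
  rw [Finset.Ioc_eq_empty (by omega), Finset.Ioc_eq_empty (by omega)]
  simp only [Finset.sum_empty, zero_add]
  have h1 : (d : ℝ)⁻¹ - (a : ℝ)⁻¹ = (a - d) / (a * d) := by
    have : (a : ℝ) ≠ 0 := by linarith
    field_simp
  rw [h1, ← sub_div]
  have h2 : ((a : ℝ) - d) / (a * d) ≤ (a - d) / (d ^ 2) := by
    gcongr
    nlinarith
  refine h2.trans ?_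
  gcongr ?_ / _
  push_cast
  nlinarith

theorem sum_Ioc_inv_le (x d : ℕ) :
    ∑ i ∈ Finset.Ioc x d, (i : ℝ)⁻¹ ≤ 1 + Real.log d := by
  have h1 := harmonic_le_one_add_log d
  rw [harmonic_eq_sum_Icc] at h1
  push_cast at h1
  refine le_trans (Finset.sum_le_sum_of_subset_of_nonneg ?_ ?_) h1
  · intro i
    simp only [Finset.mem_Ioc, Finset.mem_Icc]
    omega
  · intros
    positivity

theorem degPot_le {d : ℕ} (hd : 0 < d) (x : ℕ) :
    degPot d x ≤ 3 * (1 + Real.log d) * ((x : ℝ) - d) ^ 2 / d ^ 2 := by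
  have hd' : (0 : ℝ) < d := by exact_mod_cast hd
  have hL : 1 ≤ 1 + Real.log d := by
    have := Real.log_natCast_nonneg d
    linarith
  set L := 1 + Real.log d with hLdef
  unfold degPot
  rcases le_total d x with h | h
  · rw [Finset.Ioc_eq_empty (by omega), Finset.sum_empty, zero_add, mul_div_assoc]
    have : 0 ≤ ((x : ℝ) - d) ^ 2 / d ^ 2 := by positivity
    nlinarith
  · have hx : (x : ℝ) ≤ d := by exact_mod_cast h
    have h1 : ∑ i ∈ Finset.Ioc x d, ((i : ℝ)⁻¹ - (d : ℝ)⁻¹)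
        ≤ ∑ i ∈ Finset.Ioc x d, (d - x) / d * (i : ℝ)⁻¹ := by
      refine Finset.sum_le_sum fun i hi => ?_
      rw [Finset.mem_Ioc] at hi
      have hi0 : (0 : ℝ) < i := by exact_mod_cast (by omega : 0 < i)
      have hi1 : (x : ℝ) ≤ i := by exact_mod_cast hi.1.le
      have e1 : (i : ℝ)⁻¹ - (d : ℝ)⁻¹ = (d - i) / d * (i : ℝ)⁻¹ := by
        field_simp
      rw [e1]
      gcongr
    rw [← Finset.mul_sum] at h1
    have h2 : ∑ i ∈ Finset.Ioc x d, (i : ℝ)⁻¹ ≤ 2 * L * ((d - x) / d) := by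
      rcases le_total (d : ℝ) (2 * x) with h3 | h3
      · have h4 : ∀ i ∈ Finset.Ioc x d, (i : ℝ)⁻¹ ≤ 2 / d := by
          intro i hi
          rw [Finset.mem_Ioc] at hi
          have hi1 : (x : ℝ) ≤ i := by exact_mod_cast hi.1.le
          rw [inv_le_comm₀ (by linarith) (by positivity), inv_div]
          linarith
        have h5 := Finset.sum_le_card_nsmul _ _ _ h4
        rw [Nat.card_Ioc, nsmul_eq_mul, Nat.cast_sub h] at h5
        refine h5.trans ?_
        have : 0 ≤ ((d : ℝ) - x) / d := div_nonneg (by linarith) hd'.le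
        calc ((d : ℝ) - x) * (2 / d) = 2 * 1 * (((d : ℝ) - x) / d) := by ring
          _ ≤ _ := by gcongr
      · refine (sum_Ioc_inv_le x d).trans ?_
        rw [← hLdef, ← mul_div_assoc, le_div_iff₀ hd']
        nlinarith
    have h6 : ((d : ℝ) - x) / d * ∑ i ∈ Finset.Ioc x d, (i : ℝ)⁻¹
        ≤ (d - x) / d * (2 * L * ((d - x) / d)) :=
      mul_le_mul_of_nonneg_left h2 (div_nonneg (by linarith) hd'.le)
    have h7 : ((d : ℝ) - x) / d * (2 * L * ((d - x) / d))
        = 2 * L * (((x : ℝ) - d) ^ 2 / d ^ 2) := by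
      field_simp
      ring
    rw [mul_div_assoc]
    have : 0 ≤ ((x : ℝ) - d) ^ 2 / d ^ 2 := by positivity
    nlinarith

/-- Total potential of a degree sequence. -/
noncomputable def totalPot {m : ℕ} (w : ℕ) (δ Δ : ℝ) (d : ℕ) (D : Fin m → ℕ) : ℝ :=
  ∑ v, (4 * δ / w * ((D v : ℝ) - d) ^ 2 + 8 * Δ * degPot d (D v))

theorem totalPot_const {m : ℕ} (w : ℕ) (δ Δ : ℝ) (d : ℕ) :
    totalPot w δ Δ d (fun _ : Fin m => d) = 0 := by
  simp [totalPot, degPot_self]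

theorem totalPot_le {m : ℕ} (w : ℕ) {δ Δ : ℝ} (hΔ : 0 ≤ Δ) {d : ℕ} (hd : 0 < d)
    (D : Fin m → ℕ) :
    totalPot w δ Δ d D
      ≤ (4 * δ / w + 24 * Δ * (1 + Real.log d) / d ^ 2) * sqDev d D := by
  unfold totalPot sqDev
  rw [Finset.mul_sum]
  refine Finset.sum_le_sum fun v _ => ?_
  have h1 := mul_le_mul_of_nonneg_left (degPot_le hd (D v)) (show 0 ≤ 8 * Δ by linarith)
  calc _ ≤ 4 * δ / w * ((D v : ℝ) - d) ^ 2
        + 8 * Δ * (3 * (1 + Real.log d) * ((D v : ℝ) - d) ^ 2 / d ^ 2) := by linarith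
    _ = _ := by ring

theorem le_totalPot_sub {m : ℕ} (w : ℕ) {δ Δ : ℝ} (hδ : 0 ≤ δ) (hΔ : 0 ≤ Δ) {d : ℕ} (hd : 0 < d)
    (D : Fin m → ℕ) {u v : Fin m} (huv : u ≠ v) {t : ℕ} (hu : d + (t + 1) ≤ D u)
    (hv : D v + (t + 1) ≤ d) :
    8 * δ * (((D u : ℝ) - (t + 1)) - (D v + (t + 1))) / w
      + 8 * Δ * (((D v : ℝ) + (t + 1))⁻¹ - ((D u : ℝ) - (t + 1))⁻¹)
      ≤ totalPot w δ Δ d (shift D u v t) - totalPot w δ Δ d (shift D u v (t + 1)) := by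
  unfold totalPot
  rw [sum_shift D (fun x => 4 * δ / w * ((x : ℝ) - d) ^ 2 + 8 * Δ * degPot d x) huv,
    sum_shift D (fun x => 4 * δ / w * ((x : ℝ) - d) ^ 2 + 8 * Δ * degPot d x) huv]
  obtain ⟨a, ha⟩ : ∃ a, D u = a + (t + 1) := ⟨D u - (t + 1), by omega⟩
  have h1 := le_degPot_sub_of_le (d := d) (b := D v + t) (by omega)
  have h2 := le_degPot_sub_of_ge (d := d) (a := a) hd (by omega)
  have e1 : D u - (t + 1) = a := by omega
  have e2 : D u - t = a + 1 := by omega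
  have e3 : (D u : ℝ) - (t + 1) = a := by rw [ha]; push_cast; ring
  rw [e1, e2, e3, ← add_assoc (D v)]
  have h3 := mul_le_mul_of_nonneg_left (add_le_add h1 h2) (show 0 ≤ 8 * Δ by linarith)
  have h4 : 0 ≤ 8 * δ / w := by positivity
  push_cast at h3 ⊢
  rw [← add_assoc (D v : ℝ)]
  have h5 : 8 * δ * ((a : ℝ) - (D v + t + 1)) / w
      ≤ 4 * δ / w * ((a : ℝ) + 1 - d) ^ 2 + 4 * δ / w * ((D v : ℝ) + t - d) ^ 2
        - 4 * δ / w * ((a : ℝ) - d) ^ 2 - 4 * δ / w * ((D v : ℝ) + t + 1 - d) ^ 2 := by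
    have e4 : 4 * δ / w * ((a : ℝ) + 1 - d) ^ 2 + 4 * δ / w * ((D v : ℝ) + t - d) ^ 2
        - 4 * δ / w * ((a : ℝ) - d) ^ 2 - 4 * δ / w * ((D v : ℝ) + t + 1 - d) ^ 2
        = 8 * δ / w * (a - (D v + t)) := by ring
    rw [e4]
    calc _ = 8 * δ / w * (a - (D v + t + 1)) := by ring
      _ ≤ _ := mul_le_mul_of_nonneg_left (by linarith) h4
  linarith

end Compare

section CompareFamilies

variable {ι : Type*} [Fintype ι] [DecidableEq ι] {m : ℕ}

theorem card_degFam_shift_le (A : Finset ι) (d : ℕ) {c : ι} (hc : c ∉ A) (D : Fin m → ℕ)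
    {u v : Fin m} (huv : u ≠ v) {t : ℕ} (hu : d + (t + 1) ≤ D u) (hv : D v + (t + 1) ≤ d) :
    (degFam A d c (shift D u v t)).card ≤ (degFam A d c (shift D u v (t + 1))).card := by
  refine card_degFam_le_of_step A d hc huv ?_ ?_ ?_ ?_
  · rw [shift_left D huv, shift_left D huv]
    omega
  · rw [shift_right, shift_right]
    omega
  · intro x hx hx'
    rw [shift_of_ne D hx hx', shift_of_ne D hx hx']
  · rw [shift_left D huv, shift_right]
    omega

theorem card_degFam_le_shift (A : Finset ι) (d : ℕ) {c : ι} (hc : c ∉ A) (D : Fin m → ℕ)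
    {u v : Fin m} (huv : u ≠ v) {t : ℕ} (hu : d + t ≤ D u) (hv : D v + t ≤ d) :
    (degFam A d c D).card ≤ (degFam A d c (shift D u v t)).card := by
  induction t with
  | zero => rw [shift_zero]
  | succ t ih =>
    exact (ih (by omega) (by omega)).trans (card_degFam_shift_le A d hc D huv hu hv)

theorem card_mul_sub_totalCodeg_shift (A : Finset ι) (d : ℕ) {c : ι} (hc : c ∉ A)
    (D : Fin m → ℕ) {u v : Fin m} (huv : u ≠ v) {t : ℕ} (hu : t < D u) :
    ((degFam A d c (shift D u v t)).card : ℝ) * ((D u : ℝ) - t)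
        - totalCodeg A d c (shift D u v t) u v
      = (degFam A d c (shift D u v (t + 1))).card * ((D v : ℝ) + (t + 1))
        - totalCodeg A d c (shift D u v (t + 1)) u v := by
  have h := card_mul_sub_totalCodeg A d hc huv (D := shift D u v t) (D' := shift D u v (t + 1))
    (by rw [shift_left D huv, shift_left D huv]; omega)
    (by rw [shift_right, shift_right]; omega)
    (fun x hx hx' => by rw [shift_of_ne D hx hx', shift_of_ne D hx hx'])
  rw [shift_left D huv, shift_right, Nat.cast_sub hu.le] at h
  push_cast at h
  exact h

theorem totalCodeg_nonneg (A : Finset ι) (d : ℕ) (c : ι) (D : Fin m → ℕ) (u v : Fin m) :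
    0 ≤ totalCodeg A d c D u v :=
  Finset.sum_nonneg fun _ _ => Nat.cast_nonneg _

theorem card_degFam_pos_of_shift (A : Finset ι) (d : ℕ) {c : ι} (hc : c ∉ A)
    (D : Fin m → ℕ) {u v : Fin m} (huv : u ≠ v) (hu : d < D u)
    (huw : D u ≤ m ^ (Fintype.card ι - 1))
    (h : 0 < (degFam A d c (shift D u v 1)).card) : 0 < (degFam A d c D).card := by
  have h1 := card_mul_sub_totalCodeg_shift A d hc D huv (t := 0) (by omega)
  rw [shift_zero] at h1
  have h2 := totalCodeg_nonneg A d c D u v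
  have h3 := pow_mul_totalCodeg_le A d (c := c) (shift D u v 1) huv
  rw [shift_left D huv, shift_right, Nat.cast_sub (by omega)] at h3
  have huw' : (D u : ℝ) ≤ (m : ℝ) ^ (Fintype.card ι - 1) := by exact_mod_cast huw
  have hN : (0 : ℝ) < (degFam A d c (shift D u v 1)).card := by exact_mod_cast h
  have hu' : (1 : ℝ) ≤ D u := by exact_mod_cast (by omega : 1 ≤ D u)
  simp only [zero_add, Nat.cast_zero, sub_zero, Nat.cast_add, Nat.cast_one] at h1 h3
  by_contra hcon
  have h0 : ((degFam A d c D).card : ℝ) = 0 := by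
    exact_mod_cast Nat.eq_zero_of_not_pos hcon
  rw [h0, zero_mul] at h1
  set W := (m : ℝ) ^ (Fintype.card ι - 1)
  set N := ((degFam A d c (shift D u v 1)).card : ℝ)
  set T := totalCodeg A d c (shift D u v 1) u v
  have h4 : N * ((D v : ℝ) + 1) ≤ T := by linarith
  have hv0 : (0 : ℝ) ≤ D v := Nat.cast_nonneg _
  have h5 : W * (N * ((D v : ℝ) + 1)) ≤ ((D u : ℝ) - 1) * ((D v : ℝ) + 1) * N :=
    (mul_le_mul_of_nonneg_left h4 (by linarith)).trans h3
  have h6 : 0 < N * ((D v : ℝ) + 1) := by positivity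
  nlinarith

theorem exists_lt_of_ne {D : Fin m → ℕ} {d : ℕ} (hD : ∑ v, D v = m * d)
    (hne : D ≠ fun _ => d) : ∃ u v, u ≠ v ∧ d < D u ∧ D v < d := by
  have hs : ∑ v : Fin m, D v = ∑ _v : Fin m, d := by simp [hD]
  have h1 : ∃ u, d < D u := by
    by_contra! h
    have := (Finset.sum_eq_sum_iff_of_le (fun v (_ : v ∈ Finset.univ) => h v)).1 hs
    exact hne (funext fun v => this v (Finset.mem_univ v))
  have h2 : ∃ v, D v < d := by
    by_contra! h
    have := (Finset.sum_eq_sum_iff_of_le (fun v (_ : v ∈ Finset.univ) => h v)).1 hs.symm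
    exact hne (funext fun v => (this v (Finset.mem_univ v)).symm)
  obtain ⟨u, hu⟩ := h1
  obtain ⟨v, hv⟩ := h2
  refine ⟨u, v, ?_, hu, hv⟩
  rintro rfl
  omega

theorem card_degFam_pos (A : Finset ι) {d : ℕ} {c : ι} (hc : c ∉ A)
    (h : 0 < (degFam (m := m) A d c fun _ => d).card) (D : Fin m → ℕ) (hD : ∑ v, D v = m * d)
    (hw : ∀ v, D v ≤ m ^ (Fintype.card ι - 1)) : 0 < (degFam A d c D).card := by
  induction hn : ∑ v, (D v - d) using Nat.strong_induction_on generalizing D with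
  | _ n ih =>
    by_cases hne : D = fun _ => d
    · rw [hne]
      exact h
    obtain ⟨u, v, huv, hu, hv⟩ := exists_lt_of_ne hD hne
    refine card_degFam_pos_of_shift A d hc D huv hu (hw u) ?_
    refine ih (∑ x, (shift D u v 1 x - d)) ?_ _ ?_ ?_ rfl
    · rw [← hn, sum_shift D (fun x => x - d) huv, sum_eq_add_add (fun x => D x - d) huv]
      omega
    · rw [sum_shift_eq D huv (by omega), hD]
    · intro x
      by_cases hx : x = u
      · rw [hx, shift_left D huv]
        exact (Nat.sub_le _ _).trans (hw u)
      by_cases hx' : x = v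
      · rw [hx', shift_right]
        have := hw u
        omega
      · rw [shift_of_ne D hx hx']
        exact hw x

/-- The number of edge sets with prescribed degrees, relative to the unconstrained number. -/
noncomputable def relCount (A : Finset ι) (d : ℕ) (c : ι) (D : Fin m → ℕ) : ℝ :=
  (degFam A d c D).card / linkWeight (m ^ (Fintype.card ι - 1)) D

theorem relCount_shift_compare {A : Finset ι} {d : ℕ} {c : ι} (hc : c ∉ A) (hd0 : 0 < d)
    (hd : 2 * d ≤ m ^ (Fintype.card ι - 1)) {δ Δ n₀ : ℝ} (hδ : 0 ≤ δ) (hΔ : 0 ≤ Δ) (hn₀ : 0 < n₀)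
    (hT : ∀ D : Fin m → ℕ, n₀ ≤ (degFam A d c D).card → ∀ u v, u ≠ v →
      ((1 - δ) * (D u * D v) / (m : ℝ) ^ (Fintype.card ι - 1) - Δ) * (degFam A d c D).card
        ≤ totalCodeg A d c D u v)
    (D : Fin m → ℕ) (hw : ∀ v, 4 * D v ≤ 3 * m ^ (Fintype.card ι - 1))
    (hN : n₀ ≤ (degFam A d c D).card) {u v : Fin m} (huv : u ≠ v) {n : ℕ}
    (hu : d + n ≤ D u) (hv : D v + n ≤ d) :
    relCount A d c (shift D u v n)
        * Real.exp (-(2 * δ * d / (m : ℝ) ^ (Fintype.card ι - 1) + 2 * Δ / d))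
      ≤ relCount A d c D ∧
    relCount A d c D ≤ relCount A d c (shift D u v n)
      * Real.exp (2 * δ * d / (m : ℝ) ^ (Fintype.card ι - 1) + 2 * Δ / d
        + (totalPot (m ^ (Fintype.card ι - 1)) δ Δ d D
          - totalPot (m ^ (Fintype.card ι - 1)) δ Δ d (shift D u v n))) := by
  set w := m ^ (Fintype.card ι - 1) with hwdef
  have hwc : (m : ℝ) ^ (Fintype.card ι - 1) = (w : ℕ) := by rw [hwdef]; push_cast; rfl
  simp only [hwc] at hT ⊢
  have huw := hw u
  have hNs : ∀ t ≤ n, n₀ ≤ (degFam A d c (shift D u v t)).card := by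
    intro t ht
    refine hN.trans ?_
    exact_mod_cast card_degFam_le_shift A d hc D huv (by omega) (by omega)
  have hcast : ∀ i ≤ n, ((n - i : ℕ) : ℝ) = n - i := fun i hi => Nat.cast_sub hi
  have hL : ∀ t ≤ n, ((shift D u v t u : ℕ) : ℝ) = D u - t := by
    intro t ht
    rw [shift_left D huv, Nat.cast_sub (by omega)]
  have hR : ∀ t, ((shift D u v t v : ℕ) : ℝ) = D v + t := by
    intro t
    rw [shift_right]
    push_cast
    rfl
  have key := run_compare (d := d) (w := w) (δ := δ) (Δ := Δ) (a := D u - n) (b := D v + n)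
    (by exact_mod_cast hd0) (by exact_mod_cast hd) hδ hΔ (by exact_mod_cast hv)
    (by rw [le_sub_iff_add_le]; exact_mod_cast hu) n
    (by rw [add_sub_cancel_right]; exact Nat.cast_nonneg _)
    (by rw [sub_add_cancel]; exact_mod_cast huw)
    (fun i => (degFam A d c (shift D u v (n - i))).card)
    (fun i => linkWeight w (shift D u v (n - i)))
    (fun i => totalCodeg A d c (shift D u v (n - i)) u v)
    (fun i => totalPot w δ Δ d (shift D u v (n - i)))
    (fun i hi => hn₀.trans_le (hNs _ (Nat.sub_le _ _)))
    (fun i hi => linkWeight_pos fun x => by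
      by_cases hx : x = u
      · rw [hx, shift_left D huv]
        omega
      by_cases hx' : x = v
      · rw [hx', shift_right]
        omega
      · rw [shift_of_ne D hx hx']
        have := hw x
        omega)
    ?_ ?_ ?_ ?_ ?_
  · simp only [Nat.sub_zero, Nat.sub_self, shift_zero] at key
    exact key
  · intro i hi
    have h := pow_mul_totalCodeg_le A d (c := c) (shift D u v (n - i)) huv
    rw [hwc, hL _ (Nat.sub_le _ _), hR, hcast i hi] at h
    convert h using 2
    ring
  · intro i hi
    have h := hT _ (hNs (n - i) (Nat.sub_le _ _)) u v huv
    rw [hL _ (Nat.sub_le _ _), hR, hcast i hi] at h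
    convert h using 6 <;> ring
  · intro i hi
    obtain ⟨t, rfl⟩ : ∃ t, n = i + (t + 1) := ⟨n - i - 1, by omega⟩
    have e1 : i + (t + 1) - i = t + 1 := by omega
    have e2 : i + (t + 1) - (i + 1) = t := by omega
    have h := card_mul_sub_totalCodeg_shift A d hc D huv (t := t) (by omega)
    simp only [e1, e2]
    push_cast
    convert h.symm using 3 <;> ring
  · intro i hi
    obtain ⟨t, rfl⟩ : ∃ t, n = i + (t + 1) := ⟨n - i - 1, by omega⟩
    have e1 : i + (t + 1) - i = t + 1 := by omega
    have e2 : i + (t + 1) - (i + 1) = t := by omega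
    have h := linkWeight_shift (w := w) D huv (t := t) (by omega) (by omega) (by omega)
    simp only [e1, e2]
    push_cast
    convert h using 4 <;> ring
  · intro i hi
    obtain ⟨t, rfl⟩ : ∃ t, n = i + (t + 1) := ⟨n - i - 1, by omega⟩
    have e1 : i + (t + 1) - i = t + 1 := by omega
    have e2 : i + (t + 1) - (i + 1) = t := by omega
    have h := le_totalPot_sub w hδ hΔ hd0 D huv (t := t) (by omega) (by omega)
    simp only [e1, e2]
    push_cast
    refine le_trans (le_of_eq ?_) h
    have e3 : (D u : ℝ) - (i + (t + 1)) + i = D u - (t + 1) := by ring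
    have e4 : (D v : ℝ) + (i + (t + 1)) - i = D v + (t + 1) := by ring
    rw [e3, e4]

theorem relCount_compare {A : Finset ι} {d : ℕ} {c : ι} (hc : c ∉ A) (hd0 : 0 < d)
    (hd : 2 * d ≤ m ^ (Fintype.card ι - 1)) {δ Δ n₀ : ℝ} (hδ : 0 ≤ δ) (hΔ : 0 ≤ Δ) (hn₀ : 0 < n₀)
    (hT : ∀ D : Fin m → ℕ, n₀ ≤ (degFam A d c D).card → ∀ u v, u ≠ v →
      ((1 - δ) * (D u * D v) / (m : ℝ) ^ (Fintype.card ι - 1) - Δ) * (degFam A d c D).card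
        ≤ totalCodeg A d c D u v)
    (D : Fin m → ℕ) (hD : ∑ v, D v = m * d) (hw : ∀ v, 4 * D v ≤ 3 * m ^ (Fintype.card ι - 1))
    (hN : n₀ ≤ (degFam A d c D).card) :
    relCount (m := m) A d c (fun _ => d)
        * Real.exp (-(m * (2 * δ * d / (m : ℝ) ^ (Fintype.card ι - 1) + 2 * Δ / d)))
      ≤ relCount A d c D ∧
    relCount A d c D ≤ relCount (m := m) A d c (fun _ => d)
      * Real.exp (m * (2 * δ * d / (m : ℝ) ^ (Fintype.card ι - 1) + 2 * Δ / d)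
        + totalPot (m ^ (Fintype.card ι - 1)) δ Δ d D) := by
  set e := 2 * δ * d / (m : ℝ) ^ (Fintype.card ι - 1) + 2 * Δ / d with he
  have he0 : 0 ≤ e := by positivity
  have hpos : ∀ D : Fin m → ℕ, 0 ≤ relCount A d c D := fun D =>
    div_nonneg (Nat.cast_nonneg _) (Finset.prod_nonneg fun _ _ => Nat.cast_nonneg _)
  suffices h : ∀ k : ℕ, ∀ D : Fin m → ℕ, ∑ v, D v = m * d →
      (∀ v, 4 * D v ≤ 3 * m ^ (Fintype.card ι - 1)) → n₀ ≤ (degFam A d c D).card →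
      (Finset.univ.filter fun v => D v ≠ d).card ≤ k →
      relCount (m := m) A d c (fun _ => d) * Real.exp (-(k * e)) ≤ relCount A d c D ∧
      relCount A d c D ≤ relCount (m := m) A d c (fun _ => d)
        * Real.exp (k * e + totalPot (m ^ (Fintype.card ι - 1)) δ Δ d D) by
    refine h m D hD hw hN ((Finset.card_le_univ _).trans ?_)
    simp
  intro k
  induction k with
  | zero =>
    intro D hD hw hN hk
    have : D = fun _ => d := by
      funext v
      by_contra hv
      have : v ∈ (Finset.univ.filter fun v => D v ≠ d) := by simpa using hv
      rw [Finset.card_eq_zero.1 (Nat.le_zero.1 hk)] at this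
      simp at this
    subst this
    simp [totalPot_const]
  | succ k ih =>
    intro D hD hw hN hk
    by_cases hne : D = fun _ => d
    · subst hne
      rw [totalPot_const, add_zero]
      constructor
      · refine mul_le_of_le_one_right (hpos _) (Real.exp_le_one_iff.2 ?_)
        rw [neg_nonpos]
        positivity
      · refine le_mul_of_one_le_right (hpos _) (Real.one_le_exp ?_)
        positivity
    obtain ⟨u, v, huv, hu, hv⟩ := exists_lt_of_ne hD hne
    obtain ⟨n, hn⟩ : ∃ n, n = min (D u - d) (d - D v) := ⟨_, rfl⟩
    have h1 := relCount_shift_compare hc hd0 hd hδ hΔ hn₀ hT D hw hN huv (n := n) (by omega)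
      (by omega)
    have h2 := ih (shift D u v n) (by rw [sum_shift_eq D huv (by omega), hD]) (by
      intro x
      by_cases hx : x = u
      · rw [hx, shift_left D huv]
        have := hw u
        omega
      by_cases hx' : x = v
      · rw [hx', shift_right]
        have := hw u
        omega
      · rw [shift_of_ne D hx hx']
        exact hw x)
      (hN.trans (by exact_mod_cast card_degFam_le_shift A d hc D huv (by omega) (by omega)))
      (by
        rw [← Nat.lt_succ_iff]
        refine lt_of_lt_of_le (Finset.card_lt_card ?_) hk
        rw [Finset.ssubset_iff_of_subset]
        · rcases le_total (D u - d) (d - D v) with h | h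
          · refine ⟨u, by simpa using hu.ne', ?_⟩
            simp only [Finset.mem_filter, Finset.mem_univ, true_and, not_not, shift_left D huv]
            omega
          · refine ⟨v, by simpa using hv.ne, ?_⟩
            simp only [Finset.mem_filter, Finset.mem_univ, true_and, not_not, shift_right]
            omega
        · intro x
          simp only [Finset.mem_filter, Finset.mem_univ, true_and]
          intro hx
          by_cases hxu : x = u
          · rw [hxu]
            omega
          by_cases hxv : x = v
          · rw [hxv]
            omega
          rwa [shift_of_ne D hxu hxv] at hx)
    rw [← he] at h1
    constructor
    · refine le_trans (le_of_eq ?_) ((mul_le_mul_of_nonneg_right h2.1 (Real.exp_pos _).le).trans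
        h1.1)
      rw [mul_assoc, ← Real.exp_add]
      congr 2
      push_cast
      ring
    · refine h1.2.trans ((mul_le_mul_of_nonneg_right h2.2 (Real.exp_pos _).le).trans
        (le_of_eq ?_))
      rw [mul_assoc, ← Real.exp_add]
      congr 2
      push_cast
      ring

end CompareFamilies

section ClassStep

theorem sum_le_of_markov {α : Type*} (s : Finset α) (N S : α → ℝ) {B K : ℝ} (hB : 0 < B)
    (hK : 0 < K) (hN : ∀ D ∈ s, 0 ≤ N D) (hS : ∀ D ∈ s, 0 ≤ S D)
    (h : ∑ D ∈ s, N D * S D ≤ B * ∑ D ∈ s, N D) :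
    (1 - 1 / K) * ∑ D ∈ s, N D ≤ ∑ D ∈ s with S D ≤ K * B, N D := by
  have h1 := Finset.sum_filter_add_sum_filter_not s (fun D => S D ≤ K * B) N
  have h2 : ∑ D ∈ s with ¬ S D ≤ K * B, N D ≤ 1 / K * ∑ D ∈ s, N D := by
    have h3 : K * B * ∑ D ∈ s with ¬ S D ≤ K * B, N D ≤ ∑ D ∈ s, N D * S D := by
      rw [Finset.mul_sum]
      refine le_trans (Finset.sum_le_sum (g := fun D => N D * S D) fun D hD => ?_)
        (Finset.sum_le_sum_of_subset_of_nonneg (Finset.filter_subset _ s) fun D hD _ =>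
          mul_nonneg (hN D hD) (hS D hD))
      rw [Finset.mem_filter, not_le] at hD
      rw [mul_comm]
      exact mul_le_mul_of_nonneg_left hD.2.le (hN D hD.1)
    rw [one_div, inv_mul_eq_div, le_div_iff₀ hK]
    refine le_of_mul_le_mul_left (le_trans (le_of_eq ?_) (h3.trans h)) hB
    ring
  linarith

theorem sum_filter_ge {α : Type*} (s t : Finset α) (hts : t ⊆ s) (N : α → ℝ) {P x : ℝ}
    (hx : 0 ≤ x) (hP : (s.card : ℝ) ≤ P) :
    ∑ D ∈ t, N D - P * x ≤ ∑ D ∈ t with x ≤ N D, N D := by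
  have h1 := Finset.sum_filter_add_sum_filter_not t (fun D => x ≤ N D) N
  have h2 : ∑ D ∈ t with ¬ x ≤ N D, N D ≤ P * x := by
    have h3 := Finset.sum_le_card_nsmul (t.filter fun D => ¬ x ≤ N D) N x (by
      intro D hD
      rw [Finset.mem_filter, not_le] at hD
      exact hD.2.le)
    rw [nsmul_eq_mul] at h3
    have h4 : ((t.filter fun D => ¬ x ≤ N D).card : ℝ) ≤ P := by
      refine le_trans ?_ hP
      exact_mod_cast Finset.card_le_card ((Finset.filter_subset _ t).trans hts)
    exact h3.trans (mul_le_mul_of_nonneg_right h4 hx)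
  linarith

variable {ι : Type*} [Fintype ι] [DecidableEq ι] {m : ℕ}

theorem degFam_const (A : Finset ι) (d : ℕ) (c : ι) :
    degFam A d c (fun _ : Fin m => d) = regFam ι m (insert c A) d (m * d) := by
  ext E
  simp only [degFam, regFam, Finset.mem_filter, Finset.mem_univ, true_and,
    Finset.forall_mem_insert]
  constructor
  · rintro ⟨h1, h2⟩
    refine ⟨?_, h2, h1⟩
    rw [← sum_vdeg E c]
    simp [h2]
  · rintro ⟨-, h2, h1⟩
    exact ⟨h1, h2⟩

theorem card_degFam_le_const (A : Finset ι) {d : ℕ} {c : ι} (hc : c ∉ A) (D : Fin m → ℕ)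
    (hD : ∑ v, D v = m * d) :
    (degFam A d c D).card ≤ (degFam (m := m) A d c fun _ => d).card := by
  induction hn : ∑ v, (D v - d) using Nat.strong_induction_on generalizing D with
  | _ n ih =>
    by_cases hne : D = fun _ => d
    · rw [hne]
    obtain ⟨u, v, huv, hu, hv⟩ := exists_lt_of_ne hD hne
    refine (card_degFam_le_shift A d hc D huv (t := 1) (by omega) (by omega)).trans ?_
    refine ih (∑ x, (shift D u v 1 x - d)) ?_ _ ?_ rfl
    · rw [← hn, sum_shift D (fun x => x - d) huv, sum_eq_add_add (fun x => D x - d) huv]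
      omega
    · rw [sum_shift_eq D huv (by omega), hD]

theorem card_regFam_le_mul (A : Finset ι) (d : ℕ) {c : ι} (hc : c ∉ A) :
    ((regFam ι m A d (m * d)).card : ℝ)
      ≤ (m * d + 1 : ℕ) ^ m * (regFam ι m (insert c A) d (m * d)).card := by
  rw [card_regFam_eq A d c, ← degFam_const]
  have h1 := Finset.sum_le_card_nsmul (Finset.piAntidiag (Finset.univ : Finset (Fin m)) (m * d))
    (fun D => ((degFam (m := m) A d c D).card : ℝ)) (degFam (m := m) A d c fun _ => d).card (by
      intro D hD
      exact_mod_cast card_degFam_le_const A hc D (Finset.mem_piAntidiag.1 hD).1)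
  refine h1.trans ?_
  rw [nsmul_eq_mul]
  gcongr
  exact_mod_cast card_piAntidiag_le m (m * d)

theorem card_degFam_empty_cast (d : ℕ) (c : ι) (D : Fin m → ℕ) :
    ((degFam (∅ : Finset ι) d c D).card : ℝ) = linkWeight (m ^ (Fintype.card ι - 1)) D := by
  rw [card_degFam_empty]
  unfold linkWeight
  push_cast
  rfl

theorem le_of_sqDev_le {w d : ℕ} {K : ℝ} (hK : 0 ≤ K) (hd : 2 * d ≤ w)
    (hKw : 8 * K * m ≤ w) {D : Fin m → ℕ} (hS : sqDev d D ≤ K * (m * d)) (v : Fin m) :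
    4 * D v ≤ 3 * w := by
  have h1 : ((D v : ℝ) - d) ^ 2 ≤ K * (m * d) :=
    (Finset.single_le_sum (f := fun v => ((D v : ℝ) - d) ^ 2) (fun _ _ => sq_nonneg _)
      (Finset.mem_univ v)).trans hS
  have hd' : 2 * (d : ℝ) ≤ w := by exact_mod_cast hd
  have hd0 : (0 : ℝ) ≤ d := Nat.cast_nonneg d
  have h2 : ((D v : ℝ) - d) ^ 2 ≤ (w / 4) ^ 2 := by
    have h3 : 8 * K * m * (2 * d) ≤ w * w := by
      have : 0 ≤ 8 * K * m := by positivity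
      exact mul_le_mul hKw hd' (by positivity) (by positivity)
    nlinarith
  have h3 : (D v : ℝ) - d ≤ w / 4 := abs_le_of_sq_le_sq' h2 (by positivity) |>.2
  have h4 : 4 * (D v : ℝ) ≤ 3 * w := by linarith
  exact_mod_cast h4

/-- The logarithmic error made when one more class is required to be regular. -/
noncomputable def stepCost (m w d : ℕ) (K δ Δ : ℝ) : ℝ :=
  m * (2 * δ * d / w + 2 * Δ / d)
    + (4 * δ / w + 24 * Δ * (1 + Real.log d) / d ^ 2) * (K * (m * d))

set_option maxHeartbeats 1000000 in
theorem regFam_step (hm : 0 < m) {A : Finset ι} {c : ι} (hc : c ∉ A) {d : ℕ} (hd0 : 0 < d)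
    (hd : 2 * d ≤ m ^ (Fintype.card ι - 1)) {K δ Δ : ℝ} (hK : 2 < K)
    (hKw : 8 * K * m ≤ (m ^ (Fintype.card ι - 1) : ℕ)) (hδ : 0 ≤ δ) (hΔ : 0 ≤ Δ)
    (hN : 0 < (regFam ι m (insert c A) d (m * d)).card)
    (hT : ∀ D : Fin m → ℕ,
      Real.exp (-m) / (K * (m * d + 1 : ℕ) ^ m) * (regFam ι m (insert c A) d (m * d)).card
        ≤ (degFam A d c D).card → ∀ u v, u ≠ v →
      ((1 - δ) * (D u * D v) / (m : ℝ) ^ (Fintype.card ι - 1) - Δ) * (degFam A d c D).card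
        ≤ totalCodeg A d c D u v) :
    (1 - 2 / K) * Real.exp (-(stepCost m (m ^ (Fintype.card ι - 1)) d K δ Δ))
        * ((((m ^ Fintype.card ι).choose (m * d) : ℕ) : ℝ)
          * (regFam ι m (insert c A) d (m * d)).card)
      ≤ ((regFam ι m A d (m * d)).card : ℝ) * ((m ^ (Fintype.card ι - 1)).choose d : ℝ) ^ m ∧
    (1 - 2 / K) * Real.exp (-(stepCost m (m ^ (Fintype.card ι - 1)) d K δ Δ))
        * (((regFam ι m A d (m * d)).card : ℝ) * ((m ^ (Fintype.card ι - 1)).choose d : ℝ) ^ m)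
      ≤ (((m ^ Fintype.card ι).choose (m * d) : ℕ) : ℝ)
          * (regFam ι m (insert c A) d (m * d)).card := by
  set w := m ^ (Fintype.card ι - 1) with hwdef
  have hwc : (m : ℝ) ^ (Fintype.card ι - 1) = (w : ℕ) := by rw [hwdef]; push_cast; rfl
  set PA := Finset.piAntidiag (Finset.univ : Finset (Fin m)) (m * d) with hPA
  set P : ℝ := (m * d + 1 : ℕ) ^ m with hP
  have hPpos : 0 < P := by positivity
  have hPcard : (PA.card : ℝ) ≤ P := by
    rw [hPA, hP]
    exact_mod_cast card_piAntidiag_le m (m * d)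
  set cost := stepCost m w d K δ Δ with hcost
  set W₁ : ℝ := (w.choose d : ℝ) ^ m with hW₁
  have hW₁c : linkWeight w (fun _ : Fin m => d) = W₁ := by simp [linkWeight, hW₁]
  have hW₁pos : 0 < W₁ := by
    have : 0 < w.choose d := Nat.choose_pos (by omega)
    positivity
  set Wt : ℝ := (((m ^ Fintype.card ι).choose (m * d) : ℕ) : ℝ) with hWt
  set F : ℝ := ((regFam ι m A d (m * d)).card : ℝ) with hF
  set N₁ : ℝ := ((regFam ι m (insert c A) d (m * d)).card : ℝ) with hN₁
  have hN₁c : ((degFam (m := m) A d c fun _ => d).card : ℝ) = N₁ := by rw [degFam_const]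
  have hN₁pos : 0 < N₁ := by
    rw [hN₁]
    exact_mod_cast hN
  set n₀ := Real.exp (-m) / (K * P) * N₁ with hn₀
  have hK0 : 0 < K := by linarith
  have hn₀pos : 0 < n₀ := by positivity
  have hm' : (0 : ℝ) < m := by exact_mod_cast hm
  have hd' : (0 : ℝ) < d := by exact_mod_cast hd0
  have hw0 : (0 : ℝ) < w := by
    have : 0 < w := by omega
    exact_mod_cast this
  have hB : (0 : ℝ) < m * d := by positivity
  have hexpm : Real.exp (-(m : ℝ)) ≤ 1 := Real.exp_le_one_iff.2 (by linarith)
  have hmem : ∀ D ∈ PA, ∑ v, D v = m * d := fun D hD => (Finset.mem_piAntidiag.1 hD).1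
  have hsq0 : ∀ D : Fin m → ℕ, 0 ≤ sqDev d D := fun D => Finset.sum_nonneg fun _ _ => sq_nonneg _
  -- the counts as sums over degree sequences
  have hFsum : F = ∑ D ∈ PA, ((degFam A d c D).card : ℝ) := card_regFam_eq A d c (m * d)
  have hWsum : Wt = ∑ D ∈ PA, linkWeight w D := by
    rw [hWt, ← card_regFam_empty (ι := ι) d, card_regFam_eq ∅ d c]
    exact Finset.sum_congr rfl fun D _ => card_degFam_empty_cast d c D
  have hN₁F : N₁ ≤ F := by
    rw [hFsum, ← hN₁c]
    refine Finset.single_le_sum (f := fun D => ((degFam (m := m) A d c D).card : ℝ))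
      (fun _ _ => Nat.cast_nonneg _) ?_
    rw [hPA, Finset.mem_piAntidiag]
    simp
  have hlw0 : ∀ D : Fin m → ℕ, 0 ≤ linkWeight w D := fun D =>
    Finset.prod_nonneg fun _ _ => Nat.cast_nonneg _
  have hW₁Wt : W₁ ≤ Wt := by
    rw [hWsum, ← hW₁c]
    refine Finset.single_le_sum (f := fun D : Fin m → ℕ => linkWeight w D)
      (fun _ _ => hlw0 _) ?_
    rw [hPA, Finset.mem_piAntidiag]
    simp
  have hWtpos : 0 < Wt := hW₁pos.trans_le hW₁Wt
  have hmarkF : (1 - 1 / K) * F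
      ≤ ∑ D ∈ PA with sqDev d D ≤ K * (m * d), ((degFam A d c D).card : ℝ) := by
    rw [hFsum]
    refine sum_le_of_markov PA _ (fun D => sqDev d D) hB hK0 (fun _ _ => Nat.cast_nonneg _)
      (fun D _ => hsq0 D) ?_
    rw [← hFsum]
    exact sum_card_mul_sqDev_le hm hc d
  have hmarkW : (1 - 1 / K) * Wt ≤ ∑ D ∈ PA with sqDev d D ≤ K * (m * d), linkWeight w D := by
    rw [hWsum]
    refine sum_le_of_markov PA _ (fun D => sqDev d D) hB hK0 (fun _ _ => hlw0 _)
      (fun D _ => hsq0 D) ?_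
    rw [← hWsum]
    have := sum_card_mul_sqDev_le (ι := ι) hm (Finset.notMem_empty c) d
    rw [card_regFam_empty] at this
    simp only [card_degFam_empty_cast] at this
    exact this
  -- degree sequences with small deviation
  have hdeg : ∀ D : Fin m → ℕ, sqDev d D ≤ K * (m * d) → ∀ v, 4 * D v ≤ 3 * w := fun D hS v =>
    le_of_sqDev_le hK0.le hd hKw hS v
  have hlw : ∀ D : Fin m → ℕ, sqDev d D ≤ K * (m * d) → 0 < linkWeight w D := by
    intro D hS
    refine linkWeight_pos fun v => ?_
    have := hdeg D hS v
    omega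
  have hZ₁ : relCount (m := m) A d c (fun _ => d) = N₁ / W₁ := by
    unfold relCount
    rw [hN₁c, ← hwdef, hW₁c]
  have hapriori : ∀ D ∈ PA, sqDev d D ≤ K * (m * d) →
      N₁ / W₁ * Real.exp (-m) ≤ relCount A d c D := by
    intro D hD hS
    have hpos := card_degFam_pos A hc (by rw [degFam_const]; exact hN) D (hmem D hD)
      (fun v => by have := hdeg D hS v; omega)
    have h := (relCount_compare hc hd0 hd zero_le_one le_rfl zero_lt_one (by
      intro D _ u v _
      simpa using totalCodeg_nonneg A d c D u v) D (hmem D hD) (hdeg D hS)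
      (by exact_mod_cast hpos)).1
    rw [hZ₁, hwc] at h
    refine le_trans ?_ h
    gcongr
    have h2d : 2 * (d : ℝ) ≤ w := by exact_mod_cast hd
    have : 2 * 1 * (d : ℝ) / w + 2 * 0 / d ≤ 1 := by
      rw [mul_zero, zero_div, add_zero, div_le_one hw0]
      linarith
    calc (m : ℝ) * (2 * 1 * (d : ℝ) / w + 2 * 0 / d) ≤ m * 1 := by gcongr
      _ = m := mul_one _
  have hcompare : ∀ D ∈ PA, sqDev d D ≤ K * (m * d) → n₀ ≤ (degFam A d c D).card →
      N₁ / W₁ * Real.exp (-cost) * linkWeight w D ≤ (degFam A d c D).card ∧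
      (degFam A d c D).card ≤ N₁ / W₁ * Real.exp cost * linkWeight w D := by
    intro D hD hS hn
    have h := relCount_compare hc hd0 hd hδ hΔ hn₀pos hT D (hmem D hD) (hdeg D hS) hn
    rw [hZ₁, hwc, ← hwdef] at h
    have hpot := totalPot_le w hΔ hd0 D (δ := δ)
    have hcoef : 0 ≤ 4 * δ / w + 24 * Δ * (1 + Real.log d) / d ^ 2 := by
      have := Real.log_natCast_nonneg d
      positivity
    have hpot' := hpot.trans (mul_le_mul_of_nonneg_left hS hcoef)
    have hc0 : 0 ≤ (4 * δ / w + 24 * Δ * (1 + Real.log d) / d ^ 2) * (K * (m * d)) := by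
      positivity
    have e1 : ((degFam A d c D).card : ℝ) = relCount A d c D * linkWeight w D := by
      unfold relCount
      rw [← hwdef, div_mul_cancel₀ _ (hlw D hS).ne']
    have hZ0 : 0 ≤ N₁ / W₁ := by positivity
    rw [e1]
    constructor
    · refine mul_le_mul_of_nonneg_right (le_trans ?_ h.1) (hlw0 D)
      gcongr
      rw [hcost, stepCost]
      linarith
    · refine mul_le_mul_of_nonneg_right (h.2.trans ?_) (hlw0 D)
      gcongr
      rw [hcost, stepCost]
      linarith
  have hε : 1 - 2 / K = 1 - 1 / K - 1 / K := by ring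
  constructor
  · -- lower bound for the count
    have h1 := sum_filter_ge PA (PA.filter fun D => sqDev d D ≤ K * (m * d))
      (Finset.filter_subset _ _) (fun D => linkWeight w D) (x := Wt / (K * P)) (by positivity)
      hPcard
    have e1 : P * (Wt / (K * P)) = 1 / K * Wt := by
      field_simp
    have h2 : (1 - 2 / K) * Wt ≤ ∑ D ∈ (PA.filter fun D => sqDev d D ≤ K * (m * d)) with
        Wt / (K * P) ≤ linkWeight w D, linkWeight w D := by
      rw [hε, sub_mul]
      linarith
    have h3 : N₁ / W₁ * Real.exp (-cost) * ∑ D ∈ (PA.filter fun D => sqDev d D ≤ K * (m * d)) with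
        Wt / (K * P) ≤ linkWeight w D, linkWeight w D ≤ F := by
      rw [Finset.mul_sum, hFsum]
      refine le_trans (Finset.sum_le_sum (g := fun D => ((degFam A d c D).card : ℝ)) ?_)
        (Finset.sum_le_sum_of_subset_of_nonneg ((Finset.filter_subset _ _).trans
          (Finset.filter_subset _ _)) fun _ _ _ => Nat.cast_nonneg _)
      intro D hD
      rw [Finset.mem_filter, Finset.mem_filter] at hD
      refine (hcompare D hD.1.1 hD.1.2 ?_).1
      have h4 := hapriori D hD.1.1 hD.1.2
      unfold relCount at h4
      rw [← hwdef, le_div_iff₀ (hlw D hD.1.2)] at h4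
      refine le_trans ?_ h4
      calc n₀ = N₁ / W₁ * Real.exp (-m) * (W₁ / (K * P)) := by
            rw [hn₀]
            field_simp
        _ ≤ N₁ / W₁ * Real.exp (-m) * linkWeight w D := by
            gcongr
            refine le_trans ?_ hD.2
            gcongr
    have h4 : N₁ / W₁ * Real.exp (-cost) * ((1 - 2 / K) * Wt) ≤ F :=
      (mul_le_mul_of_nonneg_left h2 (by positivity)).trans h3
    have h5 := mul_le_mul_of_nonneg_right h4 hW₁pos.le
    refine le_trans (le_of_eq ?_) h5
    field_simp
  · have h1 := sum_filter_ge PA (PA.filter fun D => sqDev d D ≤ K * (m * d))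
      (Finset.filter_subset _ _) (fun D => ((degFam A d c D).card : ℝ)) (x := n₀) hn₀pos.le
      hPcard
    have e1 : P * n₀ ≤ 1 / K * F := by
      calc P * n₀ = Real.exp (-m) * (1 / K * N₁) := by
            rw [hn₀]
            field_simp
        _ ≤ 1 * (1 / K * F) := by gcongr
        _ = _ := one_mul _
    have h2 : (1 - 2 / K) * F ≤ ∑ D ∈ (PA.filter fun D => sqDev d D ≤ K * (m * d)) with
        n₀ ≤ ((degFam A d c D).card : ℝ), ((degFam A d c D).card : ℝ) := by
      rw [hε, sub_mul]
      linarith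
    have h3 : ∑ D ∈ (PA.filter fun D => sqDev d D ≤ K * (m * d)) with
        n₀ ≤ ((degFam A d c D).card : ℝ), ((degFam A d c D).card : ℝ)
        ≤ N₁ / W₁ * Real.exp cost * Wt := by
      have hZ0 : 0 ≤ N₁ / W₁ * Real.exp cost := by positivity
      have h6 : ∀ D ∈ (PA.filter fun D => sqDev d D ≤ K * (m * d)).filter fun D =>
          n₀ ≤ ((degFam A d c D).card : ℝ),
          ((degFam A d c D).card : ℝ) ≤ N₁ / W₁ * Real.exp cost * linkWeight w D := by
        intro D hD
        rw [Finset.mem_filter, Finset.mem_filter] at hD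
        exact (hcompare D hD.1.1 hD.1.2 hD.2).2
      have h7 := Finset.sum_le_sum_of_subset_of_nonneg (f := fun D => linkWeight w D)
        ((Finset.filter_subset (fun D => n₀ ≤ ((degFam A d c D).card : ℝ))
          (PA.filter fun D => sqDev d D ≤ K * (m * d))).trans (Finset.filter_subset _ _))
        fun D _ _ => hlw0 D
      rw [hWsum]
      refine (Finset.sum_le_sum h6).trans ?_
      rw [← Finset.mul_sum]
      exact mul_le_mul_of_nonneg_left h7 hZ0
    have h4 := h2.trans h3
    have h5 := mul_le_mul_of_nonneg_right h4 (show 0 ≤ Real.exp (-cost) * W₁ by positivity)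
    have e2 : N₁ / W₁ * Real.exp cost * Wt * (Real.exp (-cost) * W₁) = Wt * N₁ := by
      rw [show N₁ / W₁ * Real.exp cost * Wt * (Real.exp (-cost) * W₁)
        = Wt * (N₁ / W₁ * W₁) * (Real.exp cost * Real.exp (-cost)) by ring, ← Real.exp_add,
        add_neg_cancel, Real.exp_zero, div_mul_cancel₀ _ hW₁pos.ne', mul_one]
    rw [e2] at h5
    refine le_trans (le_of_eq ?_) h5
    ring

end ClassStep

section AllClasses
variable {ι : Type*} [Fintype ι] [DecidableEq ι] {m : ℕ}

theorem choose_le_mul_card_regFam (d : ℕ) (A : Finset ι) :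
    (((m ^ Fintype.card ι).choose (m * d) : ℕ) : ℝ)
      ≤ (((m * d + 1 : ℕ) : ℝ) ^ m) ^ A.card * (regFam ι m A d (m * d)).card := by
  induction A using Finset.induction_on with
  | empty => simp [card_regFam_empty]
  | insert c A hc ih =>
    rw [Finset.card_insert_of_notMem hc, pow_succ, mul_assoc]
    exact ih.trans (mul_le_mul_of_nonneg_left (card_regFam_le_mul A d hc) (by positivity))

theorem pow_choose_le_choose (hι : 0 < Fintype.card ι) (d : ℕ) :
    ((m ^ (Fintype.card ι - 1)).choose d : ℝ) ^ m
      ≤ (((m ^ Fintype.card ι).choose (m * d) : ℕ) : ℝ) := by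
  obtain ⟨c⟩ : Nonempty ι := Fintype.card_pos_iff.1 hι
  rw [← card_regFam_empty (ι := ι) d, card_regFam_eq ∅ d c]
  refine le_trans (le_of_eq ?_) (Finset.single_le_sum
    (f := fun D : Fin m → ℕ => ((degFam ∅ d c D).card : ℝ)) (a := fun _ => d)
    (fun _ _ => Nat.cast_nonneg _) (by rw [Finset.mem_piAntidiag]; simp))
  simp only [card_degFam_empty_cast]
  simp [linkWeight]

theorem card_regFam_bounds (hm : 0 < m) (hι : 0 < Fintype.card ι) {d : ℕ} (hd0 : 0 < d)
    (hd : 2 * d ≤ m ^ (Fintype.card ι - 1)) {K δ Δ : ℝ} (hK : 2 < K)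
    (hKw : 8 * K * m ≤ (m ^ (Fintype.card ι - 1) : ℕ)) (hδ : 0 ≤ δ) (hΔ : 0 ≤ Δ)
    (hT : ∀ (A : Finset ι) (c : ι) (D : Fin m → ℕ),
      ((m ^ (Fintype.card ι - 1)).choose d : ℝ) ^ m
        ≤ Real.exp m * K * (((m * d + 1 : ℕ) : ℝ) ^ m) ^ (Fintype.card ι + 1)
          * (degFam A d c D).card → ∀ u v, u ≠ v →
      ((1 - δ) * (D u * D v) / (m : ℝ) ^ (Fintype.card ι - 1) - Δ) * (degFam A d c D).card
        ≤ totalCodeg A d c D u v) (A : Finset ι) :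
    ((1 - 2 / K) * Real.exp (-(stepCost m (m ^ (Fintype.card ι - 1)) d K δ Δ))) ^ A.card
        * ((((m ^ Fintype.card ι).choose (m * d) : ℕ) : ℝ)
          * (((m ^ (Fintype.card ι - 1)).choose d : ℝ) ^ m) ^ A.card)
      ≤ (regFam ι m A d (m * d)).card
          * (((m ^ Fintype.card ι).choose (m * d) : ℕ) : ℝ) ^ A.card ∧
    ((1 - 2 / K) * Real.exp (-(stepCost m (m ^ (Fintype.card ι - 1)) d K δ Δ))) ^ A.card
        * ((regFam ι m A d (m * d)).card
          * (((m ^ Fintype.card ι).choose (m * d) : ℕ) : ℝ) ^ A.card)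
      ≤ (((m ^ Fintype.card ι).choose (m * d) : ℕ) : ℝ)
          * (((m ^ (Fintype.card ι - 1)).choose d : ℝ) ^ m) ^ A.card := by
  have hK0 : 0 < K := by linarith
  have hβ : 0 ≤ (1 - 2 / K) * Real.exp (-(stepCost m (m ^ (Fintype.card ι - 1)) d K δ Δ)) := by
    refine mul_nonneg ?_ (Real.exp_pos _).le
    rw [sub_nonneg, div_le_one hK0]
    exact hK.le
  have hC : 0 < (m ^ (Fintype.card ι - 1)).choose d := Nat.choose_pos (by omega)
  have hW₁ : 0 < ((m ^ (Fintype.card ι - 1)).choose d : ℝ) ^ m := by positivity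
  have hWt := pow_choose_le_choose (m := m) hι d
  have hP : (1 : ℝ) ≤ ((m * d + 1 : ℕ) : ℝ) ^ m := by
    refine one_le_pow₀ ?_
    push_cast
    have : (0 : ℝ) ≤ m * d := by positivity
    linarith
  induction A using Finset.induction_on with
  | empty => simp [card_regFam_empty]
  | insert c A hc ih =>
    have hlow := choose_le_mul_card_regFam (m := m) d (insert c A)
    have hpos : 0 < (regFam ι m (insert c A) d (m * d)).card := by
      by_contra h0
      rw [not_lt, Nat.le_zero] at h0
      rw [h0, Nat.cast_zero, mul_zero] at hlow
      linarith
    have hcard : (insert c A).card ≤ Fintype.card ι := Finset.card_le_univ _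
    have hlow' : ((m ^ (Fintype.card ι - 1)).choose d : ℝ) ^ m
        ≤ (((m * d + 1 : ℕ) : ℝ) ^ m) ^ Fintype.card ι
          * (regFam ι m (insert c A) d (m * d)).card := by
      refine hWt.trans (hlow.trans ?_)
      gcongr
    have hstep := regFam_step hm hc hd0 hd hK hKw hδ hΔ hpos (by
      intro D hD u v huv
      refine hT A c D (hlow'.trans ?_) u v huv
      have h1 : ((regFam ι m (insert c A) d (m * d)).card : ℝ)
          ≤ Real.exp m * K * ((m * d + 1 : ℕ) : ℝ) ^ m * (degFam A d c D).card := by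
        rw [Real.exp_neg] at hD
        have h2 := mul_le_mul_of_nonneg_left hD
          (show 0 ≤ Real.exp m * (K * ((m * d + 1 : ℕ) : ℝ) ^ m) by positivity)
        refine le_trans (le_of_eq ?_) (h2.trans (le_of_eq ?_))
        · have := (Real.exp_pos m).ne'
          field_simp
        · ring
      calc (((m * d + 1 : ℕ) : ℝ) ^ m) ^ Fintype.card ι
            * (regFam ι m (insert c A) d (m * d)).card
          ≤ (((m * d + 1 : ℕ) : ℝ) ^ m) ^ Fintype.card ι
            * (Real.exp m * K * ((m * d + 1 : ℕ) : ℝ) ^ m * (degFam A d c D).card) := by gcongr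
        _ = _ := by ring)
    generalize (1 - 2 / K) * Real.exp (-(stepCost m (m ^ (Fintype.card ι - 1)) d K δ Δ)) = β at *
    generalize (((m ^ Fintype.card ι).choose (m * d) : ℕ) : ℝ) = Wt at *
    generalize ((m ^ (Fintype.card ι - 1)).choose d : ℝ) ^ m = W₁ at *
    have hWt0 : 0 ≤ Wt := hW₁.le.trans hWt
    rw [Finset.card_insert_of_notMem hc]
    generalize ((regFam ι m (insert c A) d (m * d)).card : ℝ) = N₁ at *
    generalize ((regFam ι m A d (m * d)).card : ℝ) = F at *
    constructor
    · calc β ^ (A.card + 1) * (Wt * W₁ ^ (A.card + 1))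
          = β * W₁ * (β ^ A.card * (Wt * W₁ ^ A.card)) := by ring
        _ ≤ β * W₁ * (F * Wt ^ A.card) := mul_le_mul_of_nonneg_left ih.1 (by positivity)
        _ = Wt ^ A.card * (β * (F * W₁)) := by ring
        _ ≤ Wt ^ A.card * (Wt * N₁) := mul_le_mul_of_nonneg_left hstep.2 (by positivity)
        _ = N₁ * Wt ^ (A.card + 1) := by ring
    · calc β ^ (A.card + 1) * (N₁ * Wt ^ (A.card + 1))
          = β ^ A.card * Wt ^ A.card * (β * (Wt * N₁)) := by ring
        _ ≤ β ^ A.card * Wt ^ A.card * (F * W₁) :=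
          mul_le_mul_of_nonneg_left hstep.1 (by positivity)
        _ = W₁ * (β ^ A.card * (F * Wt ^ A.card)) := by ring
        _ ≤ W₁ * (Wt * W₁ ^ A.card) := mul_le_mul_of_nonneg_left ih.2 (by positivity)
        _ = Wt * W₁ ^ (A.card + 1) := by ring

end AllClasses

section Count

theorem Hcount_eq_card_regFam {r : ℕ} (hr : 0 < r) (m d : ℕ) :
    Hcount r m d = (regFam (Fin r) m Finset.univ d (m * d)).card := by
  unfold Hcount
  rw [Nat.card_eq_fintype_card, Fintype.card_subtype]
  congr 1
  ext E
  simp only [regFam, vdeg, Finset.mem_filter, Finset.mem_univ, true_and, true_implies]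
  refine ⟨fun h => ⟨?_, h⟩, fun h => h.2⟩
  rw [← sum_vdeg E ⟨0, hr⟩]
  simp [vdeg, h]

theorem Hcount_zero {r : ℕ} (hr : 0 < r) (m : ℕ) : Hcount r m 0 = 1 := by
  rw [Hcount_eq_card_regFam hr, Finset.card_eq_one]
  refine ⟨∅, ?_⟩
  ext E
  simp only [regFam, vdeg, Finset.mem_filter, Finset.mem_univ, true_and, mul_zero,
    Finset.card_eq_zero, Finset.mem_singleton]
  refine ⟨fun h => h.1, fun h => ?_⟩
  simp [h]

theorem Hhat_zero (r m : ℕ) : Hhat r m 0 = 1 := by simp [Hhat]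

theorem vdeg_univ {ι : Type*} [Fintype ι] [DecidableEq ι] {m : ℕ} (t : ι) (v : Fin m) :
    vdeg (Finset.univ : Finset (ι → Fin m)) t v = m ^ (Fintype.card ι - 1) := by
  rw [← card_link]
  simp [link]

theorem vdeg_compl {ι : Type*} [Fintype ι] [DecidableEq ι] {m : ℕ} (E : Finset (ι → Fin m))
    (t : ι) (v : Fin m) : vdeg Eᶜ t v + vdeg E t v = m ^ (Fintype.card ι - 1) := by
  rw [← vdeg_univ t v]
  unfold vdeg
  rw [← Finset.card_union_of_disjoint
    (Finset.disjoint_filter_filter disjoint_compl_left), ← Finset.filter_union,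
    Finset.union_comm, Finset.union_compl]

theorem Hcount_compl {r m d : ℕ} (hd : d ≤ m ^ (r - 1)) :
    Hcount r m (m ^ (r - 1) - d) = Hcount r m d := by
  unfold Hcount
  refine Nat.card_congr ((compl_involutive.toPerm _).subtypeEquiv fun E => ?_)
  refine forall_congr' fun t => forall_congr' fun v => ?_
  have h := vdeg_compl E t v
  rw [Fintype.card_fin] at h
  unfold vdeg at h
  simp only [Function.Involutive.coe_toPerm]
  omega

theorem Hhat_compl {r m d : ℕ} (hr : 0 < r) (hd : d ≤ m ^ (r - 1)) :
    Hhat r m (m ^ (r - 1) - d) = Hhat r m d := by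
  unfold Hhat
  have h1 : m ^ r = m * m ^ (r - 1) := by
    rw [mul_comm, ← pow_succ, Nat.sub_add_cancel hr]
  rw [Nat.choose_symm hd, h1, Nat.mul_sub, Nat.choose_symm (Nat.mul_le_mul_left m hd)]

theorem ratio_bounds {r m d : ℕ} (hr : 0 < r) (hd0 : 2 * d ≤ m ^ (r - 1)) {β : ℝ}
    (h : β ^ r * ((((m ^ r).choose (m * d) : ℕ) : ℝ)
          * (((m ^ (r - 1)).choose d : ℝ) ^ m) ^ r)
      ≤ (regFam (Fin r) m Finset.univ d (m * d)).card
          * (((m ^ r).choose (m * d) : ℕ) : ℝ) ^ r ∧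
    β ^ r * ((regFam (Fin r) m Finset.univ d (m * d)).card
          * (((m ^ r).choose (m * d) : ℕ) : ℝ) ^ r)
      ≤ (((m ^ r).choose (m * d) : ℕ) : ℝ)
          * (((m ^ (r - 1)).choose d : ℝ) ^ m) ^ r) :
    β ^ r ≤ Hcount r m d / Hhat r m d ∧ β ^ r * (Hcount r m d / Hhat r m d) ≤ 1 := by
  have hdw : d ≤ m ^ (r - 1) := by omega
  have hC : (0 : ℝ) < (m ^ (r - 1)).choose d := by exact_mod_cast Nat.choose_pos hdw
  have h1 : m ^ r = m * m ^ (r - 1) := by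
    rw [mul_comm, ← pow_succ, Nat.sub_add_cancel hr]
  have hW : (0 : ℝ) < (m ^ r).choose (m * d) := by
    have : m * d ≤ m ^ r := by rw [h1]; exact Nat.mul_le_mul_left m hdw
    exact_mod_cast Nat.choose_pos this
  obtain ⟨r, rfl⟩ : ∃ s, r = s + 1 := ⟨r - 1, by omega⟩
  rw [Hcount_eq_card_regFam hr]
  unfold Hhat
  rw [Nat.add_sub_cancel] at *
  generalize ((regFam (Fin (r + 1)) m Finset.univ d (m * d)).card : ℝ) = F at *
  generalize (((m ^ (r + 1)).choose (m * d) : ℕ) : ℝ) = Wt at *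
  generalize ((m ^ r).choose d : ℝ) = C at *
  rw [← pow_mul, mul_comm m (r + 1)] at h
  generalize β ^ (r + 1) = b at *
  have hCp : 0 < C ^ ((r + 1) * m) := by positivity
  generalize C ^ ((r + 1) * m) = W at *
  rw [div_div_eq_mul_div, mul_div_assoc', div_le_one hCp, le_div_iff₀ hCp]
  constructor
  · refine le_of_mul_le_mul_left (le_trans (le_of_eq ?_) (h.1.trans (le_of_eq ?_))) hW <;> ring
  · refine le_of_mul_le_mul_left (le_trans (le_of_eq ?_) (h.2.trans (le_of_eq ?_))) hW <;> ring

end Count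

section CodegBound
variable {ι : Type*} [Fintype ι] [DecidableEq ι] {m : ℕ}

theorem le_totalCodeg_of_card_ge (hm : 2 ≤ m) (A : Finset ι) (d : ℕ) {c : ι} (D : Fin m → ℕ)
    {u v : Fin m} (huv : u ≠ v) {g K : ℕ} (hg : 0 < g) {x M : ℝ} (hx : 1 ≤ x)
    (h1 : x * m * ((m ^ (Fintype.card ι - 1) + 1) ^ (4 * g) : ℕ)
      ≤ ((m ^ (Fintype.card ι - 1)).choose d : ℕ))
    (h2 : (m : ℝ) ^ 2 * 2 ^ m * M ≤ x ^ K)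
    (hN : ((m ^ (Fintype.card ι - 1)).choose d : ℝ) ^ m ≤ M * (degFam A d c D).card) :
    ((1 - (Fintype.card ι : ℝ) / g) * (D u * D v) / (m : ℝ) ^ (Fintype.card ι - 1)
        - 2 * g * (3 * ((K : ℝ) ^ 2 + 1)) / m) * (degFam A d c D).card
      ≤ totalCodeg A d c D u v := by
  refine le_totalCodeg hm A d D huv hg (by positivity) fun s hs => ?_
  refine sum_closePairs_le A d c D hs hx h1 ?_
  calc (m : ℝ) ^ 2 * (2 * ((m ^ (Fintype.card ι - 1)).choose d : ℕ)) ^ m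
      = (m : ℝ) ^ 2 * 2 ^ m * ((m ^ (Fintype.card ι - 1)).choose d : ℝ) ^ m := by ring
    _ ≤ (m : ℝ) ^ 2 * 2 ^ m * (M * (degFam A d c D).card) := by gcongr
    _ = (m : ℝ) ^ 2 * 2 ^ m * M * (degFam A d c D).card := by ring
    _ ≤ x ^ K * (degFam A d c D).card := by gcongr

end CodegBound

section Asymptotics

theorem two_pow_le_choose {w d : ℕ} (h : 2 * d ≤ w) : 2 ^ d ≤ w.choose d := by
  refine le_trans ?_ (Nat.choose_le_choose d h)
  rw [← Nat.centralBinom_eq_two_mul_choose]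
  clear h
  induction d with
  | zero => simp
  | succ n ih =>
    have h := Nat.succ_mul_centralBinom_succ n
    refine le_of_mul_le_mul_left ?_ (Nat.succ_pos n)
    rw [h, pow_succ]
    nlinarith

theorem log_le_mul_log {q x : ℝ} (hx : 0 < x) (n : ℕ) (h : x ≤ q ^ n) :
    Real.log x ≤ n * Real.log q := by
  rw [← Real.log_pow]
  exact Real.log_le_log hx h

theorem pow_of_stepCost_le {r : ℕ} (hr : 0 < r) {L c : ℝ} (hL : 2 ≤ L) (hc : r * c ≤ 1 / L) :
    1 - 3 / L ≤ ((1 - 2 / (r * L)) * Real.exp (-c)) ^ r := by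
  have hr' : (1 : ℝ) ≤ r := by exact_mod_cast hr
  have h1 : 1 - 2 / L ≤ (1 - 2 / (r * L)) ^ r := by
    have h2 : (2 : ℝ) / (r * L) ≤ 2 := by
      rw [div_le_iff₀ (by positivity)]
      nlinarith
    have := one_add_mul_le_pow (a := -(2 / (r * L))) (by linarith) r
    refine le_trans (le_of_eq ?_) (this.trans (le_of_eq ?_))
    · field_simp
      ring
    · ring
  have h3 : 1 - 1 / L ≤ Real.exp (-c) ^ r := by
    rw [← Real.exp_nat_mul]
    have := Real.add_one_le_exp (r * -c)
    linarith
  have h4 : 0 ≤ 1 - 1 / L := by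
    rw [sub_nonneg, div_le_one (by linarith)]
    linarith
  have h5 : 0 ≤ 1 - 2 / L := by
    rw [sub_nonneg, div_le_one (by linarith)]
    linarith
  rw [mul_pow]
  refine le_trans ?_ (mul_le_mul h1 h3 h4 (h5.trans h1))
  have : (1 - 2 / L) * (1 - 1 / L) = 1 - 3 / L + 2 / L ^ 2 := by
    field_simp
    ring
  rw [this]
  have : 0 ≤ 2 / L ^ 2 := by positivity
  linarith

theorem stepCost_trivial {m q d r : ℕ} (hm : 0 < m) {L : ℝ} (hL : 100 ≤ L)
    (hq : (0 : ℝ) < q) (hr1 : 1 ≤ r) (hr : (r : ℝ) ≤ 3 * L) (hd : d * L ^ 5 ≤ q) :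
    r * stepCost m (m * q) d (r * L) 1 0 ≤ 1 / L := by
  have hm' : (0 : ℝ) < m := by exact_mod_cast hm
  have hr1' : (1 : ℝ) ≤ r := by exact_mod_cast hr1
  have e : stepCost m (m * q) d (r * L) 1 0 = (2 + 4 * (r * L)) * (d / q) := by
    unfold stepCost
    simp only [mul_zero, zero_mul, zero_div, add_zero]
    push_cast
    field_simp
  have h1 : (d : ℝ) / q ≤ 1 / L ^ 5 := by
    rw [div_le_div_iff₀ hq (by positivity)]
    linarith
  have h2 : 2 + 4 * (r * L) ≤ 18 * L ^ 2 := by nlinarith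
  calc r * stepCost m (m * q) d (r * L) 1 0 = r * ((2 + 4 * (r * L)) * (d / q)) := by rw [e]
    _ ≤ (3 * L) * ((18 * L ^ 2) * (1 / L ^ 5)) := by gcongr
    _ = 54 / L * (1 / L) := by
      field_simp
      ring
    _ ≤ 1 * (1 / L) := by
      gcongr
      rw [div_le_one (by linarith)]
      linarith
    _ = 1 / L := one_mul _

theorem stepCost_nontrivial {m q d r g K : ℕ} (hm : 0 < m) (hd0 : 0 < d) {L : ℝ}
    (hL : 100000 ≤ L) (hq : L ^ 27 ≤ q) (hr1 : 1 ≤ r) (hr : (r : ℝ) ≤ 3 * L)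
    (hd : Real.log d ≤ 2 * L) (hg1 : d ≤ g * L ^ 21) (hg2 : g * L ^ 21 ≤ 2 * d)
    (hK : (K : ℝ) ≤ 47 * L ^ 7) :
    r * stepCost m (m * q) d (r * L) (r / g) (2 * g * (3 * ((K : ℝ) ^ 2 + 1)) / m) ≤ 1 / L := by
  have hm' : (0 : ℝ) < m := by exact_mod_cast hm
  have hd' : (0 : ℝ) < d := by exact_mod_cast hd0
  have hr1' : (1 : ℝ) ≤ r := by exact_mod_cast hr1
  have hL0 : 0 < L := by linarith
  have hq0 : (0 : ℝ) < q := lt_of_lt_of_le (by positivity) hq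
  have hg0 : (0 : ℝ) < g := by
    by_contra h
    nlinarith [pow_pos hL0 21]
  have hlog : 0 ≤ Real.log d := Real.log_natCast_nonneg d
  have e : stepCost m (m * q) d (r * L) (r / g) (2 * g * (3 * ((K : ℝ) ^ 2 + 1)) / m)
      = (2 + 4 * (r * L)) * r * ((d / g) * (1 / q))
        + (2 + 24 * (1 + Real.log d) * (r * L)) * (6 * ((K : ℝ) ^ 2 + 1)) * (g / d) := by
    unfold stepCost
    push_cast
    field_simp
    ring
  have h1 : (d : ℝ) / g ≤ L ^ 21 := by
    rw [div_le_iff₀ hg0]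
    linarith
  have h2 : (g : ℝ) / d ≤ 2 / L ^ 21 := by
    rw [div_le_div_iff₀ hd' (by positivity)]
    linarith
  have h3 : (1 : ℝ) / q ≤ 1 / L ^ 27 := by gcongr
  have h4 : 2 + 4 * (r * L) ≤ 18 * L ^ 2 := by nlinarith
  have h5 : (K : ℝ) ^ 2 + 1 ≤ 2300 * L ^ 14 := by
    have h6 : (K : ℝ) ^ 2 ≤ (47 * L ^ 7) ^ 2 := by gcongr
    have h7 : 1 ≤ L ^ 14 := one_le_pow₀ (by linarith)
    have h8 : (47 * L ^ 7) ^ 2 = 2209 * L ^ 14 := by ring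
    linarith
  have h9 : 2 + 24 * (1 + Real.log d) * (r * L) ≤ 218 * L ^ 3 := by
    have ha : 24 * (1 + Real.log d) * (r * L) ≤ 24 * (3 * L) * (3 * L * L) := by
      gcongr
      linarith
    have hb : 1 ≤ L ^ 3 := one_le_pow₀ (by linarith)
    nlinarith
  rw [e]
  calc r * ((2 + 4 * (r * L)) * r * ((d / g) * (1 / q))
        + (2 + 24 * (1 + Real.log d) * (r * L)) * (6 * ((K : ℝ) ^ 2 + 1)) * (g / d))
      ≤ (3 * L) * ((18 * L ^ 2) * (3 * L) * (L ^ 21 * (1 / L ^ 27))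
        + (218 * L ^ 3) * (6 * (2300 * L ^ 14)) * (2 / L ^ 21)) := by gcongr
    _ = (162 / L + 18050400 / L ^ 2) * (1 / L) := by
      field_simp
      ring
    _ ≤ 1 * (1 / L) := by
      gcongr
      have h10 : 162 / L ≤ 1 / 2 := by
        rw [div_le_iff₀ hL0]
        linarith
      have h11 : 18050400 / L ^ 2 ≤ 1 / 2 := by
        rw [div_le_iff₀ (by positivity)]
        nlinarith
      linarith
    _ = 1 / L := one_mul _

end Asymptotics

section Ratio

theorem exp_threshold_le_choose {m w d g : ℕ} (hm : 0 < m) (hd : 2 * d ≤ w) {L : ℝ}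
    (hL : 100000 ≤ L) (hlm : Real.log m ≤ L) (hlw : Real.log (w + 1 : ℕ) ≤ 3 * L)
    (hdL : 100 * L ≤ d) (hg : g * L ^ 21 ≤ 2 * d) :
    Real.exp (d / 2) * m * ((w + 1) ^ (4 * g) : ℕ) ≤ (w.choose d : ℕ) := by
  have hm' : (0 : ℝ) < m := by exact_mod_cast hm
  have h1 : (m : ℝ) ≤ Real.exp L := by rwa [← Real.log_le_iff_le_exp hm']
  have h2 : (((w + 1) ^ (4 * g) : ℕ) : ℝ) ≤ Real.exp (12 * (g * L)) := by
    rw [← Real.log_le_iff_le_exp (by positivity), Nat.cast_pow, Real.log_pow]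
    push_cast at hlw ⊢
    have : (0 : ℝ) ≤ g := Nat.cast_nonneg g
    nlinarith
  have h3 : (g * L) * 1000 ≤ 2 * d := by
    refine le_trans ?_ hg
    have h4 : 1000 ≤ L ^ 20 := by
      calc (1000 : ℝ) ≤ L := by linarith
        _ = L ^ 1 := (pow_one L).symm
        _ ≤ L ^ 20 := pow_le_pow_right₀ (by linarith) (by norm_num)
    calc (g * L) * 1000 ≤ (g * L) * L ^ 20 := by gcongr
      _ = g * L ^ 21 := by ring
  have h5 : Real.exp (d / 2 + L + 12 * (g * L)) ≤ 2 ^ d := by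
    rw [← Real.le_log_iff_exp_le (by positivity), Real.log_pow]
    have := Real.log_two_gt_d9
    have hd0 : (0 : ℝ) ≤ d := Nat.cast_nonneg d
    nlinarith
  calc Real.exp (d / 2) * m * ((w + 1) ^ (4 * g) : ℕ)
      ≤ Real.exp (d / 2) * Real.exp L * Real.exp (12 * (g * L)) := by gcongr
    _ = Real.exp (d / 2 + L + 12 * (g * L)) := by rw [Real.exp_add, Real.exp_add]
    _ ≤ 2 ^ d := h5
    _ ≤ (w.choose d : ℕ) := by exact_mod_cast two_pow_le_choose hd

theorem threshold_le_exp_pow {m d r K : ℕ} (hm : 0 < m) (hr : 1 ≤ r) {L : ℝ}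
    (hL : 100 ≤ L) (hlm : Real.log m ≤ L) (hlP : Real.log (m * d + 1 : ℕ) ≤ 4 * L)
    (hrL : (r : ℝ) ≤ 3 * L) (hmd : m ≤ d * L ^ 5) (hK : 46 * L ^ 7 ≤ K) :
    (m : ℝ) ^ 2 * 2 ^ m
        * (Real.exp m * (r * L) * (((m * d + 1 : ℕ) : ℝ) ^ m) ^ (r + 1))
      ≤ Real.exp (d / 2) ^ K := by
  have hm' : (1 : ℝ) ≤ m := by exact_mod_cast hm
  have h1 : (m : ℝ) ≤ Real.exp L := by rwa [← Real.log_le_iff_le_exp (by linarith)]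
  have h2 : (2 : ℝ) ≤ Real.exp 1 := by
    have := Real.add_one_le_exp (1 : ℝ)
    linarith
  have h3 : (r : ℝ) * L ≤ Real.exp (3 * L ^ 2) := by
    have := Real.add_one_le_exp (3 * L ^ 2)
    nlinarith
  have h4 : ((m * d + 1 : ℕ) : ℝ) ≤ Real.exp (4 * L) := by
    rwa [← Real.log_le_iff_le_exp (by positivity)]
  calc (m : ℝ) ^ 2 * 2 ^ m
        * (Real.exp m * (r * L) * (((m * d + 1 : ℕ) : ℝ) ^ m) ^ (r + 1))
      ≤ Real.exp L ^ 2 * Real.exp 1 ^ m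
        * (Real.exp m * Real.exp (3 * L ^ 2) * (Real.exp (4 * L) ^ m) ^ (r + 1)) := by gcongr
    _ = Real.exp (2 * L + m * 1 + (m + 3 * L ^ 2 + (r + 1 : ℕ) * (m * (4 * L)))) := by
      simp only [Real.exp_add, Real.exp_nat_mul]
      rw [show (2 : ℝ) * L = (2 : ℕ) * L by norm_num, Real.exp_nat_mul]
    _ ≤ Real.exp (K * (d / 2)) := by
      rw [Real.exp_le_exp]
      have h5 : ((r + 1 : ℕ) : ℝ) * (m * (4 * L)) ≤ 4 * L * (m * (4 * L)) := by
        gcongr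
        push_cast
        linarith
      have h6 : 2 * L ≤ L ^ 2 * m := by nlinarith
      have h7 : 2 * (m : ℝ) ≤ L ^ 2 * m := by
        gcongr
        nlinarith
      have h8 : 3 * L ^ 2 ≤ 3 * L ^ 2 * m := by nlinarith
      calc 2 * L + m * 1 + (m + 3 * L ^ 2 + (r + 1 : ℕ) * (m * (4 * L))) ≤ 23 * L ^ 2 * m := by
            linarith [mul_nonneg (sq_nonneg L) (Nat.cast_nonneg (α := ℝ) m)]
        _ ≤ 23 * L ^ 2 * (d * L ^ 5) := by gcongr
        _ = 46 * L ^ 7 * (d / 2) := by ring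
        _ ≤ K * (d / 2) := by gcongr
    _ = Real.exp (d / 2) ^ K := Real.exp_nat_mul _ _

theorem natCast_le_three_mul_log {m r : ℕ} (hm : 2 ≤ m) (hL : 100 ≤ Real.log (m ^ (r - 2) : ℕ)) :
    (r : ℝ) ≤ 3 * Real.log (m ^ (r - 2) : ℕ) := by
  have h1 : ((r - 2 : ℕ) : ℝ) * Real.log 2 ≤ Real.log (m ^ (r - 2) : ℕ) := by
    rw [← Real.log_pow]
    refine Real.log_le_log (by positivity) ?_
    exact_mod_cast Nat.pow_le_pow_left hm _
  have h2 : (r : ℝ) ≤ (r - 2 : ℕ) + 2 := by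
    exact_mod_cast (by omega : r ≤ r - 2 + 2)
  have h3 := Real.log_two_gt_d9
  have h4 : (0 : ℝ) ≤ (r - 2 : ℕ) := Nat.cast_nonneg _
  nlinarith

theorem exists_ratio_bound {r m d : ℕ} (hr : 3 ≤ r) (hm : 2 ≤ m) (hd0 : 0 < d)
    (hd : 2 * d ≤ m ^ (r - 1)) {L : ℝ} (hLq : Real.log (m ^ (r - 2) : ℕ) = L)
    (hL : 100000 ≤ L) (hq : L ^ 27 ≤ (m ^ (r - 2) : ℕ)) :
    ∃ b, 1 - 3 / L ≤ b ∧ b ≤ Hcount r m d / Hhat r m d ∧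
      b * (Hcount r m d / Hhat r m d) ≤ 1 := by
  have hrL : (r : ℝ) ≤ 3 * L := by
    rw [← hLq] at hL ⊢
    exact natCast_le_three_mul_log hm (by linarith)
  set q := m ^ (r - 2) with hqdef
  have hL0 : 0 < L := by linarith
  have hmq : m ≤ q := Nat.le_self_pow (by omega) m
  have hw : m ^ (r - 1) = m * q := by
    rw [hqdef, ← pow_succ', show r - 2 + 1 = r - 1 by omega]
  have hr0 : (0 : ℝ) < r := by exact_mod_cast (by omega : 0 < r)
  have hmq' : (m : ℝ) ≤ q := by exact_mod_cast hmq
  have hm' : (2 : ℝ) ≤ m := by exact_mod_cast hm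
  have hq2 : (2 : ℝ) ≤ q := hm'.trans hmq'
  have hwq : (m : ℝ) * q ≤ q ^ 2 := by nlinarith
  have hdq : (d : ℝ) ≤ q ^ 2 / 2 := by
    have : 2 * (d : ℝ) ≤ m * q := by
      rw [hw] at hd
      exact_mod_cast hd
    linarith
  have hd' : (1 : ℝ) ≤ d := by exact_mod_cast hd0
  have hlm : Real.log m ≤ L := by
    have := log_le_mul_log (q := q) (x := m) (by linarith) 1 (by linarith)
    rw [hLq] at this
    simpa using this
  have hld : Real.log d ≤ 2 * L := by
    have := log_le_mul_log (q := q) (x := d) (by linarith) 2 (by linarith)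
    rw [hLq] at this
    exact_mod_cast this
  have hlw : Real.log (m ^ (r - 1) + 1 : ℕ) ≤ 3 * L := by
    have := log_le_mul_log (q := q) (x := (m ^ (r - 1) + 1 : ℕ)) (by positivity) 3 (by
      rw [hw]
      push_cast
      nlinarith [sq_nonneg (q : ℝ)])
    rw [hLq] at this
    exact_mod_cast this
  have hlP : Real.log (m * d + 1 : ℕ) ≤ 4 * L := by
    have := log_le_mul_log (q := q) (x := (m * d + 1 : ℕ)) (by positivity) 4 (by
      push_cast
      have h1 : (m : ℝ) * d ≤ q * (q ^ 2 / 2) := by gcongr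
      have h2 : (1 : ℝ) ≤ q ^ 3 := one_le_pow₀ (by linarith)
      have h3 : 2 * (q : ℝ) ^ 3 ≤ q ^ 4 := by
        rw [pow_succ _ 3, mul_comm]
        gcongr
      nlinarith)
    rw [hLq] at this
    exact_mod_cast this
  have hK : 2 < r * L := by
    have : (3 : ℝ) ≤ r := by exact_mod_cast hr
    nlinarith
  have hL3 : 24 * L ^ 2 ≤ q := by
    refine le_trans ?_ hq
    calc 24 * L ^ 2 ≤ L * L ^ 2 := by gcongr; linarith
      _ = L ^ 3 := by ring
      _ ≤ L ^ 27 := pow_le_pow_right₀ (by linarith) (by norm_num)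
  have hKw : 8 * (r * L) * m ≤ (m ^ (r - 1) : ℕ) := by
    rw [hw]
    push_cast
    calc 8 * (r * L) * m ≤ 8 * (3 * L * L) * m := by gcongr
      _ = m * (24 * L ^ 2) := by ring
      _ ≤ m * q := by gcongr
  have key : ∀ δ Δ : ℝ, 0 ≤ δ → 0 ≤ Δ → r * stepCost m (m * q) d (r * L) δ Δ ≤ 1 / L →
      (∀ (A : Finset (Fin r)) (c : Fin r) (D : Fin m → ℕ),
        ((m ^ (r - 1)).choose d : ℝ) ^ m
          ≤ Real.exp m * (r * L) * (((m * d + 1 : ℕ) : ℝ) ^ m) ^ (r + 1)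
            * (degFam A d c D).card → ∀ u v, u ≠ v →
        ((1 - δ) * (D u * D v) / (m : ℝ) ^ (r - 1) - Δ) * (degFam A d c D).card
          ≤ totalCodeg A d c D u v) →
      ∃ b, 1 - 3 / L ≤ b ∧ b ≤ Hcount r m d / Hhat r m d ∧
        b * (Hcount r m d / Hhat r m d) ≤ 1 := by
    intro δ Δ hδ hΔ hcost hT
    have h := card_regFam_bounds (ι := Fin r) (m := m) (d := d) (K := r * L) (δ := δ) (Δ := Δ)
      (by omega) (by simpa using (by omega : 0 < r)) hd0 (by simpa using hd) hK
      (by simpa using hKw) hδ hΔ (by simpa using hT) Finset.univ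
    simp only [Fintype.card_fin, Finset.card_univ] at h
    exact ⟨_, pow_of_stepCost_le (by omega) (by linarith) (by rw [hw]; exact hcost),
      ratio_bounds (by omega) hd h⟩
  rcases le_total (d * L ^ 5) q with hdL | hdL
  · refine key 1 0 zero_le_one le_rfl
      (stepCost_trivial (by omega) (by linarith) (by linarith) (by omega) hrL hdL) ?_
    intro A c D _ u v _
    simpa using totalCodeg_nonneg A d c D u v
  · have hd22 : L ^ 22 ≤ d := by
      refine le_of_mul_le_mul_right (le_trans (le_of_eq ?_) (hq.trans hdL)) (pow_pos hL0 5)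
      ring
    have hd21 : L ^ 21 ≤ d := (pow_le_pow_right₀ (by linarith) (by norm_num)).trans hd22
    have hd2 : 100 * L ≤ d := by
      calc 100 * L ≤ L * L := by gcongr; linarith
        _ = L ^ 2 := by ring
        _ ≤ L ^ 22 := pow_le_pow_right₀ (by linarith) (by norm_num)
        _ ≤ d := hd22
    obtain ⟨g, hg1, hg2⟩ : ∃ g : ℕ, d ≤ g * L ^ 21 ∧ g * L ^ 21 ≤ 2 * d := by
      have h0 : 0 < L ^ 21 := by positivity
      have h1 := Nat.le_ceil (d / L ^ 21)
      have h2 := Nat.ceil_lt_add_one (show 0 ≤ d / L ^ 21 by positivity)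
      refine ⟨⌈d / L ^ 21⌉₊, (div_le_iff₀ h0).1 h1, ?_⟩
      calc (⌈d / L ^ 21⌉₊ : ℝ) * L ^ 21 ≤ (d / L ^ 21 + 1) * L ^ 21 := by gcongr
        _ = d + L ^ 21 := by field_simp
        _ ≤ 2 * d := by linarith
    have hg0 : 0 < g := by
      rcases Nat.eq_zero_or_pos g with h | h
      · rw [h, Nat.cast_zero, zero_mul] at hg1
        linarith
      · exact h
    obtain ⟨K, hK1, hK2⟩ : ∃ K : ℕ, 46 * L ^ 7 ≤ K ∧ K ≤ 47 * L ^ 7 := by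
      have h1 := Nat.le_ceil (46 * L ^ 7)
      have h2 := Nat.ceil_lt_add_one (show 0 ≤ 46 * L ^ 7 by positivity)
      have h3 : 1 ≤ L ^ 7 := one_le_pow₀ (by linarith)
      exact ⟨_, h1, by linarith⟩
    refine key (r / g) (2 * g * (3 * ((K : ℝ) ^ 2 + 1)) / m) (by positivity) (by positivity)
      (stepCost_nontrivial (by omega) hd0 hL hq (by omega) hrL hld hg1 hg2 hK2) ?_
    intro A c D hN u v huv
    have h := le_totalCodeg_of_card_ge hm A d D huv hg0 (K := K) (x := Real.exp (d / 2))
      (Real.one_le_exp (by positivity)) (by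
        rw [Fintype.card_fin]
        exact exp_threshold_le_choose (by omega) hd hL hlm hlw hd2 hg2)
      (threshold_le_exp_pow (by omega) (by omega) (by linarith) hlm hlP hrL (hmq'.trans hdL) hK1)
      (by rw [Fintype.card_fin]; exact hN)
    rw [Fintype.card_fin] at h
    exact h

end Ratio

section Limit

theorem ratio_of_zero_or_full {r m d : ℕ} (hr : 0 < r) (hd : d = 0 ∨ d = m ^ (r - 1)) :
    (Hcount r m d : ℝ) / Hhat r m d = 1 := by
  rcases hd with rfl | rfl
  · rw [Hcount_zero hr, Hhat_zero]
    simp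
  · rw [← Hcount_compl le_rfl, ← Hhat_compl hr le_rfl, Nat.sub_self, Hcount_zero hr, Hhat_zero]
    simp

theorem abs_ratio_sub_one_le {r m d : ℕ} (hr : 3 ≤ r) (hm : 2 ≤ m) (hd : d ≤ m ^ (r - 1)) {L : ℝ}
    (hLq : Real.log (m ^ (r - 2) : ℕ) = L) (hL : 100000 ≤ L)
    (hq : L ^ 27 ≤ (m ^ (r - 2) : ℕ)) :
    |(Hcount r m d : ℝ) / Hhat r m d - 1| ≤ 6 / L := by
  have hL0 : 0 < L := by linarith
  wlog h2 : 2 * d ≤ m ^ (r - 1) generalizing d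
  · rw [← Hcount_compl hd, ← Hhat_compl (by omega) hd]
    exact this (Nat.sub_le _ _) (by omega)
  rcases Nat.eq_zero_or_pos d with h0 | h0
  · rw [ratio_of_zero_or_full (by omega) (Or.inl h0)]
    simp only [sub_self, abs_zero]
    positivity
  obtain ⟨b, hb1, hb2, hb3⟩ := exists_ratio_bound hr hm h0 h2 hLq hL hq
  generalize (Hcount r m d : ℝ) / Hhat r m d = ρ at *
  have h3 : 3 / L ≤ 1 / 2 := by
    rw [div_le_iff₀ hL0]
    linarith
  have h4 : 6 / L = 2 * (3 / L) := by ring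
  have h5 : 0 ≤ 3 / L := by positivity
  rw [h4, abs_le]
  generalize 3 / L = e at *
  constructor
  · linarith
  · by_contra! h6
    nlinarith

theorem mul_le_two_mul_sq {r m : ℕ} (hr : 3 ≤ r) (hm : 2 ≤ m) :
    r * m ≤ 2 * (m ^ (r - 2)) ^ 2 := by
  have h1 : m ≤ m ^ (r - 2) := Nat.le_self_pow (by omega) m
  have h2 : r - 2 < m ^ (r - 2) := Nat.lt_pow_self (by omega)
  calc r * m ≤ (2 * m ^ (r - 2)) * m ^ (r - 2) := Nat.mul_le_mul (by omega) h1
    _ = 2 * (m ^ (r - 2)) ^ 2 := by ring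

theorem eventually_log_bounds {ε : ℝ} (hε : 0 < ε) :
    ∀ᶠ q : ℕ in atTop, 100000 ≤ Real.log q ∧ Real.log q ^ 27 ≤ q ∧ 6 / Real.log q < ε := by
  have hlog : Tendsto (fun q : ℕ => Real.log q) atTop atTop :=
    Real.tendsto_log_atTop.comp tendsto_natCast_atTop_atTop
  have h1 := hlog.eventually_ge_atTop 100000
  have h2 := hlog.eventually_gt_atTop (6 / ε)
  have h3 := tendsto_natCast_atTop_atTop.eventually
    ((Real.isLittleO_pow_log_id_atTop (n := 27)).bound one_pos)
  filter_upwards [h1, h2, h3] with q h1 h2 h3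
  refine ⟨h1, ?_, ?_⟩
  · simp only [id, one_mul, Real.norm_eq_abs, Nat.abs_cast] at h3
    exact (le_abs_self _).trans h3
  · rw [div_lt_iff₀ hε] at h2
    rw [div_lt_iff₀ (by linarith)]
    linarith

end Limit

/-- if `n = r(n)·m(n) → ∞`, `r ≥ 3`, `m ≥ 1` and `0 ≤ d ≤ m^(r-1)`,
then `H_r(d,m) = (1+o(1))·Ĥ_r(d,m)`. -/
theorem regular_multipartite_hypergraph_count
    (r m d : ℕ → ℕ)
    (hr : ∀ k, 3 ≤ r k) (hm : ∀ k, 1 ≤ m k)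
    (hn : Tendsto (fun k => r k * m k) atTop atTop)
    (hd : ∀ k, d k ≤ (m k) ^ (r k - 1)) :
    Tendsto (fun k => (Hcount (r k) (m k) (d k) : ℝ) / Hhat (r k) (m k) (d k))
      atTop (nhds 1) := by
  rw [Metric.tendsto_nhds]
  intro ε hε
  obtain ⟨Q, hQ⟩ := eventually_atTop.1 (eventually_log_bounds hε)
  filter_upwards [hn.eventually_gt_atTop (2 * Q ^ 2)] with k hk
  rw [Real.dist_eq]
  rcases (hm k).eq_or_lt with h1 | h1
  · have h2 := hd k
    rw [ratio_of_zero_or_full (by have := hr k; omega) (by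
      rw [← h1, one_pow] at h2 ⊢
      omega)]
    simpa using hε
  · have h2 : Q ≤ m k ^ (r k - 2) := by
      by_contra! h3
      have h4 := mul_le_two_mul_sq (hr k) h1
      have h5 := Nat.pow_le_pow_left h3.le 2
      omega
    obtain ⟨h3, h4, h5⟩ := hQ _ h2
    exact (abs_ratio_sub_one_le (hr k) h1 (hd k) rfl h3 h4).trans_lt h5
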